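/- In G(𝒜): if x ∈ G(𝒜) satisfies u_A(x,c) = e and u_A(x,d) = e, then x is the image in G(𝒜) of one of the generators a with a ∈ A. -/

import Mathlib

/-!
Common setup: an `L`-structure `𝒜` for a language whose symbols are enumerated
(`m`-th symbol, `m ≥ 1`, each a function or relation symbol of arity ≥ 1), and the
presented group `G(𝒜)` of Harrison-Trainor and Ho.
-/

/-- A first-order language with symbols enumerated by `ℕ` (the `m`-th symbol, for `m ≥ 1`,
is a function symbol if `isFunc m`, and a relation symbol otherwise, of arity `arity m ≥ 1`),
together with an interpretation on a domain `A`: `funcInterp m` interprets the `m`-th symbol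
when it is a function symbol, and `relInterp m` when it is a relation symbol. -/
structure IndexedStructure where
  A : Type
  arity : ℕ → ℕ
  arity_pos : ∀ m, 1 ≤ m → 1 ≤ arity m
  isFunc : ℕ → Prop
  funcInterp : ∀ m, (Fin (arity m) → A) → A
  relInterp : ∀ m, (Fin (arity m) → A) → Prop

/-- The generating set of `G(𝒜)`: one generator for each element of the domain `A`,
plus five further generators `b`, `c`, `d`, `f₁`, `f₂`. -/
inductive GenSym (A : Type) : Type
  | elt : A → GenSym A
  | b : GenSym A
  | c : GenSym A
  | d : GenSym A
  | f1 : GenSym A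
  | f2 : GenSym A

/-- `chainProd lo x y = x y^{(lo+1)²} x y^{(lo+2)²} ⋯ x y^{(lo+1000)²}`.
So `u_A = chainProd 0`, `u_b = chainProd 1000`, `u_c = chainProd 2000`,
`u_d = chainProd 3000`, and `v = chainProd 4000`. -/
def chainProd {G : Type*} [Group G] (lo : ℕ) (x y : G) : G :=
  ((List.range 1000).map fun k => x * y ^ ((lo + k + 1) ^ 2)).prod

/-- `wProd m xs y = x₁⋯xₙ y^{100m+1} x₁⋯xₙ y^{100m+2} ⋯ x₁⋯xₙ y^{100m+100}`,
i.e. the word `w_m(x₁,…,xₙ,y)`. -/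
def wProd {G : Type*} [Group G] (m : ℕ) {n : ℕ} (xs : Fin n → G) (y : G) : G :=
  ((List.range 100).map fun k => (List.ofFn xs).prod * y ^ (100 * m + k + 1)).prod

/-- The set of relators of the presentation of `G(𝒜)`. -/
def grpRels (S : IndexedStructure) (p₁ p₂ : ℕ) : Set (FreeGroup (GenSym S.A)) :=
  {FreeGroup.of GenSym.f1 ^ p₁, FreeGroup.of GenSym.f2 ^ p₂,
    chainProd 4000 (FreeGroup.of GenSym.f1) (FreeGroup.of GenSym.f2),
    chainProd 4000 (FreeGroup.of GenSym.f2) (FreeGroup.of GenSym.f1),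
    chainProd 1000 (FreeGroup.of GenSym.b) (FreeGroup.of GenSym.f1),
    chainProd 1000 (FreeGroup.of GenSym.b) (FreeGroup.of GenSym.f2),
    chainProd 2000 (FreeGroup.of GenSym.c) (FreeGroup.of GenSym.f1),
    chainProd 2000 (FreeGroup.of GenSym.c) (FreeGroup.of GenSym.f2),
    chainProd 3000 (FreeGroup.of GenSym.d) (FreeGroup.of GenSym.f1),
    chainProd 3000 (FreeGroup.of GenSym.d) (FreeGroup.of GenSym.f2)}
  ∪ {r | ∃ a : S.A,
      r = chainProd 0 (FreeGroup.of (GenSym.elt a)) (FreeGroup.of GenSym.c) ∨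
      r = chainProd 0 (FreeGroup.of (GenSym.elt a)) (FreeGroup.of GenSym.d)}
  ∪ {r | ∃ m, 1 ≤ m ∧ S.isFunc m ∧ ∃ as : Fin (S.arity m) → S.A,
      r = wProd m (fun i => FreeGroup.of (GenSym.elt (as i))) (FreeGroup.of GenSym.b) *
        (FreeGroup.of (GenSym.elt (S.funcInterp m as)))⁻¹}
  ∪ {r | ∃ m, 1 ≤ m ∧ ¬ S.isFunc m ∧ ∃ as : Fin (S.arity m) → S.A,
      S.relInterp m as ∧
      r = wProd m (fun i => FreeGroup.of (GenSym.elt (as i))) (FreeGroup.of GenSym.b)}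

/-- The group `G(𝒜)`, presented on the generators `GenSym A` with relators `grpRels`. -/
abbrev GA (S : IndexedStructure) (p₁ p₂ : ℕ) : Type :=
  PresentedGroup (grpRels S p₁ p₂)

/-- The image in `G(𝒜)` of a generator. -/
def gen (S : IndexedStructure) (p₁ p₂ : ℕ) (g : GenSym S.A) : GA S p₁ p₂ :=
  PresentedGroup.of g


set_option linter.unusedSectionVars false

namespace SC
open List

variable {α : Type} {G : Type} [Group G]

/-- inverse letter -/
def iL (x : α × Bool) : α × Bool := (x.1, !x.2)

@[simp] theorem iL_iL (x : α × Bool) : iL (iL x) = x := by simp [iL]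
theorem iL_ne (x : α × Bool) : iL x ≠ x := by
  intro h; have := congrArg Prod.snd h; simp [iL] at this

/-- inverse word -/
def iW (w : List (α × Bool)) : List (α × Bool) := (w.map iL).reverse

@[simp] theorem iW_nil : iW ([] : List (α × Bool)) = [] := rfl
@[simp] theorem iW_iW (w : List (α × Bool)) : iW (iW w) = w := by
  simp [iW, Function.comp_def]
@[simp] theorem iW_append (u v : List (α × Bool)) : iW (u ++ v) = iW v ++ iW u := by simp [iW]
@[simp] theorem iW_cons (x) (v : List (α × Bool)) : iW (x :: v) = iW v ++ [iL x] := by simp [iW]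
@[simp] theorem iW_length (u : List (α × Bool)) : (iW u).length = u.length := by simp [iW]
theorem iW_eq_invRev (u : List (α × Bool)) : iW u = FreeGroup.invRev u := rfl

/-- evaluation of words -/
def ev (f : FreeGroup α →* G) (w : List (α × Bool)) : G := f (FreeGroup.mk w)

@[simp] theorem ev_nil (f : FreeGroup α →* G) : ev f [] = 1 := by
  unfold ev; rw [← FreeGroup.one_eq_mk]; simp
@[simp] theorem ev_append (f : FreeGroup α →* G) (u v) : ev f (u ++ v) = ev f u * ev f v := by
  unfold ev; rw [← FreeGroup.mul_mk, map_mul]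
theorem ev_cons (f : FreeGroup α →* G) (x v) : ev f (x :: v) = ev f [x] * ev f v := by
  rw [← ev_append]; rfl
@[simp] theorem ev_iW (f : FreeGroup α →* G) (u) : ev f (iW u) = (ev f u)⁻¹ := by
  unfold ev; rw [iW_eq_invRev, ← FreeGroup.inv_mk, map_inv]
theorem ev_iL (f : FreeGroup α →* G) (x) : ev f [iL x] = (ev f [x])⁻¹ := by
  rw [← ev_iW]; simp

/-- Small cancellation hypotheses -/
structure Sys (R : Set (List (α × Bool))) (N : ℕ) (f : FreeGroup α →* G) : Prop where
  hN : 6 ≤ N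
  len : ∀ r ∈ R, 2 ≤ r.length
  red : ∀ x y t, x :: y :: t ∈ R → y ≠ iL x
  rot : ∀ u v, u ++ v ∈ R → v ++ u ∈ R
  inv : ∀ r ∈ R, iW r ∈ R
  noninv : ∀ u v, u ++ v ∈ R → v ++ u ≠ iW (u ++ v)
  piece : ∀ s t₁ t₂, s ++ t₁ ∈ R → s ++ t₂ ∈ R → t₁ ≠ t₂ → N * s.length ≤ (s ++ t₁).length
  one : ∀ r ∈ R, ev f r = 1

/-- diagrams -/
structure Dg (α G : Type) where
  o : List ℕ
  inn : List (List ℕ)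
  lab : ℕ → α × Bool
  ε : ℕ → ℕ
  vt : ℕ → ℕ
  pot : ℕ → G
  v0 : ℕ

def Dg.all (D : Dg α G) : List ℕ := D.o ++ D.inn.flatten

def Dg.Path (D : Dg α G) : ℕ → List ℕ → ℕ → Prop
  | p, [], q => p = q
  | p, d :: l, q => D.vt d = p ∧ D.Path (D.vt (D.ε d)) l q

theorem Dg.path_append (D : Dg α G) (p q : ℕ) (l l' : List ℕ) :
    D.Path p (l ++ l') q ↔ ∃ r, D.Path p l r ∧ D.Path r l' q := by
  induction l generalizing p with
  | nil => simp [Dg.Path]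
  | cons d l ih => simp [Dg.Path, ih, and_assoc]

theorem Dg.path_cons (D : Dg α G) (p q d : ℕ) (l : List ℕ) :
    D.Path p (d :: l) q ↔ D.vt d = p ∧ D.Path (D.vt (D.ε d)) l q := Iff.rfl

theorem Dg.path_congr (D D' : Dg α G) (p q : ℕ) (l : List ℕ)
    (h : ∀ d ∈ l, D'.vt d = D.vt d ∧ D'.vt (D'.ε d) = D.vt (D.ε d))
    (hp : D.Path p l q) : D'.Path p l q := by
  induction l generalizing p with
  | nil => exact hp
  | cons d l ih =>
    obtain ⟨h1, h2⟩ := hp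
    refine ⟨by rw [(h d (by simp)).1, h1], ?_⟩
    rw [(h d (by simp)).2]
    exact ih _ (fun e he => h e (by simp [he])) h2

theorem Dg.path_map (D D' : Dg α G) (ρ : ℕ → ℕ) (p q : ℕ) (l : List ℕ)
    (h : ∀ d, D'.vt d = ρ (D.vt d)) (h' : D'.ε = D.ε)
    (hp : D.Path p l q) : D'.Path (ρ p) l (ρ q) := by
  induction l generalizing p with
  | nil => exact congrArg ρ hp
  | cons d l ih =>
    obtain ⟨h1, h2⟩ := hp
    refine ⟨by rw [h, h1], ?_⟩
    rw [h, h']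
    exact ih _ h2

def Dg.verts (D : Dg α G) : Finset ℕ := insert D.v0 (D.all.toFinset.image D.vt)

/-- the two darts form a mirror pair -/
def Dg.Mir (D : Dg α G) (d d' : ℕ) : Prop :=
  ∃ a b a' b', a ++ d :: b ∈ D.inn ∧ a' ++ d' :: b' ∈ D.inn ∧
    (b' ++ a').map D.lab = iW ((b ++ a).map D.lab)

structure Dg.OK (D : Dg α G) (R : Set (List (α × Bool))) (f : FreeGroup α →* G) (k : ℕ) : Prop where
  nd : D.all.Nodup
  εm : ∀ d ∈ D.all, D.ε d ∈ D.all
  εε : ∀ d ∈ D.all, D.ε (D.ε d) = d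
  εl : ∀ d ∈ D.all, D.lab (D.ε d) = iL (D.lab d)
  po : D.Path D.v0 D.o D.v0
  pi : ∀ l ∈ D.inn, ∃ p, D.Path p l p
  wi : ∀ l ∈ D.inn, l.map D.lab ∈ R
  pt : ∀ d ∈ D.all, D.pot (D.vt (D.ε d)) = D.pot (D.vt d) * ev f [D.lab d]
  eul : D.all.length + 4 ≤ 2 * D.verts.card + 2 * (D.inn.length + 1) + k
  rd : ∀ d ∈ D.all, ¬ D.Mir d (D.ε d)

def HasD (R : Set (List (α × Bool))) (f : FreeGroup α →* G) (n : ℕ) (w : List (α × Bool)) : Prop :=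
  ∃ D : Dg α G, D.OK R f 0 ∧ D.inn.length ≤ n ∧ D.o.map D.lab = w

variable {R : Set (List (α × Bool))} {f : FreeGroup α →* G}

theorem hasD_nil [Inhabited α] : HasD R f 0 ([] : List (α × Bool)) := by
  refine ⟨⟨[], [], fun _ => (default, true), id, id, fun _ => 1, 0⟩, ?_, by simp, by simp⟩
  constructor <;> simp [Dg.all, Dg.Path, Dg.verts]

theorem Dg.path_pot (D : Dg α G) {k} (h : D.OK R f k) (p q : ℕ) (l : List ℕ) (hl : ∀ d ∈ l, d ∈ D.all)
    (hp : D.Path p l q) : D.pot q = D.pot p * ev f (l.map D.lab) := by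
  induction l generalizing p with
  | nil => simp [Dg.Path] at hp; simp [hp]
  | cons d l ih =>
    obtain ⟨h1, h2⟩ := hp
    rw [ih _ (fun e he => hl e (by simp [he])) h2, h.pt d (hl d (by simp)), h1, map_cons,
      ev_cons f (D.lab d) (map D.lab l), mul_assoc]

/-- permuting the inner faces -/
theorem Dg.OK.perm (D : Dg α G) {k} (h : D.OK R f k) (L : List (List ℕ)) (hL : D.inn.Perm L) :
    Dg.OK { D with inn := L } R f k := by
  have hall : (Dg.all { D with inn := L }).Perm D.all := by
    simp only [Dg.all]
    exact (hL.flatten.append_left _).symm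
  have hmem : ∀ l, l ∈ L ↔ l ∈ D.inn := fun l => hL.symm.mem_iff
  have hm : ∀ d, d ∈ Dg.all { D with inn := L } ↔ d ∈ D.all := fun d => hall.mem_iff
  have hP : ∀ p q l, Dg.Path { D with inn := L } p l q ↔ D.Path p l q := by
    intro p q l
    exact ⟨Dg.path_congr _ _ _ _ _ (fun d _ => ⟨rfl, rfl⟩), Dg.path_congr _ _ _ _ _ (fun d _ => ⟨rfl, rfl⟩)⟩
  constructor
  · exact hall.nodup_iff.mpr h.nd
  · intro d hd; rw [hm] at hd ⊢; exact h.εm d hd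
  · intro d hd; rw [hm] at hd; exact h.εε d hd
  · intro d hd; rw [hm] at hd; exact h.εl d hd
  · rw [hP]; exact h.po
  · intro l hl
    obtain ⟨p, hp⟩ := h.pi l ((hmem l).1 hl)
    exact ⟨p, (hP _ _ _).2 hp⟩
  · intro l hl; exact h.wi l ((hmem l).1 hl)
  · intro d hd; rw [hm] at hd; exact h.pt d hd
  · have : Dg.verts { D with inn := L } = D.verts := by
      simp only [Dg.verts]; congr 2; ext d; simp [hm]
    rw [this, hall.length_eq]
    simpa [hL.length_eq] using h.eul
  · rintro d hd ⟨a, b, a', b', h1, h2, h3⟩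
    rw [hm] at hd
    exact h.rd d hd ⟨a, b, a', b', (hmem _).1 h1, (hmem _).1 h2, h3⟩

/-- merging two vertices with equal potential -/
def Dg.merge (D : Dg α G) (p p' : ℕ) : Dg α G :=
  { D with vt := fun d => if D.vt d = p' then p else D.vt d, v0 := if D.v0 = p' then p else D.v0 }

theorem Dg.OK.merge (D : Dg α G) {k} (h : D.OK R f k) (p p' : ℕ) (hp : D.pot p = D.pot p') :
    (D.merge p p').OK R f (k + 2) := by
  set ρ : ℕ → ℕ := fun v => if v = p' then p else v with hρ
  have hv : ∀ d, (D.merge p p').vt d = ρ (D.vt d) := fun d => rfl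
  have hpot : ∀ v, D.pot (ρ v) = D.pot v := by
    intro v; simp only [hρ]; split_ifs with h1
    · rw [hp, h1]
    · rfl
  constructor
  · exact h.nd
  · exact h.εm
  · exact h.εε
  · exact h.εl
  · exact Dg.path_map D _ ρ _ _ _ hv rfl h.po
  · intro l hl
    obtain ⟨q, hq⟩ := h.pi l hl
    exact ⟨ρ q, Dg.path_map D _ ρ _ _ _ hv rfl hq⟩
  · exact h.wi
  · intro d hd
    rw [hv, hv]
    show D.pot (ρ _) = D.pot (ρ _) * _
    rw [hpot, hpot]; exact h.pt d hd
  · have hsub : D.verts ⊆ insert p' (D.merge p p').verts := by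
      intro v hvv
      by_cases hvp : v = p'
      · simp [hvp]
      · simp only [Dg.verts, Finset.mem_insert, Finset.mem_image, List.mem_toFinset] at hvv ⊢
        right
        rcases hvv with rfl | ⟨d, hd, rfl⟩
        · left; simp [Dg.merge, hvp]
        · right; exact ⟨d, hd, by simp [Dg.merge, hvp]⟩
    have := (Finset.card_le_card hsub).trans (Finset.card_insert_le _ _)
    have h2 := h.eul
    show D.all.length + 4 ≤ 2 * (D.merge p p').verts.card + 2 * (D.inn.length + 1) + (k + 2)
    omega
  · exact h.rd

end SC

set_option linter.unusedSectionVars false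
namespace SC
open List
variable {α : Type} {G : Type} [Group G]
variable {R : Set (List (α × Bool))} {f : FreeGroup α →* G}

/-- spur insertion -/
theorem Dg.OK.spur (D : Dg α G) {k} (h : D.OK R f k) (u v : List ℕ) (x : α × Bool)
    (ho : D.o = u ++ v) : ∃ (D' : Dg α G) (m m' : ℕ), D'.OK R f k ∧ D'.inn = D.inn ∧
      D'.o = u ++ m :: m' :: v ∧ (∀ d ∈ D.all, D'.lab d = D.lab d ∧ D'.ε d = D.ε d) ∧
      D'.lab m = x ∧ D'.lab m' = iL x ∧ D'.ε m' = m := by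
  obtain ⟨m, hm⟩ := Infinite.exists_notMem_finset (D.all.toFinset)
  obtain ⟨m', hm'⟩ := Infinite.exists_notMem_finset (insert m D.all.toFinset)
  obtain ⟨nv, hnv⟩ := Infinite.exists_notMem_finset D.verts
  simp only [Finset.mem_insert, List.mem_toFinset, not_or] at hm hm'
  obtain ⟨hmm, hm'⟩ := hm'
  have hpo := h.po
  rw [ho, Dg.path_append] at hpo
  obtain ⟨p, hpu, hpv⟩ := hpo
  have hne : ∀ d ∈ D.all, d ≠ m ∧ d ≠ m' := fun d hd => ⟨fun e => hm (e ▸ hd), fun e => hm' (e ▸ hd)⟩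
  have hvv : ∀ d ∈ D.all, D.vt d ∈ D.verts := fun d hd => by
    simp only [Dg.verts, Finset.mem_insert, Finset.mem_image, List.mem_toFinset]
    exact Or.inr ⟨d, hd, rfl⟩
  have hv0 : D.v0 ∈ D.verts := by simp [Dg.verts]
  have hp : p ∈ D.verts := by
    cases v with
    | nil => rw [show p = D.v0 from hpv]; exact hv0
    | cons e v =>
      rw [← hpv.1]; apply hvv; simp [Dg.all, ho]
  have hpnv : p ≠ nv := fun e => hnv (e ▸ hp)
  set D' : Dg α G :=
    { o := u ++ m :: m' :: v
      inn := D.inn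
      lab := Function.update (Function.update D.lab m x) m' (iL x)
      ε := Function.update (Function.update D.ε m m') m' m
      vt := Function.update (Function.update D.vt m p) m' nv
      pot := Function.update D.pot nv (D.pot p * ev f [x])
      v0 := D.v0 } with hD'
  have lm : D'.lab m = x := by simp [hD', Ne.symm hmm]
  have lm' : D'.lab m' = iL x := by simp [hD']
  have em : D'.ε m = m' := by simp [hD', Ne.symm hmm]
  have em' : D'.ε m' = m := by simp [hD']
  have vm : D'.vt m = p := by simp [hD', Ne.symm hmm]
  have vm' : D'.vt m' = nv := by simp [hD']
  have lo : ∀ d ∈ D.all, D'.lab d = D.lab d := fun d hd => by simp [hD', hne d hd]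
  have eo : ∀ d ∈ D.all, D'.ε d = D.ε d := fun d hd => by simp [hD', hne d hd]
  have vo : ∀ d ∈ D.all, D'.vt d = D.vt d := fun d hd => by simp [hD', hne d hd]
  have vo' : ∀ d ∈ D.all, D'.vt d = D.vt d ∧ D'.vt (D'.ε d) = D.vt (D.ε d) := fun d hd => by
    rw [eo d hd]; exact ⟨vo d hd, vo _ (h.εm d hd)⟩
  have pto : ∀ v ∈ D.verts, D'.pot v = D.pot v := fun v hv => by
    have : v ≠ nv := fun e => hnv (e ▸ hv)
    simp [hD', this]
  have ptn : D'.pot nv = D.pot p * ev f [x] := by simp [hD']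
  have hall : D'.all.Perm (m :: m' :: D.all) := by
    simp only [Dg.all, hD', ho]
    rw [List.perm_iff_count]; intro a; simp [List.count_append, List.count_cons]; omega
  have hmem : ∀ d, d ∈ D'.all ↔ d = m ∨ d = m' ∨ d ∈ D.all := fun d => by
    rw [hall.mem_iff]; simp
  refine ⟨D', m, m', ?_, rfl, rfl, fun d hd => ⟨lo d hd, eo d hd⟩, lm, lm', em'⟩
  have hinn : ∀ l ∈ D.inn, ∀ d ∈ l, d ∈ D.all := fun l hl d hd => by
    simp only [Dg.all, mem_append, mem_flatten]; exact Or.inr ⟨l, hl, hd⟩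
  constructor
  · rw [hall.nodup_iff]; simp [hm, hm', Ne.symm hmm, h.nd]
  · intro d hd
    rw [hmem] at hd ⊢
    rcases hd with rfl | rfl | hd
    · simp [em]
    · simp [em']
    · rw [eo d hd]; exact Or.inr (Or.inr (h.εm d hd))
  · intro d hd
    rw [hmem] at hd
    rcases hd with rfl | rfl | hd
    · rw [em, em']
    · rw [em', em]
    · rw [eo d hd, eo _ (h.εm d hd), h.εε d hd]
  · intro d hd
    rw [hmem] at hd
    rcases hd with rfl | rfl | hd
    · rw [em, lm', lm]
    · rw [em', lm, lm']; simp
    · rw [eo d hd, lo _ (h.εm d hd), lo d hd, h.εl d hd]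
  · show D'.Path D.v0 (u ++ m :: m' :: v) D.v0
    rw [Dg.path_append]
    refine ⟨p, Dg.path_congr D D' _ _ _ (fun d hd => vo' d (by simp [Dg.all, ho, hd])) hpu, vm, ?_, ?_⟩
    · rw [em]
    · rw [em', vm]
      exact Dg.path_congr D D' _ _ _ (fun d hd => vo' d (by simp [Dg.all, ho, hd])) hpv
  · intro l hl
    obtain ⟨q, hq⟩ := h.pi l hl
    exact ⟨q, Dg.path_congr D D' _ _ _ (fun d hd => vo' d (hinn l hl d hd)) hq⟩
  · intro l hl
    have : l.map D'.lab = l.map D.lab := List.map_congr_left (fun d hd => lo d (hinn l hl d hd))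
    rw [this]; exact h.wi l hl
  · intro d hd
    rw [hmem] at hd
    rcases hd with rfl | rfl | hd
    · rw [em, vm, vm', ptn, lm, pto p hp]
    · rw [em', vm, vm', ptn, lm', pto p hp, ev_iL]; simp
    · rw [(vo' d hd).2, vo d hd, lo d hd, pto _ (hvv d hd), pto _ (hvv _ (h.εm d hd)), h.pt d hd]
  · have hsub : insert nv D.verts ⊆ D'.verts := by
      intro v hv
      rw [Finset.mem_insert] at hv
      simp only [Dg.verts, Finset.mem_insert, Finset.mem_image, List.mem_toFinset, hmem] at hv ⊢
      rcases hv with rfl | rfl | ⟨d, hd, rfl⟩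
      · exact Or.inr ⟨m', by simp, vm'⟩
      · left; rfl
      · right; exact ⟨d, by simp [hd], vo d hd⟩
    have h1 := Finset.card_le_card hsub
    rw [Finset.card_insert_of_notMem hnv] at h1
    have h2 := h.eul
    have h3 := hall.length_eq
    simp only [List.length_cons] at h3
    show D'.all.length + 4 ≤ 2 * D'.verts.card + 2 * (D.inn.length + 1) + k
    omega
  · rintro d hd ⟨a, b, a', b', h1, h2, h3⟩
    have hda : d ∈ D.all := hinn _ h1 d (by simp)
    refine h.rd d hda ⟨a, b, a', b', h1, by rw [← eo d hda]; exact h2, ?_⟩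
    have e1 : (b' ++ a').map D'.lab = (b' ++ a').map D.lab :=
      List.map_congr_left (fun e he => lo e (hinn _ h2 e (by
        simp only [mem_append, mem_cons] at he ⊢; tauto)))
    have e2 : (b ++ a).map D'.lab = (b ++ a).map D.lab :=
      List.map_congr_left (fun e he => lo e (hinn _ h1 e (by
        simp only [mem_append, mem_cons] at he ⊢; tauto)))
    rw [← e1, ← e2, h3]

/-- deleting an adjacent mated pair -/
theorem Dg.OK.del (D : Dg α G) {k} (h : D.OK R f k) (u v : List ℕ) (x x' : ℕ)
    (ho : D.o = u ++ x :: x' :: v) (hx : D.ε x = x') : 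
    Dg.OK { D with o := u ++ v } R f k := by
  set D' : Dg α G := { D with o := u ++ v } with hD'
  have hall : D.all.Perm (x :: x' :: D'.all) := by
    simp only [Dg.all, hD', ho]
    rw [List.perm_iff_count]; intro a; simp [List.count_append, List.count_cons]; omega
  have hmem : ∀ d, d ∈ D.all ↔ d = x ∨ d = x' ∨ d ∈ D'.all := fun d => by
    rw [hall.mem_iff]; simp
  have hnd := h.nd
  rw [hall.nodup_iff] at hnd
  simp only [nodup_cons, mem_cons, not_or] at hnd
  obtain ⟨⟨hxx, hx1⟩, hx2, hnd⟩ := hnd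
  have hx' : D.ε x' = x := by rw [← hx, h.εε]; simp [hmem]
  have hin : ∀ d ∈ D'.all, d ∈ D.all := fun d hd => by simp [hmem, hd]
  have hεm : ∀ d ∈ D'.all, D.ε d ∈ D'.all := fun d hd => by
    have h1 := h.εm d (hin d hd)
    rw [hmem] at h1
    have h2 := h.εε d (hin d hd)
    rcases h1 with h1 | h1 | h1
    · rw [h1, hx] at h2; exact absurd (h2 ▸ hd) hx2
    · rw [h1, hx'] at h2; exact absurd (h2 ▸ hd) hx1
    · exact h1
  have hcg : ∀ p q l, D.Path p l q → D'.Path p l q := fun p q l =>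
    Dg.path_congr _ _ _ _ _ (fun d _ => ⟨rfl, rfl⟩)
  have hpo := h.po
  rw [ho, Dg.path_append] at hpo
  obtain ⟨p, hpu, hpx, hpx', hpv⟩ := hpo
  rw [hx', hpx] at hpv
  rw [hx] at hpx'
  constructor
  · exact hnd
  · exact hεm
  · exact fun d hd => h.εε d (hin d hd)
  · exact fun d hd => h.εl d (hin d hd)
  · show D'.Path D.v0 (u ++ v) D.v0
    rw [Dg.path_append]
    exact ⟨p, hcg _ _ _ hpu, hcg _ _ _ hpv⟩
  · intro l hl
    obtain ⟨q, hq⟩ := h.pi l hl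
    exact ⟨q, hcg _ _ _ hq⟩
  · exact h.wi
  · exact fun d hd => h.pt d (hin d hd)
  · have hp : p ∈ D'.verts := by
      cases v with
      | nil => rw [show p = D.v0 from hpv]; simp [Dg.verts, hD']
      | cons e v =>
        rw [← hpv.1]
        simp only [Dg.verts, Finset.mem_insert, Finset.mem_image, List.mem_toFinset]
        exact Or.inr ⟨e, by simp [Dg.all, hD'], rfl⟩
    have hsub : D.verts ⊆ insert (D.vt x') D'.verts := by
      intro v hv
      simp only [Dg.verts, Finset.mem_insert, Finset.mem_image, List.mem_toFinset, hmem] at hv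
      rcases hv with rfl | ⟨d, rfl | rfl | hd, rfl⟩
      · simp [Dg.verts, hD']
      · rw [hpx]; simp [hp]
      · simp
      · rw [Finset.mem_insert]; right
        simp only [Dg.verts, Finset.mem_insert, Finset.mem_image, List.mem_toFinset]
        right; exact ⟨d, hd, rfl⟩
    have h1 := (Finset.card_le_card hsub).trans (Finset.card_insert_le _ _)
    have h2 := h.eul
    have h3 := hall.length_eq
    simp only [List.length_cons] at h3
    show D'.all.length + 4 ≤ 2 * D'.verts.card + 2 * (D.inn.length + 1) + k
    omega
  · rintro d hd ⟨a, b, a', b', h1, h2, h3⟩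
    exact h.rd d (hin d hd) ⟨a, b, a', b', h1, h2, h3⟩

end SC

set_option linter.unusedSectionVars false
namespace SC
open List
variable {α : Type} {G : Type} [Group G]
variable {R : Set (List (α × Bool))} {f : FreeGroup α →* G}

theorem Dg.Mir.symm {D : Dg α G} {d d' : ℕ} (h : D.Mir d d') : D.Mir d' d := by
  obtain ⟨a, b, a', b', h1, h2, h3⟩ := h
  exact ⟨a', b', a, b, h2, h1, by rw [h3]; simp⟩

theorem Dg.OK.ε_ne {D : Dg α G} {k} (h : D.OK R f k) {d} (hd : d ∈ D.all) : D.ε d ≠ d := by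
  intro e; have := h.εl d hd; rw [e] at this; exact iL_ne _ this.symm

/-- rewiring an adjacent inverse pair -/
theorem Dg.OK.rewire (D : Dg α G) {k} (h : D.OK R f (k + 2)) (u v : List ℕ) (x x' : ℕ)
    (ho : D.o = u ++ x :: x' :: v) (hl : D.lab x' = iL (D.lab x)) (hx : D.ε x ≠ x')
    (hvt : D.vt (D.ε x') = D.vt x) (hmir : ¬ D.Mir (D.ε x) (D.ε x')) :
    ∃ D' : Dg α G, D'.OK R f k ∧ D'.o = u ++ v ∧ D'.inn = D.inn ∧ D'.lab = D.lab := by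
  set y := D.ε x with hy
  set y' := D.ε x' with hy'
  set D' : Dg α G := { D with o := u ++ v, ε := Function.update (Function.update D.ε y y') y' y } with hD'
  refine ⟨D', ?_, rfl, rfl, rfl⟩
  have hall : D.all.Perm (x :: x' :: D'.all) := by
    simp only [Dg.all, hD', ho]
    rw [List.perm_iff_count]; intro a; simp [List.count_append, List.count_cons]; omega
  have hmem : ∀ d, d ∈ D.all ↔ d = x ∨ d = x' ∨ d ∈ D'.all := fun d => by
    rw [hall.mem_iff]; simp
  have hnd := h.nd
  rw [hall.nodup_iff] at hnd
  simp only [nodup_cons, mem_cons, not_or] at hnd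
  obtain ⟨⟨hxx, hx1⟩, hx2, hnd⟩ := hnd
  have hin : ∀ d ∈ D'.all, d ∈ D.all := fun d hd => by simp [hmem, hd]
  have xa : x ∈ D.all := by simp [hmem]
  have xa' : x' ∈ D.all := by simp [hmem]
  have ey : D.ε y = x := h.εε x xa
  have ey' : D.ε y' = x' := h.εε x' xa'
  have hyx : y ≠ x := h.ε_ne xa
  have hyx' : y' ≠ x' := h.ε_ne xa'
  have hy'x : y' ≠ x := fun e => hx (by rw [hy, ← e, ey'])
  have hyy : y ≠ y' := fun e => hxx (by rw [← ey, e, ey'])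
  have ya : y ∈ D'.all := by
    have := h.εm x xa; rw [hmem] at this; tauto
  have ya' : y' ∈ D'.all := by
    have := h.εm x' xa'; rw [hmem] at this; tauto
  have e1 : D'.ε y = y' := by simp [hD', hyy]
  have e2 : D'.ε y' = y := by simp [hD']
  have e3 : ∀ d, d ≠ y → d ≠ y' → D'.ε d = D.ε d := fun d h1 h2 => by simp [hD', h1, h2]
  have hεm : ∀ d ∈ D'.all, d ≠ y → d ≠ y' → D.ε d ∈ D'.all ∧ D.ε d ≠ y ∧ D.ε d ≠ y' := by
    intro d hd n1 n2
    have h1 := h.εm d (hin d hd)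
    rw [hmem] at h1
    have h2 := h.εε d (hin d hd)
    refine ⟨?_, ?_, ?_⟩
    · rcases h1 with h1 | h1 | h1
      · rw [h1] at h2; exact absurd h2.symm n1
      · rw [h1] at h2; exact absurd h2.symm n2
      · exact h1
    · intro e; rw [e, ey] at h2; exact hx1 (h2 ▸ hd)
    · intro e; rw [e, ey'] at h2; exact hx2 (h2 ▸ hd)
  have hpo := h.po
  rw [ho, Dg.path_append] at hpo
  obtain ⟨p, hpu, hpx, hpx', hpv⟩ := hpo
  have hvo : ∀ d ∈ D'.all, D'.vt d = D.vt d ∧ D'.vt (D'.ε d) = D.vt (D.ε d) := by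
    intro d hd
    refine ⟨rfl, ?_⟩
    show D.vt (D'.ε d) = _
    by_cases h1 : d = y
    · rw [h1, e1, ey, ← hvt]
    · by_cases h2 : d = y'
      · rw [h2, e2, ey', hpx']
      · rw [e3 d h1 h2]
  have hinn : ∀ l ∈ D.inn, ∀ d ∈ l, d ∈ D'.all := fun l hl d hd => by
    simp only [Dg.all, mem_append, mem_flatten]; exact Or.inr ⟨l, hl, hd⟩
  have hlab : D.lab y' = iL (D.lab y) := by
    rw [hy', h.εl x' xa', hl, hy, h.εl x xa]
  constructor
  · exact hnd
  · intro d hd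
    by_cases h1 : d = y
    · rw [h1, e1]; exact ya'
    · by_cases h2 : d = y'
      · rw [h2, e2]; exact ya
      · rw [e3 d h1 h2]; exact (hεm d hd h1 h2).1
  · intro d hd
    by_cases h1 : d = y
    · rw [h1, e1, e2]
    · by_cases h2 : d = y'
      · rw [h2, e2, e1]
      · obtain ⟨-, h3, h4⟩ := hεm d hd h1 h2
        rw [e3 d h1 h2, e3 _ h3 h4, h.εε d (hin d hd)]
  · intro d hd
    show D.lab (D'.ε d) = iL (D.lab d)
    by_cases h1 : d = y
    · rw [h1, e1, hlab]
    · by_cases h2 : d = y'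
      · rw [h2, e2, hlab]; simp
      · rw [e3 d h1 h2, h.εl d (hin d hd)]
  · show D'.Path D.v0 (u ++ v) D.v0
    rw [Dg.path_append]
    refine ⟨p, Dg.path_congr D D' _ _ _ (fun d hd => hvo d (by simp [Dg.all, hD', hd])) hpu, ?_⟩
    apply Dg.path_congr D D' _ _ _ (fun d hd => hvo d (by simp [Dg.all, hD', hd]))
    rw [← hpx, ← hvt]; exact hpv
  · intro l hl
    obtain ⟨q, hq⟩ := h.pi l hl
    exact ⟨q, Dg.path_congr D D' _ _ _ (fun d hd => hvo d (hinn l hl d hd)) hq⟩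
  · exact h.wi
  · intro d hd
    rw [(hvo d hd).2]
    exact h.pt d (hin d hd)
  · have hsub : D.verts ⊆ D'.verts := by
      intro v hv
      simp only [Dg.verts, Finset.mem_insert, Finset.mem_image, List.mem_toFinset, hmem] at hv ⊢
      rcases hv with rfl | ⟨d, rfl | rfl | hd, rfl⟩
      · simp [hD']
      · exact Or.inr ⟨y', ya', hvt⟩
      · exact Or.inr ⟨y, ya, hpx'.symm⟩
      · exact Or.inr ⟨d, hd, rfl⟩
    have h1 := Finset.card_le_card hsub
    have h2 := h.eul
    have h3 := hall.length_eq
    simp only [List.length_cons] at h3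
    show D'.all.length + 4 ≤ 2 * D'.verts.card + 2 * (D.inn.length + 1) + k
    omega
  · intro d hd hM
    by_cases h1 : d = y
    · rw [h1, e1] at hM; exact hmir hM
    · by_cases h2 : d = y'
      · rw [h2, e2] at hM; exact hmir (Dg.Mir.symm hM)
      · rw [e3 d h1 h2] at hM; exact h.rd d (hin d hd) hM

/-- opening a face along an outer edge -/
theorem Dg.OK.opn (D : Dg α G) {k} (h : D.OK R f k) (u v a b : List ℕ) (x : ℕ) (rest : List (List ℕ))
    (ho : D.o = u ++ x :: v) (hi : D.inn = (a ++ D.ε x :: b) :: rest) (hab : b ++ a ≠ []) :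
    Dg.OK { D with o := u ++ (b ++ a) ++ v, inn := rest } R f k := by
  set D' : Dg α G := { D with o := u ++ (b ++ a) ++ v, inn := rest } with hD'
  have hall : D.all.Perm (x :: D.ε x :: D'.all) := by
    simp only [Dg.all, hD', ho, hi]
    rw [List.perm_iff_count]; intro a; simp [List.count_append, List.count_cons]; omega
  have hmem : ∀ d, d ∈ D.all ↔ d = x ∨ d = D.ε x ∨ d ∈ D'.all := fun d => by
    rw [hall.mem_iff]; simp
  have hnd := h.nd
  rw [hall.nodup_iff] at hnd
  simp only [nodup_cons, mem_cons, not_or] at hnd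
  obtain ⟨⟨hxx, hx1⟩, hx2, hnd⟩ := hnd
  have xa : x ∈ D.all := by simp [hmem]
  have hx' : D.ε (D.ε x) = x := h.εε x xa
  have hin : ∀ d ∈ D'.all, d ∈ D.all := fun d hd => by simp [hmem, hd]
  have hεm : ∀ d ∈ D'.all, D.ε d ∈ D'.all := fun d hd => by
    have h1 := h.εm d (hin d hd)
    rw [hmem] at h1
    have h2 := h.εε d (hin d hd)
    rcases h1 with h1 | h1 | h1
    · rw [h1] at h2; exact absurd (h2 ▸ hd) hx2
    · rw [h1, hx'] at h2; exact absurd (h2 ▸ hd) hx1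
    · exact h1
  have hcg : ∀ p q l, D.Path p l q → D'.Path p l q := fun p q l =>
    Dg.path_congr _ _ _ _ _ (fun d _ => ⟨rfl, rfl⟩)
  have hpo := h.po
  rw [ho, Dg.path_append] at hpo
  obtain ⟨p, hpu, hpx, hpv⟩ := hpo
  obtain ⟨s, hs⟩ := h.pi (a ++ D.ε x :: b) (by simp [hi])
  rw [Dg.path_append] at hs
  obtain ⟨q, hq1, hq2, hq3⟩ := hs
  rw [hx', hpx] at hq3
  rw [hq2] at hpv
  have hri : ∀ l ∈ rest, l ∈ D.inn := fun l hl => by simp [hi, hl]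
  have hba : D.Path p (b ++ a) q := by rw [Dg.path_append]; exact ⟨s, hq3, hq1⟩
  constructor
  · exact hnd
  · exact hεm
  · exact fun d hd => h.εε d (hin d hd)
  · exact fun d hd => h.εl d (hin d hd)
  · show D'.Path D.v0 (u ++ (b ++ a) ++ v) D.v0
    apply hcg
    rw [Dg.path_append]
    exact ⟨q, by rw [Dg.path_append]; exact ⟨p, hpu, hba⟩, hpv⟩
  · intro l hl
    obtain ⟨q, hq⟩ := h.pi l (hri l hl)
    exact ⟨q, hcg _ _ _ hq⟩
  · exact fun l hl => h.wi l (hri l hl)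
  · exact fun d hd => h.pt d (hin d hd)
  · have hq' : q ∈ D'.verts := by
      cases v with
      | nil => rw [show q = D.v0 from hpv]; simp [Dg.verts, hD']
      | cons e v =>
        rw [← hpv.1]
        simp only [Dg.verts, Finset.mem_insert, Finset.mem_image, List.mem_toFinset]
        exact Or.inr ⟨e, by simp [Dg.all, hD'], rfl⟩
    have hp' : p ∈ D'.verts := by
      cases hc : b ++ a with
      | nil => exact absurd hc hab
      | cons e t =>
        rw [hc] at hba
        rw [← hba.1]
        simp only [Dg.verts, Finset.mem_insert, Finset.mem_image, List.mem_toFinset]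
        exact Or.inr ⟨e, by simp [Dg.all, hD', hc], rfl⟩
    have hsub : D.verts ⊆ D'.verts := by
      intro v hv
      simp only [Dg.verts, Finset.mem_insert, Finset.mem_image, List.mem_toFinset, hmem] at hv
      rcases hv with rfl | ⟨d, rfl | rfl | hd, rfl⟩
      · simp [Dg.verts, hD']
      · rw [hpx]; exact hp'
      · rw [hq2]; exact hq'
      · simp only [Dg.verts, Finset.mem_insert, Finset.mem_image, List.mem_toFinset]
        right; exact ⟨d, hd, rfl⟩
    have h1 := Finset.card_le_card hsub
    have h2 := h.eul
    have h3 := hall.length_eq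
    simp only [List.length_cons] at h3
    rw [hi, List.length_cons] at h2
    show D'.all.length + 4 ≤ 2 * D'.verts.card + 2 * (rest.length + 1) + k
    omega
  · rintro d hd ⟨a, b, a', b', h1, h2, h3⟩
    exact h.rd d (hin d hd) ⟨a, b, a', b', hri _ h1, hri _ h2, h3⟩

/-- turning a closed segment of the outer boundary into a face -/
theorem Dg.OK.face (D : Dg α G) {k} (h : D.OK R f (k + 2)) (u l v : List ℕ) (p : ℕ)
    (ho : D.o = u ++ l ++ v) (hl : l.map D.lab ∈ R)
    (hpu : D.Path D.v0 u p) (hpl : D.Path p l p) (hpv : D.Path p v D.v0)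
    (hm : ∀ d ∈ l, D.ε d ∈ u ++ v) :
    Dg.OK { D with o := u ++ v, inn := l :: D.inn } R f k := by
  set D' : Dg α G := { D with o := u ++ v, inn := l :: D.inn } with hD'
  have hall : D'.all.Perm D.all := by
    simp only [Dg.all, hD', ho]
    rw [List.perm_iff_count]; intro a; simp [List.count_append, List.count_cons]; omega
  have hmem : ∀ d, d ∈ D'.all ↔ d ∈ D.all := fun d => by
    rw [hall.mem_iff]
  have hcg : ∀ p q l, D.Path p l q → D'.Path p l q := fun p q l =>
    Dg.path_congr _ _ _ _ _ (fun d _ => ⟨rfl, rfl⟩)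
  have hnd : D'.all.Nodup := hall.nodup_iff.2 h.nd
  have hdis : ∀ l' ∈ D'.inn, ∀ d ∈ l', d ∉ u ++ v := by
    intro l' hl' d hd hd'
    simp only [Dg.all] at hnd
    exact (List.nodup_append.1 hnd).2.2 d hd' d (mem_flatten.2 ⟨l', hl', hd⟩) rfl
  constructor
  · exact hnd
  · intro d hd; rw [hmem] at hd ⊢; exact h.εm d hd
  · intro d hd; rw [hmem] at hd; exact h.εε d hd
  · intro d hd; rw [hmem] at hd; exact h.εl d hd
  · show D'.Path D.v0 (u ++ v) D.v0
    apply hcg; rw [Dg.path_append]; exact ⟨p, hpu, hpv⟩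
  · intro l' hl'
    rcases List.mem_cons.1 hl' with rfl | hl'
    · exact ⟨p, hcg _ _ _ hpl⟩
    · obtain ⟨q, hq⟩ := h.pi l' hl'
      exact ⟨q, hcg _ _ _ hq⟩
  · intro l' hl'
    rcases List.mem_cons.1 hl' with rfl | hl'
    · exact hl
    · exact h.wi l' hl'
  · intro d hd; rw [hmem] at hd; exact h.pt d hd
  · have h2 := h.eul
    have h3 := hall.length_eq
    have : D'.verts = D.verts := by
      simp only [Dg.verts]; congr 2; ext d; simp [hmem]
    rw [this]
    show D'.all.length + 4 ≤ 2 * D.verts.card + 2 * ((l :: D.inn).length + 1) + k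
    simp only [List.length_cons]
    omega
  · rintro d hd ⟨a, b, a', b', h1, h2, h3⟩
    rw [hmem] at hd
    rcases List.mem_cons.1 h1 with h1' | h1'
    · have := hm d (by rw [← h1']; simp)
      exact hdis _ h2 (D.ε d) (by simp [hD']) this
    · rcases List.mem_cons.1 h2 with h2' | h2'
      · have := hm (D.ε d) (by rw [← h2']; simp [hD'])
        rw [h.εε d hd] at this
        exact hdis _ h1 d (by simp) this
      · exact h.rd d hd ⟨a, b, a', b', h1', h2', h3⟩

end SC

set_option linter.unusedSectionVars false
namespace SC
open List
variable {α : Type} {G : Type} [Group G]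
variable {R : Set (List (α × Bool))} {f : FreeGroup α →* G} {N : ℕ}

theorem map_split2 {β γ : Type} {g : β → γ} {l : List β} {u v : List γ} {x y : γ}
    (h : l.map g = u ++ x :: y :: v) : ∃ u' x' y' v', l = u' ++ x' :: y' :: v' ∧ u'.map g = u ∧
      g x' = x ∧ g y' = y ∧ v'.map g = v := by
  rw [List.map_eq_append_iff] at h
  obtain ⟨u', l', rfl, hu, h⟩ := h
  rw [List.map_eq_cons_iff] at h
  obtain ⟨x', l'', rfl, hx, h⟩ := h
  rw [List.map_eq_cons_iff] at h
  obtain ⟨y', l''', rfl, hy, h⟩ := h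
  exact ⟨u', x', y', l''', rfl, hu, hx, hy, h⟩

theorem HasD.mono {n n'} {w : List (α × Bool)} (h : HasD R f n w) (hn : n ≤ n') : HasD R f n' w := by
  obtain ⟨D, h1, h2, h3⟩ := h; exact ⟨D, h1, h2.trans hn, h3⟩

theorem hasD_glue (S : Sys R N f) (n : ℕ) : ∀ (u v : List (α × Bool)) (x : α × Bool),
    HasD R f n (u ++ x :: iL x :: v) → HasD R f n (u ++ v) := by
  induction n using Nat.strong_induction_on with
  | _ n IH =>
  rintro u v x ⟨D, hD, hn, hw⟩
  have cancel : ∀ m < n, ∀ (L u v : List (α × Bool)), HasD R f m (u ++ L ++ iW L ++ v) →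
      HasD R f m (u ++ v) := by
    intro m hm L
    induction L with
    | nil => intro u v h; simpa using h
    | cons y L ih =>
      intro u v h
      have := ih (u ++ [y]) (iL y :: v) (by simpa using h)
      exact IH m hm u v y (by simpa using this)
  obtain ⟨u, x, x', v, ho, rfl, rfl, hx', rfl⟩ := map_split2 hw
  by_cases he : D.ε x = x'
  · exact ⟨_, hD.del D u v x x' ho he, hn, by simp⟩
  have xa : x ∈ D.all := by simp [Dg.all, ho]
  have xa' : x' ∈ D.all := by simp [Dg.all, ho]
  by_cases hM : D.Mir (D.ε x) (D.ε x')
  · obtain ⟨a, b, a', b', h1, h2, h3⟩ := hM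
    have hne : (a ++ D.ε x :: b) ≠ (a' ++ D.ε x' :: b') := by
      intro e
      have e' : ((a ++ D.ε x :: b)).map D.lab = ((a' ++ D.ε x' :: b')).map D.lab := by rw [e]
      have hw1 := hD.wi _ h1
      have hw2 := hD.wi _ h2
      simp only [map_append, map_cons] at hw1 hw2 e' h3
      rw [hD.εl x xa] at hw1 e'
      rw [hD.εl x' xa', hx', iL_iL] at hw2 e'
      have k4 : map D.lab b' ++ map D.lab a' = iW (map D.lab a) ++ iW (map D.lab b) := by
        rw [h3]; simp
      have gen : ∀ w w' : List (α × Bool), w ∈ R → w ~r w' → w' ≠ iW w := by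
        intro w w' hw hr
        obtain ⟨i, rfl⟩ := hr
        have hw' := hw
        rw [← List.take_append_drop (i % w.length) w] at hw'
        have := S.noninv _ _ hw'
        rwa [List.take_append_drop, ← List.rotate_eq_drop_append_take_mod] at this
      refine gen _ (iW (map D.lab a ++ iL (D.lab x) :: map D.lab b)) hw1 ?_ rfl
      have r1 : iW (map D.lab a ++ iL (D.lab x) :: map D.lab b) ~r
          (D.lab x :: (map D.lab b' ++ map D.lab a')) := by
        rw [k4]
        have := List.isRotated_append (l := iW (map D.lab b)) (l' := D.lab x :: iW (map D.lab a))
        simpa using this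
      have r2 : (D.lab x :: (map D.lab b' ++ map D.lab a')) ~r (map D.lab a' ++ D.lab x :: map D.lab b') := by
        have := List.isRotated_append (l := D.lab x :: map D.lab b') (l' := map D.lab a')
        simpa using this
      rw [e'] at r1 ⊢
      exact (r1.trans r2).symm
    have hlen : ∀ a d b, a ++ d :: b ∈ D.inn → b ++ a ≠ [] := by
      intro a d b hin e
      have := S.len _ (hD.wi _ hin)
      have e2 := congrArg List.length e
      simp at this e2
      simp [e2.1, e2.2] at this
    have hperm := List.perm_cons_erase h1
    have h2' : (a' ++ D.ε x' :: b') ∈ D.inn.erase (a ++ D.ε x :: b) :=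
      (List.mem_erase_of_ne hne.symm).2 h2
    have hperm2 := List.perm_cons_erase h2'
    set rest2 := (D.inn.erase (a ++ D.ε x :: b)).erase (a' ++ D.ε x' :: b')
    have hp := hperm.trans (hperm2.cons _)
    have D1 := hD.perm D _ hp
    have D2 := D1.opn _ u (x' :: v) a b x _ ho rfl (hlen _ _ _ h1)
    have D3 := D2.opn _ (u ++ (b ++ a)) v a' b' x' rest2 rfl rfl (hlen _ _ _ h2)
    have hl := hp.length_eq
    simp only [List.length_cons] at hl
    have : HasD R f (n - 2) (map D.lab u ++ (b ++ a).map D.lab ++ iW ((b ++ a).map D.lab) ++ map D.lab v) := by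
      refine ⟨_, D3, ?_, ?_⟩
      · show rest2.length ≤ n - 2
        omega
      · rw [← h3]; simp
    exact (cancel (n - 2) (by omega) _ _ _ this).mono (by omega)
  · obtain ⟨D', hD', h1, h2, h3⟩ : ∃ D' : Dg α G, D'.OK R f 0 ∧ D'.o = u ++ v ∧ D'.inn = D.inn ∧ D'.lab = D.lab := by
      have hpo := hD.po
      rw [ho, Dg.path_append] at hpo
      obtain ⟨p, hpu, hpx, hpx', hpv⟩ := hpo
      have hpot : D.pot (D.vt x) = D.pot (D.vt (D.ε x')) := by
        rw [hD.pt x' xa', hpx', hD.pt x xa, hx', ev_iL]; simp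
      have hm := hD.merge D (D.vt x) (D.vt (D.ε x')) hpot
      refine Dg.OK.rewire _ hm u v x x' ho hx' he ?_ hM
      show (if D.vt (D.ε x') = D.vt (D.ε x') then D.vt x else _) = 
        (if D.vt x = D.vt (D.ε x') then D.vt x else D.vt x)
      simp
    exact ⟨D', hD', by rw [h2]; exact hn, by rw [h1, h3]; simp⟩

theorem hasD_red (S : Sys R N f) (n : ℕ) {w w' : List (α × Bool)} (h : FreeGroup.Red w w')
    (hw : HasD R f n w) : HasD R f n w' := by
  induction h with
  | refl => exact hw
  | tail _ hs ih =>
    cases hs with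
    | @not L₁ L₂ a b => exact hasD_glue S n L₁ L₂ (a, b) ih

theorem hasD_spurs (n : ℕ) (L : List (α × Bool)) : ∀ u v : List (α × Bool), HasD R f n (u ++ v) →
    HasD R f n (u ++ L ++ iW L ++ v) := by
  induction L with
  | nil => intro u v h; simpa using h
  | cons y L ih =>
    rintro u v ⟨D, hD, hn, hw⟩
    rw [List.map_eq_append_iff] at hw
    obtain ⟨u, v, ho, rfl, rfl⟩ := hw
    obtain ⟨D', m, m', hD', hi, ho', hl, hm, hm', -⟩ := hD.spur D u v y ho
    have h1 : HasD R f n ((u.map D.lab ++ [y]) ++ (iL y :: v.map D.lab)) := by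
      refine ⟨D', hD', by rw [hi]; exact hn, ?_⟩
      have e1 : u.map D'.lab = u.map D.lab := List.map_congr_left fun d hd => (hl d (by simp [Dg.all, ho, hd])).1
      have e2 : v.map D'.lab = v.map D.lab := List.map_congr_left fun d hd => (hl d (by simp [Dg.all, ho, hd])).1
      rw [ho']; simp [e1, e2, hm, hm']
    have := ih _ _ h1
    simpa using this

theorem hasD_rel (S : Sys R N f) (n : ℕ) (r : List (α × Bool)) (hr : r ∈ R) (u v : List (α × Bool))
    (h : HasD R f n (u ++ v)) : HasD R f (n + 1) (u ++ r ++ v) := by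
  obtain ⟨D, hD, hn, hw⟩ := h
  rw [List.map_eq_append_iff] at hw
  obtain ⟨U, V, ho, rfl, rfl⟩ := hw
  have key : ∀ L : List (α × Bool), ∃ (D' : Dg α G) (A B : List ℕ), D'.OK R f 0 ∧ D'.inn.length ≤ n ∧
      D'.o = U ++ A ++ B ++ V ∧ U.map D'.lab = U.map D.lab ∧ V.map D'.lab = V.map D.lab ∧
      A.map D'.lab = L ∧ B.map D'.lab = iW L ∧ ∀ d ∈ B, D'.ε d ∈ A := by
    intro L
    induction L using List.reverseRecOn with
    | nil => exact ⟨D, [], [], hD, hn, by simpa using ho, rfl, rfl, rfl, rfl, by simp⟩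
    | append_singleton L y ih =>
      obtain ⟨D1, A, B, h1, h2, h3, h4, h5, h6, h7, h8⟩ := ih
      obtain ⟨D', m, m', hD', hi, ho', hl, hm, hm', hem⟩ := h1.spur D1 (U ++ A) (B ++ V) y (by simp [h3])
      have hc : ∀ l : List ℕ, (∀ d ∈ l, d ∈ D1.o) → l.map D'.lab = l.map D1.lab := fun l hl' =>
        List.map_congr_left fun d hd => (hl d (by simp [Dg.all, hl' d hd])).1
      refine ⟨D', A ++ [m], m' :: B, hD', by rw [hi]; exact h2, by simp [ho'], ?_, ?_, ?_, ?_, ?_⟩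
      · rw [hc U (fun d hd => by simp [h3, hd]), h4]
      · rw [hc V (fun d hd => by simp [h3, hd]), h5]
      · rw [map_append, hc A (fun d hd => by simp [h3, hd]), h6]; simp [hm]
      · rw [map_cons, hc B (fun d hd => by simp [h3, hd]), h7]; simp [hm']
      · intro d hd
        rcases List.mem_cons.1 hd with rfl | hd
        · simp [hem]
        · rw [(hl d (by simp [Dg.all, h3, hd])).2]; simp [h8 d hd]
  obtain ⟨D', A, B, h1, h2, h3, h4, h5, h6, h7, h8⟩ := key r
  have hpo := h1.po
  rw [h3, Dg.path_append] at hpo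
  obtain ⟨q, hpo, hV⟩ := hpo
  rw [Dg.path_append] at hpo
  obtain ⟨p, hUA, hB⟩ := hpo
  have hpot : D'.pot p = D'.pot q := by
    rw [Dg.path_pot D' h1 p q B (fun d hd => by simp [Dg.all, h3, hd]) hB, h7, S.one _ (S.inv _ hr)]; simp
  have hm := h1.merge D' p q hpot
  set ρ : ℕ → ℕ := fun v => if v = q then p else v with hρ
  have hv : ∀ d, (D'.merge p q).vt d = ρ (D'.vt d) := fun d => rfl
  have ρq : ρ q = p := by simp [hρ]
  have ρp : ρ p = p := by simp [hρ]
  have P1 := Dg.path_map D' (D'.merge p q) ρ _ _ _ hv rfl hUA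
  have P2 := Dg.path_map D' (D'.merge p q) ρ _ _ _ hv rfl hB
  have P3 := Dg.path_map D' (D'.merge p q) ρ _ _ _ hv rfl hV
  rw [ρp] at P1
  rw [ρp, ρq] at P2
  rw [ρq] at P3
  have := Dg.OK.face (D'.merge p q) hm (U ++ A) B V p h3 (by
    show B.map D'.lab ∈ R
    rw [h7]; exact S.inv _ hr) P1 P2 P3 (fun d hd => by
      show D'.ε d ∈ _
      simp [h8 d hd])
  refine ⟨_, this, ?_, ?_⟩
  · show (B :: D'.inn).length ≤ n + 1
    simpa using h2
  · show (U ++ A ++ V).map D'.lab = _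
    simp [h4, h5, h6]

theorem hasD_normalClosure [Inhabited α] (S : Sys R N f) (g : FreeGroup α)
    (hg : g ∈ Subgroup.normalClosure (FreeGroup.mk '' R)) :
    ∃ n, ∀ w, FreeGroup.IsReduced w → FreeGroup.mk w = g → HasD R f n w := by
  suffices h : ∃ n w, FreeGroup.mk w = g ∧ HasD R f n w by
    obtain ⟨n, w, hw, hD⟩ := h
    refine ⟨n, fun w' hw' e => ?_⟩
    classical
    have h1 : FreeGroup.reduce w' = FreeGroup.reduce w := by
      rw [← FreeGroup.toWord_mk, ← FreeGroup.toWord_mk, e, hw]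
    rw [hw'.reduce_eq] at h1
    rw [h1]
    exact hasD_red S n FreeGroup.reduce.red hD
  unfold Subgroup.normalClosure at hg
  induction hg using Subgroup.closure_induction_left with
  | one => exact ⟨0, [], rfl, hasD_nil⟩
  | mul_left x hx y hy ih =>
    obtain ⟨n, w, hw, hD⟩ := ih
    rw [Group.mem_conjugatesOfSet_iff] at hx
    obtain ⟨r', ⟨r, hr, rfl⟩, hc⟩ := hx
    rw [isConj_iff] at hc
    obtain ⟨c, rfl⟩ := hc
    obtain ⟨h, rfl⟩ : ∃ h, FreeGroup.mk h = c := Quot.exists_rep c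
    have h1 := hasD_spurs n h [] w (by simpa using hD)
    have h2 := hasD_rel S n r hr (h) (iW h ++ w) (by simpa using h1)
    refine ⟨_, _, ?_, h2⟩
    rw [← hw, iW_eq_invRev, FreeGroup.inv_mk, FreeGroup.mul_mk, FreeGroup.mul_mk, FreeGroup.mul_mk]
    simp
  | inv_mul_cancel x hx y hy ih =>
    obtain ⟨n, w, hw, hD⟩ := ih
    rw [Group.mem_conjugatesOfSet_iff] at hx
    obtain ⟨r', ⟨r, hr, rfl⟩, hc⟩ := hx
    rw [isConj_iff] at hc
    obtain ⟨c, rfl⟩ := hc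
    obtain ⟨h, rfl⟩ : ∃ h, FreeGroup.mk h = c := Quot.exists_rep c
    have h1 := hasD_spurs n h [] w (by simpa using hD)
    have h2 := hasD_rel S n (iW r) (S.inv _ hr) (h) (iW h ++ w) (by simpa using h1)
    refine ⟨_, _, ?_, h2⟩
    rw [← hw, iW_eq_invRev, iW_eq_invRev]
    simp [FreeGroup.inv_mk, FreeGroup.mul_mk]

end SC

set_option linter.unusedSectionVars false
namespace SC
open List

theorem exists_phi (F : List (List ℕ)) (hF : F.flatten.Nodup) : ∃ φ ψ : ℕ → ℕ,
    (∀ l ∈ F, ∀ d ∈ l, φ d ∈ l ∧ ψ d ∈ l ∧ φ (ψ d) = d ∧ ψ (φ d) = d) ∧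
    (∀ l ∈ F, ∀ a d b, l = a ++ d :: b → d :: (b ++ a) = List.iterate φ d l.length ∧
      φ^[l.length] d = d) := by
  classical
  have huniq : ∀ l ∈ F, ∀ l' ∈ F, ∀ d, d ∈ l → d ∈ l' → l = l' := by
    intro l hl l' hl' d hd hd'
    by_contra hne
    rw [List.nodup_flatten] at hF
    have := hF.2
    have hsy : Std.Symm (α := List ℕ) List.Disjoint := ⟨fun a b h => List.Disjoint.symm h⟩
    have h2 := this.forall hl hl' hne
    exact h2 hd hd'
  have hnd : ∀ l ∈ F, l.Nodup := fun l hl => (List.nodup_flatten.1 hF).1 l hl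
  let φ : ℕ → ℕ := fun d => if h : ∃ l ∈ F, d ∈ l then h.choose.next d h.choose_spec.2 else d
  let ψ : ℕ → ℕ := fun d => if h : ∃ l ∈ F, d ∈ l then h.choose.prev d h.choose_spec.2 else d
  have hφ : ∀ l (_ : l ∈ F) d (hd : d ∈ l), φ d = l.next d hd := by
    intro l hl d hd
    have h : ∃ l ∈ F, d ∈ l := ⟨l, hl, hd⟩
    have e := huniq _ h.choose_spec.1 l hl d h.choose_spec.2 hd
    simp only [φ, dif_pos h]
    congr 1
  have hψ : ∀ l (_ : l ∈ F) d (hd : d ∈ l), ψ d = l.prev d hd := by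
    intro l hl d hd
    have h : ∃ l ∈ F, d ∈ l := ⟨l, hl, hd⟩
    have e := huniq _ h.choose_spec.1 l hl d h.choose_spec.2 hd
    simp only [ψ, dif_pos h]
    congr 1
  refine ⟨φ, ψ, ?_, ?_⟩
  · intro l hl d hd
    have h1 : φ d ∈ l := by rw [hφ l hl d hd]; exact List.next_mem _ _ _
    have h2 : ψ d ∈ l := by rw [hψ l hl d hd]; exact List.prev_mem _ _ _
    refine ⟨h1, h2, ?_, ?_⟩
    · rw [hφ l hl _ h2]; simp only [hψ l hl d hd]; exact List.next_prev _ (hnd l hl) _ _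
    · rw [hψ l hl _ h1]; simp only [hφ l hl d hd]; exact List.prev_next _ (hnd l hl) _ _
  · intro l hl a d b e
    have hr : l ~r (d :: (b ++ a)) := by
      rw [e]; have := List.isRotated_append (l := a) (l' := d :: b); simpa using this
    have hnd' : (d :: (b ++ a)).Nodup := hr.nodup_iff.1 (hnd l hl)
    have hlen : (d :: (b ++ a)).length = l.length := hr.perm.length_eq.symm
    have hpos : 0 < l.length := by rw [← hlen]; simp
    have hi : ∀ i, φ^[i] d = (d :: (b ++ a))[i % l.length]'(by rw [hlen]; exact Nat.mod_lt _ hpos) := by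
      intro i
      induction i with
      | zero => simp
      | succ i ih =>
        rw [Function.iterate_succ_apply', ih]
        have hlt : i % l.length < (d :: (b ++ a)).length := by rw [hlen]; exact Nat.mod_lt _ hpos
        have hm : (d :: (b ++ a))[i % l.length]'hlt ∈ l := hr.mem_iff.2 (List.getElem_mem _)
        rw [hφ l hl _ hm, List.isRotated_next_eq hr (hnd l hl) hm, List.next_getElem _ hnd']
        congr 1
        rw [hlen]; simp
    constructor
    · apply List.ext_getElem
      · rw [hlen]; simp
      · intro i h1 h2
        rw [List.getElem_iterate, hi]
        congr 1
        rw [Nat.mod_eq_of_lt]; omega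
    · rw [hi]; simp

end SC

set_option linter.unusedSectionVars false
namespace SC
open List
variable {α : Type} {G : Type} [Group G]
variable {R : Set (List (α × Bool))} {f : FreeGroup α →* G} {N : ℕ}

structure Cx (D : Dg α G) (R : Set (List (α × Bool))) (N : ℕ) (f : FreeGroup α →* G) (φ ψ : ℕ → ℕ) : Prop where
  ok : D.OK R f 0
  S : Sys R N f
  one : D.o ≠ []
  h1 : ∀ l ∈ D.o :: D.inn, ∀ d ∈ l, φ d ∈ l ∧ ψ d ∈ l ∧ φ (ψ d) = d ∧ ψ (φ d) = d
  h2 : ∀ l ∈ D.o :: D.inn, ∀ a d b, l = a ++ d :: b → d :: (b ++ a) = List.iterate φ d l.length ∧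
      φ^[l.length] d = d
  vinj : ∀ d ∈ D.o, ∀ d' ∈ D.o, D.vt d = D.vt d' → d = d'
  lb : ∀ d ∈ D.all, D.lab (φ d) ≠ iL (D.lab d)

variable {D : Dg α G} {φ ψ : ℕ → ℕ}

theorem Dg.mem_all {d : ℕ} : d ∈ D.all ↔ ∃ l ∈ D.o :: D.inn, d ∈ l := by
  simp [Dg.all]

namespace Cx

theorem φm (C : Cx D R N f φ ψ) {d} (hd : d ∈ D.all) : φ d ∈ D.all := by
  obtain ⟨l, hl, h⟩ := Dg.mem_all.1 hd
  exact Dg.mem_all.2 ⟨l, hl, (C.h1 l hl d h).1⟩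
theorem ψm (C : Cx D R N f φ ψ) {d} (hd : d ∈ D.all) : ψ d ∈ D.all := by
  obtain ⟨l, hl, h⟩ := Dg.mem_all.1 hd
  exact Dg.mem_all.2 ⟨l, hl, (C.h1 l hl d h).2.1⟩
theorem φψ (C : Cx D R N f φ ψ) {d} (hd : d ∈ D.all) : φ (ψ d) = d := by
  obtain ⟨l, hl, h⟩ := Dg.mem_all.1 hd
  exact (C.h1 l hl d h).2.2.1
theorem ψφ (C : Cx D R N f φ ψ) {d} (hd : d ∈ D.all) : ψ (φ d) = d := by
  obtain ⟨l, hl, h⟩ := Dg.mem_all.1 hd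
  exact (C.h1 l hl d h).2.2.2
theorem φinj (C : Cx D R N f φ ψ) {d d'} (hd : d ∈ D.all) (hd' : d' ∈ D.all) (h : φ d = φ d') : d = d' := by
  rw [← C.ψφ hd, h, C.ψφ hd']
theorem εinj (C : Cx D R N f φ ψ) {d d'} (hd : d ∈ D.all) (hd' : d' ∈ D.all) (h : D.ε d = D.ε d') : d = d' := by
  rw [← C.ok.εε d hd, h, C.ok.εε d' hd']

/-- vertex rotation -/
def σ (D : Dg α G) (φ : ℕ → ℕ) (d : ℕ) : ℕ := φ (D.ε d)

theorem σm (C : Cx D R N f φ ψ) {d} (hd : d ∈ D.all) : σ D φ d ∈ D.all := C.φm (C.ok.εm d hd)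
theorem σinj (C : Cx D R N f φ ψ) {d d'} (hd : d ∈ D.all) (hd' : d' ∈ D.all) (h : σ D φ d = σ D φ d') : d = d' :=
  C.εinj hd hd' (C.φinj (C.ok.εm _ hd) (C.ok.εm _ hd') h)

theorem closed (C : Cx D R N f φ ψ) {l} (hl : l ∈ D.o :: D.inn) : ∃ p, D.Path p l p := by
  rcases List.mem_cons.1 hl with rfl | hl
  · exact ⟨_, C.ok.po⟩
  · exact C.ok.pi l hl

theorem vtφ (C : Cx D R N f φ ψ) {d} (hd : d ∈ D.all) : D.vt (φ d) = D.vt (D.ε d) := by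
  obtain ⟨l, hl, h⟩ := Dg.mem_all.1 hd
  obtain ⟨a, b, e⟩ := List.append_of_mem h
  obtain ⟨k1, k2⟩ := C.h2 l hl a d b e
  obtain ⟨p, hp⟩ := C.closed hl
  rw [e, Dg.path_append] at hp
  obtain ⟨q, hq1, hq2⟩ := hp
  have hP : D.Path q (d :: (b ++ a)) q := by
    rw [← List.cons_append, Dg.path_append]; exact ⟨p, hq2, hq1⟩
  have hlen : l.length = (b ++ a).length + 1 := by rw [e]; simp; omega
  rw [hlen] at k1 k2
  cases hc : b ++ a with
  | nil =>
    rw [hc] at hP k2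
    simp at k2
    obtain ⟨e1, e2⟩ := hP
    rw [k2, e1]; exact e2.symm
  | cons e t =>
    rw [hc] at hP k1
    simp [List.iterate] at k1
    obtain ⟨e1, e2, -⟩ := hP
    rw [← k1.1, e2]

theorem vtσ (C : Cx D R N f φ ψ) {d} (hd : d ∈ D.all) : D.vt (σ D φ d) = D.vt d := by
  unfold σ
  rw [C.vtφ (C.ok.εm d hd), C.ok.εε d hd]

theorem σne (C : Cx D R N f φ ψ) {d} (hd : d ∈ D.all) : σ D φ d ≠ d := by
  intro h
  have := C.lb _ (C.ok.εm d hd)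
  apply this
  rw [show φ (D.ε d) = d from h, C.ok.εl d hd]; simp

def D3 (D : Dg α G) (φ : ℕ → ℕ) : Finset ℕ := D.all.toFinset.filter fun d => σ D φ (σ D φ d) ≠ d

theorem card_all (C : Cx D R N f φ ψ) : D.all.toFinset.card = D.all.length :=
  List.toFinset_card_of_nodup C.ok.nd

theorem D3_le (C : Cx D R N f φ ψ) : (D3 D φ).card + 6 ≤ 6 * D.inn.length := by
  classical
  set A := D.all.toFinset with hA
  have mA : ∀ d, d ∈ A ↔ d ∈ D.all := fun d => by simp [hA]
  let wt : ℕ → ℕ := fun d => if σ D φ (σ D φ d) ≠ d then 2 else 3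
  have hv : D.verts = A.image D.vt := by
    unfold Dg.verts
    rw [Finset.insert_eq_self]
    have := C.one
    cases ho : D.o with
    | nil => exact absurd ho this
    | cons d l =>
      have h := C.ok.po
      rw [ho] at h
      rw [← h.1]
      apply Finset.mem_image_of_mem
      simp [Dg.all, ho]
  have s1 : ∑ d ∈ A, wt d + (D3 D φ).card = 3 * A.card := by
    rw [D3, Finset.card_filter, ← Finset.sum_add_distrib, Finset.card_eq_sum_ones, Finset.mul_sum]
    apply Finset.sum_congr rfl
    intro d _
    simp only [wt]; split_ifs <;> rfl
  have s2 : 6 * D.verts.card ≤ ∑ d ∈ A, wt d := by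
    rw [hv, ← Finset.sum_fiberwise_of_maps_to (fun d hd => Finset.mem_image_of_mem D.vt hd)]
    rw [mul_comm, ← smul_eq_mul]
    apply Finset.card_nsmul_le_sum
    intro v hv
    obtain ⟨d, hd, rfl⟩ := Finset.mem_image.1 hv
    have hd' := (mA d).1 hd
    have h1 := C.σm hd'
    have h2 := C.σm h1
    have v1 := C.vtσ hd'
    have v2 := (C.vtσ h1).trans v1
    have n1 := C.σne hd'
    have n2 := C.σne h1
    by_cases h : σ D φ (σ D φ d) = d
    · have hsub : ({d, σ D φ d} : Finset ℕ) ⊆ A.filter (fun e => D.vt e = D.vt d) := by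
        intro e he
        simp only [Finset.mem_insert, Finset.mem_singleton] at he
        rw [Finset.mem_filter, mA]
        rcases he with rfl | rfl
        · exact ⟨hd', rfl⟩
        · exact ⟨h1, v1⟩
      refine le_trans ?_ (Finset.sum_le_sum_of_subset hsub)
      rw [Finset.sum_pair n1.symm]
      simp [wt, h]
    · have hsub : ({d, σ D φ d, σ D φ (σ D φ d)} : Finset ℕ) ⊆ A.filter (fun e => D.vt e = D.vt d) := by
        intro e he
        simp only [Finset.mem_insert, Finset.mem_singleton] at he
        rw [Finset.mem_filter, mA]
        rcases he with rfl | rfl | rfl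
        · exact ⟨hd', rfl⟩
        · exact ⟨h1, v1⟩
        · exact ⟨h2, v2⟩
      refine le_trans ?_ (Finset.sum_le_sum_of_subset hsub)
      rw [Finset.sum_insert (by simp [n1.symm, Ne.symm h]), Finset.sum_pair n2.symm]
      have w2 : ∀ e, 2 ≤ wt e := fun e => by simp only [wt]; split_ifs <;> omega
      have := w2 d; have := w2 (σ D φ d); have := w2 (σ D φ (σ D φ d)); omega
  have h3 := C.ok.eul
  rw [← C.card_all, ← hA] at h3
  omega

end Cx
end SC

set_option linter.unusedSectionVars false
namespace SC
open List
variable {α : Type} {G : Type} [Group G]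
variable {R : Set (List (α × Bool))} {f : FreeGroup α →* G} {N : ℕ}
variable {D : Dg α G} {φ ψ : ℕ → ℕ}

/-- word read from `d` -/
def Wd (D : Dg α G) (φ : ℕ → ℕ) (d k : ℕ) : List (α × Bool) := (List.iterate φ d k).map D.lab

@[simp] theorem Wd_length (d k : ℕ) : (Wd D φ d k).length = k := by simp [Wd]
theorem Wd_add (d m n : ℕ) : Wd D φ d (m + n) = Wd D φ d m ++ Wd D φ (φ^[m] d) n := by
  simp [Wd, List.iterate_add]
theorem Wd_succ (d n : ℕ) : Wd D φ d (n + 1) = D.lab d :: Wd D φ (φ d) n := by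
  simp [Wd, List.iterate]
theorem Wd_succ' (d n : ℕ) : Wd D φ d (n + 1) = Wd D φ d n ++ [D.lab (φ^[n] d)] := by
  rw [Wd_add]; simp [Wd, List.iterate]

namespace Cx

theorem itm (C : Cx D R N f φ ψ) {l} (hl : l ∈ D.o :: D.inn) {d} (hd : d ∈ l) (i : ℕ) : φ^[i] d ∈ l := by
  induction i with
  | zero => simpa
  | succ i ih => rw [Function.iterate_succ_apply']; exact (C.h1 l hl _ ih).1

theorem ita (C : Cx D R N f φ ψ) {d} (hd : d ∈ D.all) (i : ℕ) : φ^[i] d ∈ D.all := by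
  obtain ⟨l, hl, h⟩ := Dg.mem_all.1 hd
  exact Dg.mem_all.2 ⟨l, hl, C.itm hl h i⟩

theorem per (C : Cx D R N f φ ψ) {l} (hl : l ∈ D.o :: D.inn) {d} (hd : d ∈ l) : φ^[l.length] d = d := by
  obtain ⟨a, b, e⟩ := List.append_of_mem hd
  exact (C.h2 l hl a d b e).2

theorem iperm (C : Cx D R N f φ ψ) {l} (hl : l ∈ D.o :: D.inn) {d} (hd : d ∈ l) :
    (List.iterate φ d l.length).Perm l := by
  obtain ⟨a, b, e⟩ := List.append_of_mem hd
  rw [← (C.h2 l hl a d b e).1]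
  conv_rhs => rw [e]
  exact (List.perm_append_comm (l₁ := d :: b) (l₂ := a))

theorem cover (C : Cx D R N f φ ψ) {l} (hl : l ∈ D.o :: D.inn) {d e} (hd : d ∈ l) (he : e ∈ l) :
    ∃ i < l.length, φ^[i] d = e := by
  have := (C.iperm hl hd).mem_iff.2 he
  rw [List.mem_iterate] at this
  obtain ⟨i, hi, h⟩ := this
  exact ⟨i, hi, h.symm⟩

theorem lnd (C : Cx D R N f φ ψ) {l} (hl : l ∈ D.o :: D.inn) : l.Nodup := by
  have := C.ok.nd
  have e : D.all = (D.o :: D.inn).flatten := by simp [Dg.all]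
  rw [e, List.nodup_flatten] at this
  exact this.1 l hl

theorem ndisj (C : Cx D R N f φ ψ) {l} (hl : l ∈ D.inn) {d} (hd : d ∈ l) : d ∉ D.o := by
  intro h
  have := C.ok.nd
  unfold Dg.all at this
  exact (List.nodup_append.1 this).2.2 d h d (mem_flatten.2 ⟨l, hl, hd⟩) rfl

theorem rotR (C : Cx D R N f φ ψ) {l} (hl : l ∈ D.inn) {d} (hd : d ∈ l) : Wd D φ d l.length ∈ R := by
  obtain ⟨a, b, e⟩ := List.append_of_mem hd
  unfold Wd
  rw [← (C.h2 l (by simp [hl]) a d b e).1]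
  have := C.ok.wi l hl
  rw [e, map_append] at this
  have := C.S.rot _ _ this
  simpa using this

theorem chain1 (C : Cx D R N f φ ψ) {e} (he : e ∈ D.all) (h : σ D φ (σ D φ (φ e)) = φ e) :
    φ (D.ε (φ e)) = D.ε e := by
  have h1 := C.φm he
  have h2 : D.ε (σ D φ (φ e)) = e := C.φinj (C.ok.εm _ (C.σm h1)) he h
  have h3 := C.ok.εε _ (C.σm h1)
  rw [h2] at h3
  exact h3.symm

theorem chain (C : Cx D R N f φ ψ) {e} (he : e ∈ D.all) (j : ℕ)
    (h : ∀ i, 1 ≤ i → i ≤ j → σ D φ (σ D φ (φ^[i] e)) = φ^[i] e) (m : ℕ) (hm : m ≤ j) :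
    φ^[m] (D.ε (φ^[j] e)) = D.ε (φ^[j - m] e) := by
  induction m with
  | zero => simp
  | succ m ih =>
    rw [Function.iterate_succ_apply', ih (by omega)]
    have e1 : j - m = (j - (m + 1)) + 1 := by omega
    rw [e1, Function.iterate_succ_apply']
    apply C.chain1 (C.ita he _)
    have := h (j - m) (by omega) (by omega)
    rwa [e1, Function.iterate_succ_apply'] at this

theorem chainW (C : Cx D R N f φ ψ) {e} (he : e ∈ D.all) (j : ℕ)
    (h : ∀ i, 1 ≤ i → i ≤ j → σ D φ (σ D φ (φ^[i] e)) = φ^[i] e) :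
    Wd D φ (D.ε (φ^[j] e)) (j + 1) = iW (Wd D φ e (j + 1)) := by
  induction j with
  | zero => simp [Wd, List.iterate, C.ok.εl e he]
  | succ j ih =>
    rw [Wd_succ, Wd_succ' e]
    have := C.chain he (j + 1) h 1 (by omega)
    simp only [Function.iterate_one, Nat.add_sub_cancel] at this
    rw [this, ih (fun i h1 h2 => h i h1 (by omega)), C.ok.εl _ (C.ita he _)]
    simp

/-- arcs between inner faces are short -/
theorem inner_arc (C : Cx D R N f φ ψ) {l} (hl : l ∈ D.inn) {e} (he : e ∈ l) (j : ℕ) (hj : j + 1 ≤ l.length)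
    (h : ∀ i, 1 ≤ i → i ≤ j → σ D φ (σ D φ (φ^[i] e)) = φ^[i] e) (heo : D.ε e ∉ D.o) :
    N * (j + 1) ≤ l.length := by
  have hl' : l ∈ D.o :: D.inn := by simp [hl]
  have hea : e ∈ D.all := Dg.mem_all.2 ⟨l, hl', he⟩
  set d := φ^[j] e with hd
  have hdl : d ∈ l := C.itm hl' he j
  have hda : d ∈ D.all := Dg.mem_all.2 ⟨l, hl', hdl⟩
  obtain ⟨l'', hl'', hm⟩ := Dg.mem_all.1 (C.ok.εm d hda)
  have hl2 : l'' ∈ D.inn := by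
    rcases List.mem_cons.1 hl'' with rfl | h'
    · exfalso
      have := C.itm hl'' hm j
      rw [hd, C.chain hea j h j le_rfl] at this
      simp at this; exact heo this
    · exact h'
  have r2 := C.rotR hl2 hm
  have hφd : φ d ∈ l := (C.h1 l hl' d hdl).1
  have r1 := C.S.inv _ (C.rotR hl hφd)
  have hL2 : 2 ≤ l''.length := by have := C.S.len _ r2; simpa using this
  have hcW := C.chainW hea j h
  have e1 : Wd D φ (φ d) l.length = Wd D φ (φ d) (l.length - (j + 1)) ++ Wd D φ e (j + 1) := by
    have : l.length = (l.length - (j + 1)) + (j + 1) := by omega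
    conv_lhs => rw [this]
    rw [Wd_add]
    congr 2
    rw [hd, ← Function.iterate_succ_apply' φ j e, ← Function.iterate_add_apply]
    have : l.length - (j + 1) + (j.succ) = l.length := by omega
    rw [this]; exact C.per hl' he
  have e2 : iW (Wd D φ (φ d) l.length) = Wd D φ (D.ε d) (j + 1) ++ iW (Wd D φ (φ d) (l.length - (j + 1))) := by
    rw [e1, iW_append, ← hcW]
  rw [e2] at r1
  by_cases hc : j + 1 ≤ l''.length
  · have e3 : Wd D φ (D.ε d) l''.length = Wd D φ (D.ε d) (j + 1) ++ Wd D φ (φ^[j+1] (D.ε d)) (l''.length - (j + 1)) := by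
      rw [← Wd_add]; congr 1; omega
    have r2' := r2
    rw [e3] at r2'
    by_cases hne : iW (Wd D φ (φ d) (l.length - (j + 1))) = Wd D φ (φ^[j+1] (D.ε d)) (l''.length - (j + 1))
    · exfalso
      have e4 : Wd D φ (D.ε d) l''.length = iW (Wd D φ (φ d) l.length) := by rw [e3, e2, hne]
      obtain ⟨a, b, ea⟩ := List.append_of_mem hdl
      obtain ⟨a', b', ea'⟩ := List.append_of_mem hm
      have k1 := (C.h2 l hl' a d b ea).1
      have k2 := (C.h2 l'' hl'' a' _ b' ea').1
      have hlen : l.length = (l.length - 1) + 1 := by omega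
      have k1' : (D.lab d) :: (b ++ a).map D.lab = D.lab d :: Wd D φ (φ d) (l.length - 1) := by
        rw [← Wd_succ, ← hlen]; unfold Wd; rw [← k1]; simp
      have k2' : D.lab (D.ε d) :: (b' ++ a').map D.lab = Wd D φ (D.ε d) l''.length := by
        unfold Wd; rw [← k2]; simp
      rw [e4, hlen, Wd_succ'] at k2'
      rw [iW_append] at k2'
      simp only [List.cons.injEq, true_and] at k1'
      simp only [iW_cons, iW_nil, nil_append, cons_append, cons.injEq] at k2'
      apply C.ok.rd d hda
      refine ⟨a, b, a', b', by rw [← ea]; exact hl, by rw [← ea']; exact hl2, ?_⟩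
      rw [k1', k2'.2]
    · have := C.S.piece _ _ _ r1 r2' hne
      simp at this
      omega
  · exfalso
    have e3 : Wd D φ (D.ε d) (j + 1) = Wd D φ (D.ε d) l''.length ++ Wd D φ (φ^[l''.length] (D.ε d)) (j + 1 - l''.length) := by
      rw [← Wd_add]; congr 1; omega
    rw [e3, append_assoc] at r1
    have r2' : Wd D φ (D.ε d) l''.length ++ [] ∈ R := by simpa using r2
    have := C.S.piece _ _ _ r2' r1 (by
      intro hh
      have := congrArg List.length hh
      simp at this; omega)
    simp at this
    have := C.S.hN
    nlinarith

theorem outer_arc (C : Cx D R N f φ ψ) {o0 o'} (ho : D.o = o0 :: o') {e} (he : e ∈ D.all) (j : ℕ)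
    (h : ∀ i, 1 ≤ i → i ≤ j → σ D φ (σ D φ (φ^[i] e)) = φ^[i] e ∧ φ^[i] e ≠ σ D φ o0) (heo : D.ε e ∈ D.o) :
    iW (Wd D φ e (j + 1)) <:+: D.o.map D.lab := by
  have h' := fun i h1 h2 => (h i h1 h2).1
  rw [← C.chainW he j h']
  set d0 := D.ε (φ^[j] e) with hd0
  have hoo : D.o ∈ D.o :: D.inn := by simp
  have hd0a : d0 ∈ D.all := C.ok.εm _ (C.ita he _)
  have hch := C.chain he j h'
  have hd0o : d0 ∈ D.o := by
    obtain ⟨l, hl, hm⟩ := Dg.mem_all.1 hd0a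
    rcases List.mem_cons.1 hl with rfl | hl2
    · exact hm
    · exfalso
      have := C.itm hl hm j
      rw [hd0, hch j le_rfl] at this
      simp at this
      exact C.ndisj hl2 this heo
  obtain ⟨a, b, ea⟩ := List.append_of_mem hd0o
  obtain ⟨k1, k2⟩ := C.h2 D.o hoo a d0 b ea
  have hlen : D.o.length = (b.length + 1) + a.length := by rw [ea]; simp; omega
  have k3 : List.iterate φ d0 (b.length + 1) = d0 :: b ∧ List.iterate φ (φ^[b.length + 1] d0) a.length = a := by
    rw [hlen, List.iterate_add] at k1
    rw [← List.cons_append] at k1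
    have := List.append_inj k1 (by simp)
    exact ⟨this.1.symm, this.2.symm⟩
  by_cases hc : j + 1 ≤ b.length + 1
  · have e1 : List.iterate φ d0 (b.length + 1) = List.iterate φ d0 (j + 1) ++
        List.iterate φ (φ^[j + 1] d0) (b.length + 1 - (j + 1)) := by
      rw [← List.iterate_add]; congr 1; omega
    unfold Wd
    apply List.IsInfix.map
    refine ⟨a, List.iterate φ (φ^[j + 1] d0) (b.length + 1 - (j + 1)), ?_⟩
    rw [append_assoc, ← e1, k3.1, ea]
  · exfalso
    have hB : φ^[b.length + 1] d0 = o0 := by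
      cases ha : a with
      | nil =>
        rw [ha] at hlen ea
        simp at hlen
        rw [← hlen, k2]
        rw [ho] at ea
        simpa using (List.cons.inj ea).1.symm
      | cons x a' =>
        have := k3.2
        rw [ha, List.length_cons, List.iterate] at this
        rw [ha, ho] at ea
        rw [(List.cons.inj this).1, (List.cons.inj ea).1]
    rw [hd0, hch (b.length + 1) (by omega)] at hB
    refine (h (j - (b.length + 1) + 1) (by omega) (by omega)).2 ?_
    rw [Function.iterate_succ_apply', ← hB]
    unfold σ
    rw [C.ok.εε _ (C.ita he _)]

end Cx
end SC

set_option linter.unusedSectionVars false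
namespace SC
open List
variable {α : Type} {G : Type} [Group G]
variable {R : Set (List (α × Bool))} {f : FreeGroup α →* G} {N : ℕ}
variable {D : Dg α G} {φ ψ : ℕ → ℕ}

/-- conclusion of Greendlinger's lemma -/
def Gr (R : Set (List (α × Bool))) (N : ℕ) (w : List (α × Bool)) : Prop :=
  ∃ s t, s <:+: w ∧ s ++ t ∈ R ∧ N * t.length ≤ 3 * (s ++ t).length

namespace Cx

def sp (D : Dg α G) (φ : ℕ → ℕ) (o0 d : ℕ) : Prop := σ D φ (σ D φ d) ≠ d ∨ d = o0 ∨ d = σ D φ o0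

theorem arcs (C : Cx D R N f φ ψ) (o0 : ℕ) {l} (hl : l ∈ D.o :: D.inn) {e0} (he0 : e0 ∈ l) (hs : sp D φ o0 e0) :
    ∀ d ∈ l, ∃ e j, e ∈ l ∧ sp D φ o0 e ∧ j < l.length ∧ φ^[j] e = d ∧
      ∀ i, 1 ≤ i → i ≤ j → ¬ sp D φ o0 (φ^[i] e) := by
  classical
  intro d hd
  obtain ⟨k, hk, rfl⟩ := C.cover hl he0 hd
  set g := Nat.findGreatest (fun j => sp D φ o0 (φ^[j] e0)) k with hg
  have h1 : sp D φ o0 (φ^[g] e0) :=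
    Nat.findGreatest_spec (P := fun j => sp D φ o0 (φ^[j] e0)) (Nat.zero_le k) hs
  have h2 : g ≤ k := Nat.findGreatest_le k
  refine ⟨φ^[g] e0, k - g, C.itm hl he0 g, h1, by omega, ?_, ?_⟩
  · rw [← Function.iterate_add_apply]; congr 1; omega
  · intro i hi1 hi2
    rw [← Function.iterate_add_apply]
    exact Nat.findGreatest_is_greatest (P := fun j => sp D φ o0 (φ^[j] e0)) (n := k) (by omega) (by omega)

open Classical in
theorem face_ineq (C : Cx D R N f φ ψ) {o0 o'} (ho : D.o = o0 :: o') {l} (hl : l ∈ D.inn)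
    (hG : ¬ Gr R N (D.o.map D.lab)) :
    6 ≤ 2 * (l.toFinset.filter fun d => sp D φ o0 d ∧ D.ε d ∈ D.o).card +
      (l.toFinset.filter fun d => sp D φ o0 d ∧ D.ε d ∉ D.o).card +
      (if σ D φ o0 ∈ l then 1 else 0) := by
  have hl' : l ∈ D.o :: D.inn := by simp [hl]
  have hla : ∀ d ∈ l, d ∈ D.all := fun d hd => Dg.mem_all.2 ⟨l, hl', hd⟩
  have hL2 : 2 ≤ l.length := by have := C.S.len _ (C.ok.wi l hl); simpa using this
  have hN := C.S.hN
  have ns1 : ∀ d, ¬ sp D φ o0 d → σ D φ (σ D φ d) = d ∧ d ≠ σ D φ o0 := by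
    intro d hd; unfold sp at hd; push Not at hd; exact ⟨hd.1, hd.2.2⟩
  set O := l.toFinset.filter fun d => sp D φ o0 d ∧ D.ε d ∈ D.o with hO
  set I := l.toFinset.filter fun d => sp D φ o0 d ∧ D.ε d ∉ D.o with hI
  have mO : ∀ d, d ∈ O ↔ d ∈ l ∧ sp D φ o0 d ∧ D.ε d ∈ D.o := fun d => by simp [hO]
  have mI : ∀ d, d ∈ I ↔ d ∈ l ∧ sp D φ o0 d ∧ D.ε d ∉ D.o := fun d => by simp [hI]
  by_cases hex : ∃ e0 ∈ l, sp D φ o0 e0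
  swap
  · exfalso
    push Not at hex
    obtain ⟨d, hd⟩ : ∃ d, d ∈ l := by
      cases hc : l with
      | nil => simp [hc] at hL2
      | cons d l => exact ⟨d, by simp⟩
    have hns : ∀ i, ¬ sp D φ o0 (φ^[i] d) := fun i => hex _ (C.itm hl' hd i)
    have hlen : l.length - 1 + 1 = l.length := by omega
    by_cases heo : D.ε d ∈ D.o
    · have := C.outer_arc ho (hla d hd) (l.length - 1) (fun i _ _ => ns1 _ (hns i)) heo
      rw [hlen] at this
      exact hG ⟨_, [], this, by simpa using C.S.inv _ (C.rotR hl hd), by simp⟩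
    · have := C.inner_arc hl hd (l.length - 1) (by omega) (fun i _ _ => (ns1 _ (hns i)).1) heo
      rw [hlen] at this
      nlinarith
  obtain ⟨e0, he0, hs0⟩ := hex
  have harc := C.arcs o0 hl' he0 hs0
  choose! st bp a1 a2 a3 a4 a5 using harc
  -- inner fibres
  have hfib : ∀ e ∈ I, N * (l.toFinset.filter fun d => st d = e).card ≤ l.length := by
    intro e he
    obtain ⟨hel, hes, heo⟩ := (mI e).1 he
    have hcard : (l.toFinset.filter fun d => st d = e).card ≤ (Finset.range (l.length / N)).card := by
      apply Finset.card_le_card_of_injOn bp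
      · intro d hd
        simp only [Finset.coe_filter, List.mem_toFinset, Set.mem_ofPred_eq] at hd
        obtain ⟨hd, hde⟩ := hd
        simp only [Finset.coe_range, Set.mem_Iio]
        have h5 := a5 d hd
        rw [hde] at h5
        have := C.inner_arc hl hel (bp d) (a3 d hd) (fun i h1 h2 => (ns1 _ (h5 i h1 h2)).1) heo
        rw [Nat.lt_iff_add_one_le, Nat.le_div_iff_mul_le (by omega)]
        linarith
      · intro d hd d' hd' hh
        simp only [Finset.coe_filter, List.mem_toFinset, Set.mem_ofPred_eq] at hd hd'
        rw [← a4 d hd.1, ← a4 d' hd'.1, hd.2, hd'.2, hh]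
    rw [Finset.card_range] at hcard
    calc _ ≤ N * (l.length / N) := Nat.mul_le_mul_left _ hcard
      _ ≤ _ := Nat.mul_div_le _ _
  have hsum : l.length = ∑ e ∈ O, (l.toFinset.filter fun d => st d = e).card +
      ∑ e ∈ I, (l.toFinset.filter fun d => st d = e).card := by
    rw [← List.toFinset_card_of_nodup (C.lnd hl'), ← Finset.sum_union]
    · apply Finset.card_eq_sum_card_fiberwise
      intro d hd
      simp only [List.coe_toFinset, Set.mem_ofPred_eq] at hd
      simp only [Finset.coe_union, Set.mem_union, Finset.mem_coe, mO, mI]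
      by_cases hh : D.ε (st d) ∈ D.o
      · exact Or.inl ⟨a1 d hd, a2 d hd, hh⟩
      · exact Or.inr ⟨a1 d hd, a2 d hd, hh⟩
    · rw [Finset.disjoint_left]; intro d h1 h2
      rw [mO] at h1; rw [mI] at h2; exact h2.2.2 h1.2.2
  have hsumI : N * ∑ e ∈ I, (l.toFinset.filter fun d => st d = e).card ≤ I.card * l.length := by
    rw [Finset.mul_sum]
    calc _ ≤ ∑ e ∈ I, l.length := Finset.sum_le_sum hfib
      _ = _ := by simp
  -- k ≤ m + [b]
  have toI : ∀ e, e ∈ l → sp D φ o0 e → D.ε e ∈ D.o → e ≠ σ D φ o0 → st (ψ e) ∈ I := by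
    intro e hel hes heo hb
    rw [mI]
    have hψ := (C.h1 l hl' e hel).2.1
    refine ⟨a1 _ hψ, a2 _ hψ, ?_⟩
    intro hso
    -- ε (ψ e) ∈ o
    have hch := C.chain (hla _ (a1 _ hψ)) (bp (ψ e)) (fun i h1 h2 => (ns1 _ (a5 _ hψ i h1 h2)).1) _ le_rfl
    rw [a4 _ hψ] at hch
    simp at hch
    have hψa := hla _ hψ
    have hεo : D.ε (ψ e) ∈ D.o := by
      obtain ⟨l2, hl2, hm⟩ := Dg.mem_all.1 (C.ok.εm _ hψa)
      rcases List.mem_cons.1 hl2 with rfl | hl3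
      · exact hm
      · exfalso
        have := C.itm hl2 hm (bp (ψ e))
        rw [hch] at this
        exact C.ndisj hl3 this hso
    have hea := hla e hel
    -- both at the same vertex
    have v1 : σ D φ (D.ε (ψ e)) = e := by
      unfold σ; rw [C.ok.εε _ hψa, C.φψ hea]
    have v2 : D.vt (D.ε (ψ e)) = D.vt e := by
      rw [← C.vtσ (C.ok.εm _ hψa), v1]
    have v3 : σ D φ e ∈ D.o := (C.h1 D.o (by simp) _ heo).1
    have v4 := C.vinj _ hεo _ v3 (by rw [v2, C.vtσ hea])
    rcases hes with h | h | h
    · apply h; rw [← v4, v1]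
    · exact C.ndisj hl hel (by rw [h, ho]; simp)
    · exact hb h
  have hk : O.card ≤ I.card + (if σ D φ o0 ∈ l then 1 else 0) := by
    have : O.card ≤ (I ∪ (if σ D φ o0 ∈ l then {σ D φ o0} else ∅)).card := by
      apply Finset.card_le_card_of_injOn (fun e => if e = σ D φ o0 then σ D φ o0 else st (ψ e))
      · intro e he
        simp only [Finset.mem_coe, mO] at he
        obtain ⟨hel, hes, heo⟩ := he
        simp only [Finset.coe_union, Set.mem_union, Finset.mem_coe]
        by_cases hb : e = σ D φ o0
        · right
          rw [if_pos hb, if_pos (hb ▸ hel)]; simp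
        · left
          rw [if_neg hb]
          exact toI e hel hes heo hb
      · intro e he e' he' hh
        simp only [Finset.mem_coe, mO] at he he'
        simp only at hh
        have key : ∀ e ∈ l, sp D φ o0 e → φ^[bp (ψ e) + 1] (st (ψ e)) = e := by
          intro e hel hes
          rw [Function.iterate_succ_apply', a4 _ (C.h1 l hl' e hel).2.1, C.φψ (hla e hel)]
        have k1 := key e he.1 he.2.1
        have k2 := key e' he'.1 he'.2.1
        have hψ := (C.h1 l hl' e he.1).2.1
        have hψ' := (C.h1 l hl' e' he'.1).2.1
        have main : st (ψ e) = st (ψ e') → e = e' := by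
          intro hst
          rcases lt_trichotomy (bp (ψ e)) (bp (ψ e')) with hlt | heq | hlt
          · exfalso
            apply a5 _ hψ' (bp (ψ e) + 1) (by omega) (by omega)
            rw [← hst, k1]; exact he.2.1
          · rw [← k1, ← k2, hst, heq]
          · exfalso
            apply a5 _ hψ (bp (ψ e') + 1) (by omega) (by omega)
            rw [hst, k2]; exact he'.2.1
        by_cases hb : e = σ D φ o0 <;> by_cases hb' : e' = σ D φ o0
        · rw [hb, hb']
        · rw [if_pos hb, if_neg hb'] at hh
          have := (mI _).1 (toI e' he'.1 he'.2.1 he'.2.2 hb')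
          rw [← hh, ← hb] at this
          exact absurd he.2.2 this.2.2
        · rw [if_neg hb, if_pos hb'] at hh
          have := (mI _).1 (toI e he.1 he.2.1 he.2.2 hb)
          rw [hh, ← hb'] at this
          exact absurd he'.2.2 this.2.2
        · rw [if_neg hb, if_neg hb'] at hh
          exact main hh
    refine this.trans ((Finset.card_union_le _ _).trans ?_)
    split_ifs <;> simp
  -- good face
  by_contra hlt
  push Not at hlt
  have hI5 : I.card ≤ 5 := by omega
  rcases Nat.lt_or_ge O.card 2 with h2 | h2
  · rcases Nat.lt_or_ge O.card 1 with h1 | h1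
    · have : O = ∅ := Finset.card_eq_zero.1 (by omega)
      rw [this] at hsum
      simp only [Finset.sum_empty, zero_add] at hsum
      rw [← hsum] at hsumI
      nlinarith
    · have h1' : O.card = 1 := by omega
      obtain ⟨e, he⟩ := Finset.card_eq_one.1 h1'
      have hI3 : I.card ≤ 3 := by omega
      rw [he, Finset.sum_singleton] at hsum
      have heO := (mO e).1 (by rw [he]; simp)
      set Fi := l.toFinset.filter fun d => st d = e with hFi
      have hne : Fi.Nonempty := by
        by_contra hem
        rw [Finset.not_nonempty_iff_eq_empty] at hem
        rw [hem, Finset.card_empty, zero_add] at hsum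
        rw [← hsum] at hsumI
        nlinarith
      obtain ⟨d, hd, hmax⟩ := Finset.exists_max_image Fi bp hne
      simp only [hFi, Finset.mem_filter, List.mem_toFinset] at hd
      have hcard : Fi.card ≤ (Finset.range (bp d + 1)).card := by
        apply Finset.card_le_card_of_injOn bp
        · intro d' hd'
          have := hmax d' hd'
          simp only [Finset.coe_range, Set.mem_Iio]; omega
        · intro d hd d' hd' hh
          simp only [hFi, Finset.coe_filter, List.mem_toFinset, Set.mem_ofPred_eq] at hd hd'
          rw [← a4 d hd.1, ← a4 d' hd'.1, hd.2, hd'.2, hh]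
      rw [Finset.card_range] at hcard
      have h5 := a5 d hd.1
      rw [hd.2] at h5
      have hout := C.outer_arc ho (hla e heO.1) (bp d) (fun i h1 h2 => ns1 _ (h5 i h1 h2)) heO.2.2
      have hbl := a3 d hd.1
      apply hG
      have hlast : φ^[bp d + 1] e ∈ l := C.itm hl' heO.1 _
      have e1 : Wd D φ (φ^[bp d + 1] e) l.length =
          Wd D φ (φ^[bp d + 1] e) (l.length - (bp d + 1)) ++ Wd D φ e (bp d + 1) := by
        have : l.length = (l.length - (bp d + 1)) + (bp d + 1) := by omega
        conv_lhs => rw [this]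
        rw [Wd_add]
        congr 2
        rw [← Function.iterate_add_apply]
        have : l.length - (bp d + 1) + (bp d + 1) = l.length := by omega
        rw [this]; exact C.per hl' heO.1
      have r1 := C.S.inv _ (C.rotR hl hlast)
      rw [e1, iW_append] at r1
      refine ⟨_, _, hout, r1, ?_⟩
      simp only [iW_length, Wd_length, length_append]
      have hh : l.length - (bp d + 1) ≤ ∑ e ∈ I, (l.toFinset.filter fun d => st d = e).card := by omega
      calc N * (l.length - (bp d + 1)) ≤ N * ∑ e ∈ I, (l.toFinset.filter fun d => st d = e).card :=
            Nat.mul_le_mul_left _ hh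
        _ ≤ I.card * l.length := hsumI
        _ ≤ 3 * l.length := Nat.mul_le_mul_right _ hI3
        _ = _ := by congr 1; omega
  · split_ifs at hk hlt <;> omega

end Cx
end SC

set_option linter.unusedSectionVars false
namespace SC
open List
variable {α : Type} {G : Type} [Group G]
variable {R : Set (List (α × Bool))} {f : FreeGroup α →* G} {N : ℕ}
variable {D : Dg α G} {φ ψ : ℕ → ℕ}
namespace Cx

theorem sp_closed (C : Cx D R N f φ ψ) {o0 d} (ho0 : o0 ∈ D.all) (hd : d ∈ D.all) (h : sp D φ o0 d) : sp D φ o0 (σ D φ d) := by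
  have key : ∀ d ∈ D.all, σ D φ (σ D φ d) ≠ d → σ D φ (σ D φ (σ D φ d)) ≠ σ D φ d := by
    intro d hd h h'
    exact h (C.σinj (C.σm (C.σm hd)) hd h')
  rcases h with h | rfl | rfl
  · exact Or.inl (key d hd h)
  · right; right; rfl
  · by_cases h : σ D φ (σ D φ o0) = o0
    · right; left; exact h
    · left; exact key _ (C.σm ho0) (key _ ho0 h)

theorem nodup_card_filter {l : List ℕ} (h : l.Nodup) (p : ℕ → Prop) [DecidablePred p] :
    (l.toFinset.filter p).card = l.countP (fun d => decide (p d)) := by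
  rw [List.countP_eq_length_filter, ← List.toFinset_card_of_nodup (h.filter _), List.toFinset_filter]; congr 1; ext d; simp

open Classical in
theorem contra (C : Cx D R N f φ ψ) (hG : ¬ Gr R N (D.o.map D.lab)) : False := by
  obtain ⟨o0, o', ho⟩ : ∃ o0 o', D.o = o0 :: o' := by
    cases hc : D.o with
    | nil => exact absurd hc C.one
    | cons a b => exact ⟨a, b, rfl⟩
  have ho0 : o0 ∈ D.all := by simp [Dg.all, ho]
  have hflnd : D.inn.flatten.Nodup := by
    have := C.ok.nd; unfold Dg.all at this; exact (List.nodup_append.1 this).2.1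
  have hond : D.o.Nodup := by
    have := C.ok.nd; unfold Dg.all at this; exact (List.nodup_append.1 this).1
  set P1 : ℕ → Prop := fun d => sp D φ o0 d ∧ D.ε d ∈ D.o with hP1
  set P2 : ℕ → Prop := fun d => sp D φ o0 d ∧ D.ε d ∉ D.o with hP2
  have step : ∀ L : List (List ℕ), (∀ l ∈ L, l ∈ D.inn) →
      6 * L.length ≤ 2 * L.flatten.countP (fun d => decide (P1 d)) + L.flatten.countP (fun d => decide (P2 d))
        + L.flatten.count (σ D φ o0) := by
    intro L
    induction L with
    | nil => simp
    | cons l L ih =>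
      intro h
      have h1 := ih (fun l hl => h l (by simp [hl]))
      have hl := h l (by simp)
      have h2 := C.face_ineq ho hl hG
      have hn : l.Nodup := C.lnd (by simp [hl])
      rw [nodup_card_filter hn, nodup_card_filter hn] at h2
      have h3 : (if σ D φ o0 ∈ l then 1 else 0) ≤ l.count (σ D φ o0) := by
        split_ifs with hh
        · exact List.count_pos_iff.2 hh
        · simp
      simp only [List.flatten_cons, List.countP_append, List.count_append, List.length_cons]
      simp only [hP1, hP2] at h1 h2 ⊢
      omega
  have h1 := step D.inn (fun l h => h)
  have h2 : D.inn.flatten.count (σ D φ o0) ≤ 1 := List.nodup_iff_count_le_one.1 hflnd _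
  have h3 := C.D3_le
  rw [← nodup_card_filter hflnd, ← nodup_card_filter hflnd] at h1
  set A := D.inn.flatten.toFinset.filter P1 with hA
  set B := D.inn.flatten.toFinset.filter P2 with hB
  set O := D.o.toFinset.filter (sp D φ o0) with hO
  have hAO : A.card ≤ O.card := by
    apply Finset.card_le_card_of_injOn (σ D φ)
    · intro d hd
      simp only [hA, hP1, Finset.coe_filter, Set.mem_ofPred_eq, List.mem_toFinset] at hd
      have hda : d ∈ D.all := by unfold Dg.all; exact List.mem_append_right _ hd.1
      simp only [hO, Finset.coe_filter, Set.mem_ofPred_eq, List.mem_toFinset]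
      exact ⟨(C.h1 D.o (by simp) _ hd.2.2).1, C.sp_closed ho0 hda hd.2.1⟩
    · intro d hd d' hd' h
      simp only [hA, hP1, Finset.coe_filter, Set.mem_ofPred_eq, List.mem_toFinset] at hd hd'
      exact C.σinj (by unfold Dg.all; exact List.mem_append_right _ hd.1) (by unfold Dg.all; exact List.mem_append_right _ hd'.1) h
  have hAB : Disjoint A B := by
    rw [Finset.disjoint_left]; intro d h1 h2
    simp only [hA, hB, hP1, hP2, Finset.mem_filter] at h1 h2
    exact h2.2.2 h1.2.2
  have hABO : Disjoint (A ∪ B) O := by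
    rw [Finset.disjoint_left]; intro d h1 h2
    simp only [hA, hB, hO, hP1, hP2, Finset.mem_filter, Finset.mem_union, List.mem_toFinset] at h1 h2
    have : d ∈ D.inn.flatten := by tauto
    obtain ⟨l, hl, hdl⟩ := List.mem_flatten.1 this
    exact C.ndisj hl hdl h2.1
  have hsub : (A ∪ B) ∪ O ⊆ insert o0 (insert (σ D φ o0) (D3 D φ)) := by
    intro d hd
    have hd' : d ∈ D.all ∧ sp D φ o0 d := by
      simp only [hA, hB, hO, hP1, hP2, Finset.mem_filter, Finset.mem_union, List.mem_toFinset] at hd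
      simp only [Dg.all, List.mem_append]; tauto
    simp only [Finset.mem_insert, D3, Finset.mem_filter, List.mem_toFinset]
    rcases hd'.2 with h | h | h
    · right; right; exact ⟨hd'.1, h⟩
    · left; exact h
    · right; left; exact h
  have hc := Finset.card_le_card hsub
  rw [Finset.card_union_of_disjoint hABO, Finset.card_union_of_disjoint hAB] at hc
  have i1 := Finset.card_insert_le o0 (insert (σ D φ o0) (D3 D φ))
  have i2 := Finset.card_insert_le (σ D φ o0) (D3 D φ)
  omega

end Cx

theorem isReduced_iff (w : List (α × Bool)) : FreeGroup.IsReduced w ↔ w.IsChain (fun a b => b ≠ iL a) := by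
  unfold FreeGroup.IsReduced
  constructor <;> intro h <;> refine List.IsChain.imp ?_ h
  · rintro ⟨a, b⟩ ⟨c, d⟩ h1 h2
    simp [iL] at h2
    have := h1 h2.1.symm
    rw [h2.2] at this; simp at this
  · rintro ⟨a, b⟩ ⟨c, d⟩ h1 h2
    simp [iL] at h1 h2 ⊢
    have := h1 h2.symm
    cases b <;> cases d <;> simp_all

/-- Greendlinger's lemma -/
theorem greendlinger [Inhabited α] (S : Sys R N f)
    (hker : ∀ g : FreeGroup α, f g = 1 → g ∈ Subgroup.normalClosure (FreeGroup.mk '' R)) :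
    ∀ n, ∀ w : List (α × Bool), w.length = n → FreeGroup.IsReduced w → w ≠ [] → ev f w = 1 → Gr R N w := by
  intro n
  induction n using Nat.strong_induction_on with
  | _ n ih =>
  intro w hwn hred hne hw
  by_cases hsub : ∃ a s b, w = a ++ s ++ b ∧ s ≠ [] ∧ s.length < w.length ∧ ev f s = 1
  · obtain ⟨a, s, b, rfl, hs, hl, h1⟩ := hsub
    obtain ⟨u, t, h2, h3, h4⟩ := ih s.length (by omega) s rfl ((isReduced_iff _).2 (List.isChain_append.1 (List.isChain_append.1 ((isReduced_iff _).1 hred)).1).2.1) hs h1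
    exact ⟨u, t, h2.trans ⟨a, b, rfl⟩, h3, h4⟩
  push Not at hsub
  obtain ⟨n', hn'⟩ := hasD_normalClosure S (FreeGroup.mk w) (hker _ hw)
  obtain ⟨D, hD, -, hDw⟩ := hn' w hred rfl
  by_contra hG
  have hnd : (D.o :: D.inn).flatten.Nodup := by have := hD.nd; simpa [Dg.all] using this
  obtain ⟨φ, ψ, h1, h2⟩ := exists_phi (D.o :: D.inn) hnd
  have oall : ∀ d ∈ D.o, d ∈ D.all := fun d hd => by simp [Dg.all, hd]
  have honn : D.o ≠ [] := by rintro h; rw [h] at hDw; simp at hDw; exact hne hDw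
  -- cyclic words
  have cyc : ∀ l ∈ D.o :: D.inn, (∀ a x y b, l.map D.lab = a ++ x :: y :: b → y ≠ iL x) →
      (∀ x b y, l.map D.lab = x :: b ++ [y] → x ≠ iL y) → ∀ d ∈ l, D.lab (φ d) ≠ iL (D.lab d) := by
    intro l hl ha hb d hd
    obtain ⟨a, b, e⟩ := List.append_of_mem hd
    obtain ⟨k1, k2⟩ := h2 l hl a d b e
    cases b with
    | cons y b =>
      have hlen : l.length = (b.length + a.length) + 1 + 1 := by rw [e]; simp; omega
      rw [hlen] at k1
      simp [List.iterate] at k1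
      rw [← k1.1]
      exact ha (a.map D.lab) _ _ (b.map D.lab) (by rw [e]; simp)
    | nil =>
      cases a with
      | nil =>
        have hlen : l.length = 1 := by rw [e]; simp
        rw [hlen] at k2
        simp at k2; rw [k2]; exact (iL_ne _).symm
      | cons x a =>
        have hlen : l.length = a.length + 1 + 1 := by rw [e]; simp
        rw [hlen] at k1
        simp [List.iterate] at k1
        rw [← k1.1]
        exact hb _ (a.map D.lab) _ (by rw [e]; simp)
  have C : Cx D R N f φ ψ := by
    refine ⟨hD, S, honn, h1, h2, ?_, ?_⟩
    · have key : ∀ a d m d' b, D.o = a ++ d :: (m ++ d' :: b) → D.vt d = D.vt d' → False := by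
        intro a d m d' b e hv
        have hp := hD.po
        rw [e, Dg.path_append] at hp
        obtain ⟨q, -, hp⟩ := hp
        rw [← List.cons_append, Dg.path_append] at hp
        obtain ⟨q', hp, hq⟩ := hp
        have e1 := hp.1
        have e2 := hq.1
        have := D.path_pot hD _ _ _ (fun x hx => oall x (by rw [e]; simp at hx ⊢; tauto)) hp
        rw [← e1, ← e2, hv] at this
        have h1 : ev f ((d :: m).map D.lab) = 1 := by simpa using this
        refine hsub (a.map D.lab) _ ((d' :: b).map D.lab) ?_ (by simp) ?_ h1
        · rw [← hDw, e]; simp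
        · rw [← hDw, e]; simp; omega
      intro d hd d' hd' hv
      by_contra hdd
      obtain ⟨a, b, e⟩ := List.append_of_mem hd
      rw [e] at hd'
      rcases List.mem_append.1 hd' with h | h
      · obtain ⟨a1, a2, e'⟩ := List.append_of_mem h
        exact key a1 d' a2 d b (by rw [e, e']; simp) hv.symm
      · rcases List.mem_cons.1 h with h | h
        · exact hdd h.symm
        · obtain ⟨a1, a2, e'⟩ := List.append_of_mem h
          exact key a d a1 d' a2 (by rw [e, e']) hv
    · intro d hd
      obtain ⟨l, hl, hdl⟩ := Dg.mem_all.1 hd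
      refine cyc l hl ?_ ?_ d hdl
      · intro a x y b e
        rcases List.mem_cons.1 hl with rfl | hl'
        · rw [hDw] at e
          rw [e, isReduced_iff] at hred
          have := hred.right_of_append
          simp at this
          exact this.1
        · have := hD.wi l hl'
          rw [e] at this
          have := S.rot _ _ this
          exact S.red _ _ _ this
      · intro x b y e hxy
        rcases List.mem_cons.1 hl with rfl | hl'
        · rw [hDw] at e
          have hb : ev f b = 1 := by
            rw [e, hxy] at hw
            have : ev f ([iL y] ++ b ++ [y]) = 1 := hw
            rw [ev_append, ev_append, ev_iL] at this
            have : ev f b = ev f [y] * 1 * (ev f [y])⁻¹ := by rw [← this]; group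
            simpa using this
          cases b with
          | nil =>
            rw [e, isReduced_iff] at hred
            simp at hred
            exact hred (by rw [hxy, iL_iL])
          | cons z b =>
            refine hsub [x] (z :: b) [y] (by rw [e]; simp) (by simp) (by rw [e]; simp) hb
        · have := hD.wi l hl'
          rw [e] at this
          have := S.rot _ _ this
          exact S.red _ _ _ this hxy
  refine C.contra ?_
  rw [hDw]; exact hG
end SC

set_option linter.unusedSectionVars false
namespace SC
open List
variable {β : Type}

/-- word in run-length form -/
def wd (y : β) (L : List (List β × ℕ)) : List β := L.flatMap fun p => p.1 ++ replicate p.2 y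

@[simp] theorem wd_nil (y : β) : wd y [] = [] := rfl
@[simp] theorem wd_cons (y : β) (p L) : wd y (p :: L) = p.1 ++ (replicate p.2 y ++ wd y L) := by simp [wd]
@[simp] theorem wd_append (y : β) (L L') : wd y (L ++ L') = wd y L ++ wd y L' := by simp [wd]

def Good (y : β) (L : List (List β × ℕ)) : Prop := ∀ P ∈ L, P.1 ≠ [] ∧ y ∉ P.1 ∧ 1 ≤ P.2

theorem run_eq {y : β} {n e : ℕ} {T q : List β} {z' : β} (hz' : z' ≠ y) (hT : ∀ t T', T = t :: T' → t ≠ y)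
    (h : replicate n y ++ T = replicate e y ++ z' :: q) : n = e := by
  induction n generalizing e with
  | zero =>
    cases e with
    | zero => rfl
    | succ e => simp [replicate_succ] at h; exact absurd rfl (hT _ _ h)
  | succ n ih =>
    cases e with
    | zero => simp [replicate_succ] at h; exact absurd h.1.symm hz'
    | succ e =>
      simp [replicate_succ] at h
      rw [ih h]

theorem Good.head {y : β} {L} (hL : Good y L) : ∀ t T', wd y L = t :: T' → t ≠ y := by
  intro t T' h
  cases L with
  | nil => simp at h
  | cons p L =>
    obtain ⟨h1, h2, -⟩ := hL p (by simp)
    cases hp : p.1 with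
    | nil => exact absurd hp h1
    | cons a b =>
      simp [hp] at h
      rw [hp] at h2
      rw [← h.1]; rintro rfl; simp at h2

theorem parse {y z z' : β} {e : ℕ} {q : List β} (hz : z ≠ y) (hz' : z' ≠ y) (he : 1 ≤ e) :
    ∀ (L) (_ : Good y L) (p : List β), wd y L = p ++ z :: (replicate e y ++ z' :: q) →
    ∃ L1 X L2, L = L1 ++ (X, e) :: L2 ∧ p ++ [z] = wd y L1 ++ X := by
  intro L
  induction L with
  | nil => intro _ p h; simp at h
  | cons P L ih =>
    intro hL p h
    obtain ⟨X, n⟩ := P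
    have hL' : Good y L := fun P hP => hL P (by simp [hP])
    obtain ⟨h1, h2, h3⟩ := hL (X, n) (by simp)
    simp only [wd_cons] at h
    rcases List.append_eq_append_iff.1 h with ⟨a, ha, hb⟩ | ⟨a, ha, hb⟩
    · -- p = X ++ a
      rcases List.append_eq_append_iff.1 hb with ⟨a', ha', hb'⟩ | ⟨a', ha', hb'⟩
      · obtain ⟨L1, X', L2, e1, e2⟩ := ih hL' a' hb'
        refine ⟨(X, n) :: L1, X', L2, by rw [e1]; simp, ?_⟩
        rw [ha, ha']; simp [e2]
      · cases a' with
        | nil =>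
          simp at hb' ha'
          obtain ⟨L1, X', L2, e1, e2⟩ := ih hL' [] (by simpa using hb'.symm)
          refine ⟨(X, n) :: L1, X', L2, by rw [e1]; simp, ?_⟩
          rw [ha, ← ha']; simp at e2; simp [e2]
        | cons t a' =>
          simp at hb'
          have : t ∈ replicate n y := by rw [ha']; simp
          exact absurd (hb'.1.trans (List.eq_of_mem_replicate this)) hz
    · cases a with
      | nil =>
        simp at hb ha
        subst ha
        exfalso
        cases n with
        | zero => simp at h3
        | succ n => simp [replicate_succ] at hb; exact hz hb.1
      | cons t a =>
        simp at hb
        obtain ⟨rfl, hb⟩ := hb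
        cases a with
        | cons t' a =>
          exfalso
          cases e with
          | zero => simp at he
          | succ e =>
            simp [replicate_succ] at hb
            apply h2; rw [ha]; simp [← hb.1]
        | nil =>
          simp at hb
          have := run_eq hz' hL'.head hb.symm
          subst this
          exact ⟨[], X, L, by simp, by simp [ha]⟩

/-- position uniqueness -/
theorem idx_unique {L L1 L2 L1' L2' : List (List β × ℕ)} {X X' e} (hnd : (L.map Prod.snd).Nodup)
    (h : L ++ L = L1 ++ (X, e) :: L2) (h' : L ++ L = L1' ++ (X', e) :: L2') :
    X = X' ∧ (L1 = L1' ∨ L1 = L ++ L1' ∨ L1' = L ++ L1) := by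
  have norm : ∀ L1 L2 : List (List β × ℕ), ∀ X, L ++ L = L1 ++ (X, e) :: L2 →
      ∃ M T, L = M ++ (X, e) :: T ∧ (L1 = M ∨ L1 = L ++ M) := by
    intro L1 L2 X h
    rcases List.append_eq_append_iff.1 h with ⟨a, ha, hb⟩ | ⟨a, ha, hb⟩
    · exact ⟨a, L2, hb, Or.inr ha⟩
    · cases a with
      | nil => 
        simp at ha hb
        exact ⟨[], L2, by simp [hb], Or.inr (by simp [ha])⟩
      | cons t a =>
        simp at hb
        obtain ⟨rfl, hb⟩ := hb
        exact ⟨L1, a, ha, Or.inl rfl⟩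
  obtain ⟨M, T, e1, e2⟩ := norm _ _ _ h
  obtain ⟨M', T', e1', e2'⟩ := norm _ _ _ h'
  have key : ∀ (M M' T T' : List (List β × ℕ)) X X', (L = M ++ (X, e) :: T) → L = M' ++ (X', e) :: T' → M = M' ∧ X = X' := by
    clear * - hnd
    intro M M' T T' X X' e1 e2
    have hl : M.length = M'.length := by
      have a1 : (L.map Prod.snd)[M.length]? = some e := by rw [e1]; simp
      have a2 : (L.map Prod.snd)[M'.length]? = some e := by rw [e2]; simp
      have l1 : M.length < (L.map Prod.snd).length := by rw [e1]; simp
      exact (List.getElem?_inj l1 hnd).1 (a1.trans a2.symm)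
    have := List.append_inj (e1.symm.trans e2) hl
    simp at this
    exact ⟨this.1, this.2.1⟩
  obtain ⟨rfl, rfl⟩ := key _ _ _ _ _ _ e1 e1'
  refine ⟨rfl, ?_⟩
  rcases e2 with rfl | rfl <;> rcases e2' with rfl | rfl <;> simp

/-- windows contain good markers -/
theorem window {y : β} {hh ll : List β × ℕ} {mid : List (List β × ℕ)} (hmid : mid ≠ []) {M : ℕ}
    (hM : ∀ P ∈ mid, P.1.length + P.2 ≤ M)
    (hG : Good y (hh :: mid ++ [ll]))
    {u s t : List β} (hu : u.length < (wd y (hh :: mid ++ [ll])).length)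
    (hs : wd y ((hh :: mid ++ [ll]) ++ (hh :: mid ++ [ll])) = u ++ s ++ t)
    (hlen : hh.1.length + hh.2 + (ll.1.length + ll.2) + 2 * M + 1 ≤ s.length) :
    ∃ X e z s1 s2, (X, e) ∈ mid ∧ z ≠ y ∧ s = s1 ++ (X ++ (replicate e y ++ z :: s2)) := by
  have fin : ∀ (P : List (List β × ℕ)) X e (T : List (List β × ℕ)),
      (hh :: mid ++ [ll]) ++ (hh :: mid ++ [ll]) = P ++ (X, e) :: T → T ≠ [] → (X, e) ∈ mid →
      u.length ≤ (wd y P).length → (wd y P).length + M + 1 ≤ u.length + s.length →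
      ∃ X e z s1 s2, (X, e) ∈ mid ∧ z ≠ y ∧ s = s1 ++ (X ++ (replicate e y ++ z :: s2)) := by
    intro P X e T hP hT hXe h1 h2
    have hGT : Good y T := by
      intro Q hQ
      have : Q ∈ (hh :: mid ++ [ll]) ++ (hh :: mid ++ [ll]) := by rw [hP]; simp [hQ]
      rcases List.mem_append.1 this with h | h <;> exact hG Q h
    obtain ⟨z, T', hz⟩ : ∃ z T', wd y T = z :: T' := by
      cases T with
      | nil => exact absurd rfl hT
      | cons Q T =>
        cases hq : Q.1 with
        | nil => exact absurd hq (hGT Q (by simp)).1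
        | cons a b => exact ⟨a, b ++ (replicate Q.2 y ++ wd y T), by simp [hq]⟩
    rw [hP] at hs
    simp only [wd_append, wd_cons, hz] at hs
    rw [List.append_assoc u] at hs
    obtain ⟨s1, a1, a2⟩ : ∃ s1, wd y P = u ++ s1 ∧ s ++ t = s1 ++ (X ++ (replicate e y ++ z :: T')) := by
      rcases List.append_eq_append_iff.1 hs with ⟨a, ha, hb⟩ | ⟨a, ha, hb⟩
      · have : a = [] := by
          have := congrArg List.length ha; simp at this
          exact List.length_eq_zero_iff.1 (by omega)
        subst this
        simp at ha hb
        exact ⟨[], by simp [ha], by simp [hb]⟩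
      · exact ⟨a, ha, hb⟩
    refine ⟨X, e, z, s1, (s.drop (s1.length + X.length + e + 1)), hXe, hGT.head _ _ hz, ?_⟩
    have l1 := congrArg List.length a1
    have l2 := hM _ hXe
    simp at l1 l2
    have a3 : s ++ t = (s1 ++ X ++ replicate e y ++ [z]) ++ T' := by rw [a2]; simp
    have l3 : (s1 ++ X ++ replicate e y ++ [z]).length = s1.length + X.length + e + 1 := by simp; omega
    have a4 : s.take (s1.length + X.length + e + 1) = s1 ++ X ++ replicate e y ++ [z] := by
      have := congrArg (List.take (s1.length + X.length + e + 1)) a3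
      rw [List.take_append_of_le_length (by omega), List.take_append_of_le_length (by omega), List.take_of_length_le (l := s1 ++ X ++ replicate e y ++ [z]) (by omega)] at this
      exact this
    conv_lhs => rw [← List.take_append_drop (s1.length + X.length + e + 1) s, a4]
    simp
  -- locate the block of position |u|
  have loc : ∀ L : List (List β × ℕ), ∀ n, n < (wd y L).length → ∃ L1 B L2, L = L1 ++ B :: L2 ∧
      (wd y L1).length ≤ n ∧ n < (wd y L1).length + (B.1.length + B.2) := by
    intro L
    induction L with
    | nil => intro n h; simp at h
    | cons B L ih =>
      intro n h
      by_cases hn : n < B.1.length + B.2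
      · exact ⟨[], B, L, by simp, by simp, by simpa using hn⟩
      · simp at h
        obtain ⟨L1, C, L2, e1, e2, e3⟩ := ih (n - (B.1.length + B.2)) (by omega)
        exact ⟨B :: L1, C, L2, by simp [e1], by simp; omega, by simp; omega⟩
  obtain ⟨L1, B, L2, e1, e2, e3⟩ := loc _ _ hu
  obtain ⟨g, mid', hm⟩ := List.exists_cons_of_ne_nil hmid
  have hgM := hM g (by simp [hm])
  cases L1 with
  | nil =>
    simp at e1 e2 e3
    obtain ⟨rfl, e1⟩ := e1
    refine fin [hh] g.1 g.2 (mid' ++ [ll] ++ (hh :: mid ++ [ll])) (by simp [hm]) (by simp) (by simp [hm]) ?_ ?_ <;> simp <;> omega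
  | cons C L1 =>
    simp at e1
    obtain ⟨rfl, e1⟩ := e1
    rcases List.eq_nil_or_concat L2 with rfl | ⟨L2, l', rfl⟩
    · have : mid ++ [ll] = L1 ++ [B] := e1
      obtain ⟨rfl, h⟩ := List.append_inj' this rfl
      simp at h; subst h
      refine fin (hh :: mid ++ [ll] ++ [hh]) g.1 g.2 (mid' ++ [ll]) (by simp [hm]) (by simp) (by simp [hm]) ?_ ?_ <;> simp at e2 e3 ⊢ <;> omega
    · have : mid ++ [ll] = (L1 ++ B :: L2) ++ [l'] := by simpa using e1
      obtain ⟨e4, h⟩ := List.append_inj' this rfl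
      simp at h; subst h
      have hB := hM B (by simp [e4])
      cases L2 with
      | nil =>
        refine fin (hh :: mid ++ [ll] ++ [hh]) g.1 g.2 (mid' ++ [ll]) (by simp [hm]) (by simp) (by simp [hm]) ?_ ?_ <;>
          simp [e4] at e2 e3 hgM ⊢ <;> omega
      | cons g' L2 =>
        have hg' := hM g' (by simp [e4])
        refine fin (hh :: L1 ++ [B]) g'.1 g'.2 (L2 ++ [ll] ++ (hh :: mid ++ [ll])) (by simp [e4]) (by simp) (by simp [e4]) ?_ ?_ <;>
          simp at e2 e3 ⊢ <;> omega
end SC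

set_option linter.unusedSectionVars false
namespace SC
open List

/-- letters -/
abbrev Ltr (S : IndexedStructure) := GenSym S.A × Bool

structure Code (S : IndexedStructure) where
  y : GenSym S.A
  hh : List (Ltr S) × ℕ
  mid : List (List (Ltr S) × ℕ)
  ll : List (Ltr S) × ℕ

variable {S : IndexedStructure}

abbrev Code.L (c : Code S) := c.hh :: c.mid ++ [c.ll]
def Code.word (c : Code S) : List (Ltr S) := wd (c.y, true) c.L

/-- admissible triples for the chain words -/
inductive Tri (S : IndexedStructure) : ℕ → GenSym S.A → GenSym S.A → Prop
  | f12 : Tri S 4000 GenSym.f1 GenSym.f2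
  | f21 : Tri S 4000 GenSym.f2 GenSym.f1
  | b1 : Tri S 1000 GenSym.b GenSym.f1
  | b2 : Tri S 1000 GenSym.b GenSym.f2
  | c1 : Tri S 2000 GenSym.c GenSym.f1
  | c2 : Tri S 2000 GenSym.c GenSym.f2
  | d1 : Tri S 3000 GenSym.d GenSym.f1
  | d2 : Tri S 3000 GenSym.d GenSym.f2
  | ac (a : S.A) : Tri S 0 (GenSym.elt a) GenSym.c
  | ad (a : S.A) : Tri S 0 (GenSym.elt a) GenSym.d

def xsW (m : ℕ) (as : Fin (S.arity m) → S.A) : List (Ltr S) := List.ofFn fun i => (GenSym.elt (as i), true)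

def chC (lo : ℕ) (x y : GenSym S.A) : Code S :=
  ⟨y, ([(x, true)], (lo + 1) ^ 2), (List.range 998).map (fun k => ([(x, true)], (lo + 1 + k + 1) ^ 2)),
    ([(x, true)], (lo + 1000) ^ 2)⟩

inductive WC (S : IndexedStructure) (m : ℕ) (as : Fin (S.arity m) → S.A) : Code S → Prop
  | rel : ¬ S.isFunc m → S.relInterp m as →
      WC S m as ⟨GenSym.b, (xsW m as, 100 * m + 1), (List.range 98).map (fun k => (xsW m as, 100 * m + 2 + k)),
        (xsW m as, 100 * m + 100)⟩
  | fn (x X) : S.isFunc m → xsW m as = x :: X → x ≠ (GenSym.elt (S.funcInterp m as), true) →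
      WC S m as ⟨GenSym.b, ((GenSym.elt (S.funcInterp m as), false) :: xsW m as, 100 * m + 1),
        (List.range 98).map (fun k => (xsW m as, 100 * m + 2 + k)),
        (xsW m as, 100 * m + 100)⟩
  | fn' (X) : S.isFunc m → xsW m as = (GenSym.elt (S.funcInterp m as), true) :: X → X ≠ [] →
      WC S m as ⟨GenSym.b, (X, 100 * m + 1),
        (List.range 98).map (fun k => (xsW m as, 100 * m + 2 + k)),
        (xsW m as, 100 * m + 100)⟩
  | fn1 : S.isFunc m → xsW m as = [(GenSym.elt (S.funcInterp m as), true)] →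
      WC S m as ⟨GenSym.b, (xsW m as, 100 * m + 2),
        (List.range 97).map (fun k => (xsW m as, 100 * m + 3 + k)),
        (xsW m as, 200 * m + 101)⟩

inductive IsCode (S : IndexedStructure) : Code S → Prop
  | ch (lo x y) : Tri S lo x y → IsCode S (chC lo x y)
  | w (m as c) : 1 ≤ m → WC S m as c → IsCode S c

theorem WC.unique {m as} {c c' : Code S} (h : WC S m as c) (h' : WC S m as c') : c = c' := by
  cases h <;> cases h' <;> simp_all

theorem xsW_length (m) (as : Fin (S.arity m) → S.A) : (xsW m as).length = S.arity m := by simp [xsW]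

theorem xsW_inj {m} {as as' : Fin (S.arity m) → S.A} (h : xsW m as = xsW m as') : as = as' := by
  unfold xsW at h
  have := List.ofFn_injective h
  funext i
  have := congrFun this i
  simpa using this

theorem xsW_mem {m} {as : Fin (S.arity m) → S.A} {z} (h : z ∈ xsW m as) : ∃ a, z = (GenSym.elt a, true) := by
  simp [xsW, List.mem_ofFn] at h
  obtain ⟨i, rfl⟩ := h
  exact ⟨_, rfl⟩

theorem xsW_ne {m} (hm : 1 ≤ m) (as : Fin (S.arity m) → S.A) : xsW m as ≠ [] := by
  intro h
  have := xsW_length m as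
  rw [h] at this
  have h2 := S.arity_pos m hm
  simp only [List.length_nil] at this
  omega

theorem WC.mid {m as} {c : Code S} (h : WC S m as c) :
    c.y = GenSym.b ∧ ∀ P ∈ c.mid, P.1 = xsW m as ∧ 100 * m + 2 ≤ P.2 ∧ P.2 ≤ 100 * m + 99 := by
  cases h <;> simp <;> intros <;> omega

theorem WC.mem {m as} {c : Code S} (h : WC S m as c) :
    ∀ P ∈ c.L, ∀ e, 2 ≤ e → e ≤ 99 → ∀ m', P.2 = 100 * m' + e → m' = m ∧ P.1 = xsW m as := by
  intro P hP e h1 h2 m' he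
  cases h
  all_goals
    simp [Code.L] at hP
    rcases hP with h | ⟨k, hk, h⟩ | h
    all_goals
      subst h
      simp at he ⊢
      try omega

theorem Tri.ne {lo x y} (h : Tri S lo x y) : x ≠ y := by cases h <;> simp
theorem Tri.uniq {lo lo' x y} (h : Tri S lo x y) (h' : Tri S lo' x y) : lo = lo' := by
  cases h <;> cases h' <;> rfl
theorem Tri.yb {lo x y} (h : Tri S lo x y) : y ≠ GenSym.b ∧ ∀ a, y ≠ GenSym.elt a := by cases h <;> simp

theorem chC_mem {lo x y} {P} (hP : P ∈ (chC (S := S) lo x y).L) : P.1 = [(x, true)] ∧ ∃ k < 1000, P.2 = (lo + 1 + k) ^ 2 := by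
  simp [Code.L, chC] at hP
  rcases hP with rfl | ⟨k, hk, rfl⟩ | rfl
  · exact ⟨rfl, 0, by omega, rfl⟩
  · exact ⟨rfl, k + 1, by omega, rfl⟩
  · exact ⟨rfl, 999, by omega, rfl⟩

theorem chC_L (lo) (x y : GenSym S.A) : (chC lo x y).L = (List.range 1000).map (fun k => ([(x, true)], (lo + 1 + k) ^ 2)) := by
  rw [show 1000 = 998 + 1 + 1 from rfl, List.range_succ, List.range_succ_eq_map]
  simp [Code.L, chC]
  intro k hk; ring

theorem len_lin {β : Type} (y : β) (X : List β) (c K : ℕ) :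
    2 * (wd y ((List.range K).map fun k => (X, c + k))).length + K = 2 * K * X.length + 2 * K * c + K * K := by
  induction K with
  | zero => simp
  | succ K ih =>
    rw [List.range_succ, List.map_append, wd_append]
    simp at ih ⊢
    nlinarith

theorem len_sq {β : Type} (y : β) (X : List β) (c K : ℕ) :
    6 * (wd y ((List.range K).map fun k => (X, (c + k) ^ 2))).length + 6 * K * c + 3 * K * K = 
      6 * K * X.length + 6 * K * c * c + 6 * K * K * c + 2 * K ^ 3 + K := by
  induction K with
  | zero => simp
  | succ K ih =>
    rw [List.range_succ, List.map_append, wd_append]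
    simp at ih ⊢
    nlinarith

end SC

set_option linter.unusedSectionVars false
set_option linter.unusedSimpArgs false
set_option linter.unnecessarySeqFocus false
namespace SC
open List
variable {S : IndexedStructure}

theorem IsCode.gens {c : Code S} (h : IsCode S c) : ∀ P ∈ c.L, ∀ z ∈ P.1, z.1 ≠ c.y := by
  cases h with
  | ch lo x y t =>
    intro P hP z hz
    rw [(chC_mem hP).1] at hz
    simp at hz; subst hz
    exact t.ne
  | w m as c hm h =>
    have key : ∀ z ∈ xsW m as, z.1 ≠ GenSym.b := by
      intro z hz; obtain ⟨a, rfl⟩ := xsW_mem hz; simp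
    intro P hP z hz
    cases h with
    | rel => 
      simp [Code.L] at hP
      rcases hP with rfl | ⟨k, hk, rfl⟩ | rfl <;> exact key z hz
    | fn =>
      simp [Code.L] at hP
      rcases hP with rfl | ⟨k, hk, rfl⟩ | rfl
      · simp at hz
        rcases hz with rfl | hz
        · simp
        · exact key z hz
      · exact key z hz
      · exact key z hz
    | fn' X h1 h2 h3 =>
      simp [Code.L] at hP
      rcases hP with rfl | ⟨k, hk, rfl⟩ | rfl
      · exact key z (by rw [h2]; simp at hz; simp [hz])
      · exact key z hz
      · exact key z hz
    | fn1 =>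
      simp [Code.L] at hP
      rcases hP with rfl | ⟨k, hk, rfl⟩ | rfl <;> exact key z hz

theorem IsCode.good {c : Code S} (h : IsCode S c) : Good (c.y, true) c.L := by
  intro P hP
  refine ⟨?_, fun hm => h.gens P hP _ hm rfl, ?_⟩
  · cases h with
    | ch lo x y t => rw [(chC_mem hP).1]; simp
    | w m as c hm h =>
      have := xsW_ne hm as
      cases h <;> (simp [Code.L] at hP; rcases hP with rfl | ⟨k, hk, rfl⟩ | rfl <;> simp_all)
  · cases h with
    | ch lo x y t => obtain ⟨k, hk, e⟩ := (chC_mem hP).2; rw [e]; exact Nat.one_le_pow _ _ (by omega)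
    | w m as c hm h =>
      cases h <;> (simp [Code.L] at hP; rcases hP with rfl | ⟨k, hk, rfl⟩ | rfl <;> simp <;> omega)

theorem IsCode.nd {c : Code S} (h : IsCode S c) : (c.L.map Prod.snd).Nodup := by
  cases h with
  | ch lo x y t =>
    rw [chC_L, List.map_map]
    apply List.Nodup.map _ List.nodup_range
    intro k k' h
    simp at h
    omega
  | w m as c hm h =>
    have key : ∀ c K, ((List.range K).map fun k => c + k).Nodup := fun c K => 
      List.Nodup.map (fun a b h => by simpa using h) List.nodup_range
    cases h
    all_goals
      simp only [Code.L, List.cons_append, List.map_cons, List.map_append, List.map_map, List.nodup_cons, List.map_nil,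
        List.nodup_append]
      refine ⟨?_, ?_, by simp, ?_⟩
      · intro hh
        simp only [List.mem_append, List.mem_map, List.mem_range, Function.comp, List.mem_singleton] at hh
        obtain hh | hh := hh
        · obtain ⟨k, hk, hh⟩ := hh; omega
        · omega
      · exact key _ _
      · simp; intro k hk; omega

theorem IsCode.midne {c : Code S} (h : IsCode S c) : c.mid ≠ [] := by
  cases h with
  | ch lo x y t => simp [chC]
  | w m as c hm h => cases h <;> simp

theorem chC_length (lo) (x y : GenSym S.A) : (chC lo x y).word.length = 1000 * lo * lo + 1001000 * lo + 333834500 := by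
  unfold Code.word
  rw [chC_L]
  have := len_sq ((chC lo x y).y, true) [(x, true)] (lo + 1) 1000
  simp only [List.length_singleton] at this
  nlinarith

theorem Code.word_len (c : Code S) : c.word.length = c.hh.1.length + c.hh.2 + (wd (c.y, true) c.mid).length + (c.ll.1.length + c.ll.2) := by
  simp [Code.word]; omega

theorem IsCode.bound {c : Code S} (h : IsCode S c) : ∃ M, (∀ P ∈ c.mid, P.1.length + P.2 ≤ M) ∧
    15 * (c.hh.1.length + c.hh.2 + (c.ll.1.length + c.ll.2) + 2 * M) ≤ c.word.length := by
  cases h with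
  | ch lo x y t =>
    refine ⟨1 + (lo + 1000) ^ 2, ?_, ?_⟩
    · intro P hP
      have hP' : P ∈ (chC lo x y).L := by simp [Code.L, hP]
      obtain ⟨h1, k, hk, h2⟩ := chC_mem hP'
      rw [h1, h2]
      have : (lo + 1 + k) ^ 2 ≤ (lo + 1000) ^ 2 := Nat.pow_le_pow_left (by omega) 2
      simp; omega
    · rw [chC_length]
      simp only [chC, List.length_singleton]
      nlinarith
  | w m as c hm h =>
    refine ⟨(xsW m as).length + 100 * m + 99, ?_, ?_⟩
    · intro P hP
      obtain ⟨h1, h2, h3⟩ := h.mid.2 P hP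
      rw [h1]; omega
    · cases h with
      | rel =>
        have := len_lin (GenSym.b, true) (xsW m as) (100 * m + 2) 98
        rw [Code.word_len]
        generalize List.length (wd _ _) = nn at this ⊢
        simp only [length_cons]
        omega
      | fn =>
        have := len_lin (GenSym.b, true) (xsW m as) (100 * m + 2) 98
        rw [Code.word_len]
        generalize List.length (wd _ _) = nn at this ⊢
        simp only [length_cons]
        omega
      | fn' X h1 h2 h3 =>
        have hl := congrArg List.length h2
        have := len_lin (GenSym.b, true) (xsW m as) (100 * m + 2) 98
        rw [Code.word_len]
        generalize List.length (wd _ _) = nn at this ⊢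
        simp only [length_cons, length_nil] at hl ⊢
        omega
      | fn1 h1 h2 =>
        have hl := congrArg List.length h2
        have := len_lin (GenSym.b, true) (xsW m as) (100 * m + 3) 97
        rw [Code.word_len]
        generalize List.length (wd _ _) = nn at this ⊢
        simp only [length_cons, length_nil] at hl ⊢
        omega

theorem IsCode.len {c : Code S} (h : IsCode S c) : 15000 ≤ c.word.length := by
  cases h with
  | ch lo x y t => rw [chC_length]; omega
  | w m as c hm h =>
    have hx : 1 ≤ (xsW m as).length := List.length_pos_iff.2 (xsW_ne hm as)
    cases h with
    | rel =>
      have := len_lin (GenSym.b, true) (xsW m as) (100 * m + 2) 98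
      rw [Code.word_len]
      generalize List.length (wd _ _) = nn at this ⊢
      simp only [length_cons]
      omega
    | fn =>
      have := len_lin (GenSym.b, true) (xsW m as) (100 * m + 2) 98
      rw [Code.word_len]
      generalize List.length (wd _ _) = nn at this ⊢
      simp only [length_cons]
      omega
    | fn' X h1 h2 h3 =>
      have hl := congrArg List.length h2
      have := len_lin (GenSym.b, true) (xsW m as) (100 * m + 2) 98
      rw [Code.word_len]
      generalize List.length (wd _ _) = nn at this ⊢
      simp only [length_cons, length_nil] at hl ⊢
      omega
    | fn1 h1 h2 =>
      have hl := congrArg List.length h2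
      have := len_lin (GenSym.b, true) (xsW m as) (100 * m + 3) 97
      rw [Code.word_len]
      generalize List.length (wd _ _) = nn at this ⊢
      simp only [length_cons, length_nil] at hl ⊢
      omega

def negs (w : List (Ltr S)) : ℕ := w.countP (fun z => !z.2)
def poss (w : List (Ltr S)) : ℕ := w.countP (fun z => z.2)

theorem negs_zero {w : List (Ltr S)} (h : ∀ z ∈ w, z.2 = true) : negs w = 0 := by
  unfold negs; rw [List.countP_eq_zero]; intro z hz; simp [h z hz]

theorem negs_wd (y : GenSym S.A) {L : List (List (Ltr S) × ℕ)} (h : ∀ P ∈ L, ∀ z ∈ P.1, z.2 = true) : negs (wd (y, true) L) = 0 := by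
  apply negs_zero
  intro z hz
  simp only [wd, List.mem_flatMap, List.mem_append] at hz
  obtain ⟨P, hP, hz | hz⟩ := hz
  · exact h P hP z hz
  · rw [List.eq_of_mem_replicate hz]

theorem IsCode.neg {c : Code S} (h : IsCode S c) : negs c.word ≤ 1 := by
  have key : ∀ m as, ∀ z ∈ xsW (S := S) m as, z.2 = true := by
    intro m as z hz; obtain ⟨a, rfl⟩ := xsW_mem hz; simp
  cases h with
  | ch lo x y t =>
    have := negs_wd (S := S) (chC lo x y).y (L := (chC lo x y).L) (by
      intro P hP z hz; rw [(chC_mem hP).1] at hz; simp at hz; rw [hz])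
    unfold Code.word; omega
  | w m as c hm h =>
    cases h with
    | rel => 
      have := negs_wd (S := S) GenSym.b (L := (xsW m as, 100 * m + 1) :: (List.range 98).map (fun k => (xsW m as, 100 * m + 2 + k)) ++
        [(xsW m as, 100 * m + 100)]) (by
        intro P hP z hz; simp at hP
        rcases hP with rfl | ⟨k, hk, rfl⟩ | rfl <;> exact key m as z hz)
      simp only [Code.word, Code.L]; omega
    | fn => 
      have := negs_wd (S := S) GenSym.b (L := (xsW m as, 100 * m + 1) :: (List.range 98).map (fun k => (xsW m as, 100 * m + 2 + k)) ++
        [(xsW m as, 100 * m + 100)]) (by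
        intro P hP z hz; simp at hP
        rcases hP with rfl | ⟨k, hk, rfl⟩ | rfl <;> exact key m as z hz)
      simp [Code.word, Code.L, negs] at this ⊢; omega
    | fn' X h1 h2 h3 =>
      have := negs_wd (S := S) GenSym.b (L := (X, 100 * m + 1) :: (List.range 98).map (fun k => (xsW m as, 100 * m + 2 + k)) ++
        [(xsW m as, 100 * m + 100)]) (by
        intro P hP z hz; simp at hP
        rcases hP with rfl | ⟨k, hk, rfl⟩ | rfl
        · exact key m as z (by rw [h2]; simp at hz; simp [hz])
        · exact key m as z hz
        · exact key m as z hz)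
      simp only [Code.word, Code.L]; omega
    | fn1 h1 h2 => 
      have := negs_wd (S := S) GenSym.b (L := (xsW m as, 100 * m + 2) :: (List.range 97).map (fun k => (xsW m as, 100 * m + 3 + k)) ++
        [(xsW m as, 200 * m + 101)]) (by
        intro P hP z hz; simp at hP
        rcases hP with rfl | ⟨k, hk, rfl⟩ | rfl <;> exact key m as z hz)
      simp only [Code.word, Code.L]; omega

theorem chain_pos {w : List (Ltr S)} (h : ∀ z ∈ w, z.2 = true) : w.IsChain (fun a b => b ≠ iL a) := by
  induction w with
  | nil => simp
  | cons a w ih =>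
    cases w with
    | nil => simp
    | cons b w =>
      rw [List.isChain_cons_cons]
      refine ⟨?_, ih (fun z hz => h z (by simp [hz]))⟩
      have h1 := h a (by simp)
      have h2 := h b (by simp)
      rintro rfl
      simp [iL, h1] at h2

theorem IsCode.chain {c : Code S} (h : IsCode S c) : ∀ P ∈ c.L, P.1.IsChain (fun a b => b ≠ iL a) := by
  have key : ∀ m as, ∀ z ∈ xsW (S := S) m as, z.2 = true := by
    intro m as z hz; obtain ⟨a, rfl⟩ := xsW_mem hz; simp
  intro P hP
  cases h with
  | ch lo x y t => rw [(chC_mem hP).1]; simp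
  | w m as c hm h =>
    have k2 := chain_pos (key m as)
    cases h with
    | rel => simp [Code.L] at hP; rcases hP with rfl | ⟨k, hk, rfl⟩ | rfl <;> exact k2
    | fn x X h1 h2 h3 => 
      simp [Code.L] at hP; rcases hP with rfl | ⟨k, hk, rfl⟩ | rfl
      · rw [h2] at k2 ⊢
        simp only [List.isChain_cons_cons]
        refine ⟨?_, k2⟩
        rintro rfl
        simp [iL] at h3
      · exact k2
      · exact k2
    | fn' X h1 h2 h3 => 
      simp [Code.L] at hP; rcases hP with rfl | ⟨k, hk, rfl⟩ | rfl
      · rw [h2] at k2; simpa using k2.tail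
      · exact k2
      · exact k2
    | fn1 h1 h2 => simp [Code.L] at hP; rcases hP with rfl | ⟨k, hk, rfl⟩ | rfl <;> exact k2

theorem wd_chain (y : GenSym S.A) {L : List (List (Ltr S) × ℕ)} (h1 : ∀ P ∈ L, P.1.IsChain (fun a b => b ≠ iL a))
    (h2 : ∀ P ∈ L, ∀ z ∈ P.1, z.1 ≠ y) (h3 : Good (y, true) L) : (wd (y, true) L).IsChain (fun a b => b ≠ iL a) := by
  induction L with
  | nil => simp
  | cons P L ih =>
    have ih' := ih (fun P hP => h1 P (by simp [hP])) (fun P hP => h2 P (by simp [hP])) (fun P hP => h3 P (by simp [hP]))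
    have hL : ∀ z, (wd (y, true) L).head? = some z → z ≠ iL (y, true) := by
      intro z hz
      cases L with
      | nil => simp at hz
      | cons Q L =>
        have hq := (h3 Q (by simp)).1
        cases hQ : Q.1 with
        | nil => exact absurd hQ hq
        | cons a b =>
          simp [hQ] at hz
          subst hz
          have := h2 Q (by simp) a (by simp [hQ])
          rintro rfl
          simp [iL] at this
    rw [wd_cons, List.isChain_append, List.isChain_append]
    refine ⟨h1 P (by simp), ⟨?_, ih', ?_⟩, ?_⟩
    · apply chain_pos; intro z hz; rw [List.eq_of_mem_replicate hz]
    · intro a ha b hb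
      have := List.mem_of_mem_getLast? ha
      rw [List.eq_of_mem_replicate this]
      exact hL b hb
    · intro a ha b hb
      have h4 := List.mem_of_mem_getLast? ha
      have h5 := (h3 P (by simp)).2.2
      obtain ⟨n, hn⟩ : ∃ n, P.2 = n + 1 := ⟨P.2 - 1, by omega⟩
      simp [hn, replicate_succ] at hb
      subst hb
      have := h2 P (by simp) a h4
      intro h
      apply this
      have := congrArg Prod.fst h
      simpa [iL] using this.symm

end SC

set_option linter.unusedSectionVars false
set_option linter.unusedSimpArgs false
namespace SC
open List
variable {S : IndexedStructure}

theorem noadj {β : Type} {x y : β} (hxy : x ≠ y) {L : List (List β × ℕ)} (h : ∀ P ∈ L, P.1 = [x] ∧ 1 ≤ P.2) :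
    (wd y L).IsChain (fun a b => a = x → b = y) := by
  induction L with
  | nil => simp
  | cons P L ih =>
    have ih' := ih (fun P hP => h P (by simp [hP]))
    obtain ⟨h1, h2⟩ := h P (by simp)
    obtain ⟨n, hn⟩ : ∃ n, P.2 = n + 1 := ⟨P.2 - 1, by omega⟩
    rw [wd_cons, h1, List.isChain_append, List.isChain_append]
    refine ⟨by simp, ⟨?_, ih', ?_⟩, ?_⟩
    · rw [hn]
      clear hn h2
      induction n with
      | zero => simp
      | succ n ih2 => rw [replicate_succ, replicate_succ, List.isChain_cons_cons]; exact ⟨fun _ => rfl, ih2⟩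
    · intro a ha b hb hax
      have := List.eq_of_mem_replicate (List.mem_of_mem_getLast? ha)
      exact absurd (hax.symm.trans this) hxy
    · intro a ha b hb hax
      simp [hn, replicate_succ] at hb
      exact hb.symm

theorem noadj' {β : Type} {x y : β} (hxy : x ≠ y) {L : List (List β × ℕ)} (h : ∀ P ∈ L, P.1 = [x] ∧ 1 ≤ P.2) (p q) :
    wd y L ≠ p ++ x :: x :: q := by
  intro e
  have := noadj hxy h
  rw [e] at this
  have := this.right_of_append
  simp only [List.isChain_cons_cons] at this
  exact hxy (by simpa using this.1)

theorem mem_wd {β : Type} {y z : β} {L : List (List β × ℕ)} (h : z ∈ wd y L) : z = y ∨ ∃ P ∈ L, z ∈ P.1 := by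
  simp only [wd, List.mem_flatMap, List.mem_append] at h
  obtain ⟨P, hP, h | h⟩ := h
  · exact Or.inr ⟨P, hP, h⟩
  · exact Or.inl (List.eq_of_mem_replicate h)

theorem WC.letters {m as} {c : Code S} (h : WC S m as c) : ∀ P ∈ c.L, ∀ z ∈ P.1, ∃ a, z.1 = GenSym.elt a := by
  have key : ∀ z ∈ xsW m as, ∃ a, z.1 = GenSym.elt a := by
    intro z hz; obtain ⟨a, rfl⟩ := xsW_mem hz; exact ⟨a, rfl⟩
  intro P hP z hz
  cases h with
  | rel => 
    simp [Code.L] at hP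
    rcases hP with rfl | ⟨k, hk, rfl⟩ | rfl <;> exact key z hz
  | fn =>
    simp [Code.L] at hP
    rcases hP with rfl | ⟨k, hk, rfl⟩ | rfl
    · simp at hz
      rcases hz with rfl | hz
      · simp
      · exact key z hz
    · exact key z hz
    · exact key z hz
  | fn' X h1 h2 h3 =>
    simp [Code.L] at hP
    rcases hP with rfl | ⟨k, hk, rfl⟩ | rfl
    · exact key z (by rw [h2]; simp at hz; simp [hz])
    · exact key z hz
    · exact key z hz
  | fn1 =>
    simp [Code.L] at hP
    rcases hP with rfl | ⟨k, hk, rfl⟩ | rfl <;> exact key z hz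

theorem IsCode.mid_ge {c : Code S} (h : IsCode S c) : ∀ P ∈ c.mid, 2 ≤ P.2 := by
  intro P hP
  cases h with
  | ch lo x y t =>
    simp [chC] at hP
    obtain ⟨k, hk, rfl⟩ := hP
    have : 2 ^ 2 ≤ (lo + 1 + k + 1) ^ 2 := Nat.pow_le_pow_left (by omega) 2
    simp only; omega
  | w m as c hm h =>
    have := (h.mid.2 P hP).2.1
    omega

theorem marker_y {c c' : Code S} (h : IsCode S c) (h' : IsCode S c') {p q}
    (e : wd (c'.y, true) (c'.L ++ c'.L) = p ++ (c.y, true) :: (c.y, true) :: q) : c.y = c'.y := by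
  by_contra hne
  have hmem : (c.y, true) ∈ wd (c'.y, true) (c'.L ++ c'.L) := by rw [e]; simp
  have hmem' : ∃ P ∈ c'.L, (c.y, true) ∈ P.1 := by
    rcases mem_wd hmem with h | ⟨P, hP, h⟩
    · simp at h; exact absurd h hne
    · refine ⟨P, ?_, h⟩
      rcases List.mem_append.1 hP with h | h <;> exact h
  obtain ⟨P, hP, hm⟩ := hmem'
  cases h' with
  | ch lo' x' y' t' =>
    have := (chC_mem hP).1
    rw [this] at hm
    simp at hm
    rw [hm] at e
    have hxy := t'.ne
    refine noadj' (x := (x', true)) (y := ((chC lo' x' y').y, true)) (by simpa [chC] using hxy) ?_ p q e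
    intro P hP
    have hP : P ∈ (chC lo' x' y').L := by rcases List.mem_append.1 hP with h | h <;> exact h
    exact ⟨(chC_mem hP).1, (IsCode.good (IsCode.ch lo' x' y' t') P hP).2.2⟩
  | w m' as' c' hm' w' =>
    obtain ⟨a, ha⟩ := w'.letters P hP _ hm
    have hb := w'.mid.1
    cases h with
    | ch lo x y t => exact t.yb.2 a ha
    | w m as c hm w => rw [w.mid.1, hb] at hne; exact hne rfl

theorem marker {c c' : Code S} (h : IsCode S c) (h' : IsCode S c') {X e z p q} (hX : (X, e) ∈ c.mid)
    (hz : z ≠ (c.y, true))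
    (eq : wd (c'.y, true) (c'.L ++ c'.L) = p ++ (X ++ (replicate e (c.y, true) ++ z :: q))) :
    c = c' ∧ ∃ L1 X' L2, c.L ++ c.L = L1 ++ (X', e) :: L2 ∧ p ++ X = wd (c.y, true) L1 ++ X' := by
  have he := h.mid_ge _ hX
  simp at he
  obtain ⟨e', rfl⟩ : ∃ e', e = e' + 2 := ⟨e - 2, by omega⟩
  have hy : c.y = c'.y := by
    apply marker_y h h' (p := p ++ X) (q := replicate e' (c.y, true) ++ z :: q)
    rw [eq]; simp [replicate_succ]
  have hXL : (X, e' + 2) ∈ c.L := by simp [Code.L, hX]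
  obtain ⟨g1, g2, g3⟩ := h.good _ hXL
  rcases List.eq_nil_or_concat X with rfl | ⟨X0, z0, rfl⟩
  · exact absurd rfl g1
  simp only [List.concat_eq_append] at *
  have hz0 : z0 ≠ (c'.y, true) := by
    rintro rfl; apply g2; simp [hy]
  rw [hy] at eq hz
  have hG : Good (c'.y, true) (c'.L ++ c'.L) := by
    intro P hP; rcases List.mem_append.1 hP with h | h <;> exact h'.good P h
  obtain ⟨L1, X', L2, e1, e2⟩ := parse (q := q) hz0 hz (by omega) _ hG (p ++ X0) (by rw [eq]; simp)
  have hX' : (X', e' + 2) ∈ c'.L := by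
    have : (X', e' + 2) ∈ c'.L ++ c'.L := by rw [e1]; simp
    rcases List.mem_append.1 this with h | h <;> exact h
  have hcc : c = c' := by
    cases h with
    | ch lo x y t =>
      cases h' with
      | ch lo' x' y' t' =>
        have hy' : y = y' := hy
        subst hy'
        have a1 := (chC_mem hXL).1
        have a2 := (chC_mem hX').1
        simp only at a1 a2
        rw [a2] at e2
        have a3 := List.append_inj' e2 rfl
        rw [show X0 = [] from by cases X0 <;> simp at a1 ⊢] at a1
        simp at a1 a3
        have : x = x' := by
          have := a3.2; rw [a1] at this; simpa using this
        subst this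
        have := t.uniq t'
        subst this; rfl
      | w m' as' c' hm' w' => exact absurd (hy.trans w'.mid.1) t.yb.1
    | w m as c hm w =>
      cases h' with
      | ch lo' x' y' t' => exact absurd (hy.symm.trans w.mid.1) t'.yb.1
      | w m' as' c' hm' w' =>
        obtain ⟨b1, b2, b3⟩ := w.mid.2 _ hX
        simp only at b1 b2 b3
        obtain ⟨rfl, c2⟩ := w'.mem _ hX' (e' + 2 - 100 * m) (by omega) (by omega) m (by simp; omega)
        simp only at c2
        have hl : (X0 ++ [z0]).length = X'.length := by rw [b1, c2, xsW_length, xsW_length]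
        have := (List.append_inj' ((List.append_assoc p X0 [z0]).symm.trans e2) hl).2
        rw [b1, c2] at this
        have := xsW_inj this
        subst this
        exact w.unique w'
  subst hcc
  refine ⟨rfl, L1, X', L2, e1, ?_⟩
  rw [← e2]; simp

theorem IsCode.win {c : Code S} (h : IsCode S c) {u v s t} (e1 : c.word = u ++ v) (hu : u.length < c.word.length)
    (e2 : v ++ u = s ++ t) (hs : c.word.length < 15 * s.length) :
    ∃ X e z s1 s2, (X, e) ∈ c.mid ∧ z ≠ (c.y, true) ∧ s = s1 ++ (X ++ (replicate e (c.y, true) ++ z :: s2)) := by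
  obtain ⟨M, hM, hb⟩ := h.bound
  refine window h.midne hM h.good (u := u) (s := s) (t := t ++ v) hu ?_ (by omega)
  rw [wd_append]
  change c.word ++ c.word = _
  rw [e1]
  calc u ++ v ++ (u ++ v) = u ++ (v ++ u) ++ v := by simp
    _ = _ := by rw [e2]; simp

theorem strong {c c' : Code S} (h : IsCode S c) (h' : IsCode S c') {u v u' v' s t t'} (e1 : c.word = u ++ v)
    (e1' : c'.word = u' ++ v') (hu : u.length < c.word.length) (hu' : u'.length < c'.word.length)
    (e2 : v ++ u = s ++ t) (e2' : v' ++ u' = s ++ t') (hs : c.word.length < 15 * s.length) : c = c' ∧ u = u' := by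
  obtain ⟨X, e, z, s1, s2, hX, hz, hs'⟩ := h.win e1 hu e2 hs
  have key : ∀ (c : Code S) u v t, c.word = u ++ v → v ++ u = s ++ t →
      wd (c.y, true) (c.L ++ c.L) = u ++ (s ++ (t ++ v)) := by
    intro c u v t e1 e2
    rw [wd_append]
    change c.word ++ c.word = _
    rw [e1]
    calc u ++ v ++ (u ++ v) = u ++ (v ++ u) ++ v := by simp
      _ = _ := by rw [e2]; simp
  have k1 := key c u v t e1 e2
  have k2 := key c' u' v' t' e1' e2'
  rw [hs'] at k1 k2
  obtain ⟨-, L1, X1, L2, a1, a2⟩ := marker h h hX hz (p := u ++ s1) (q := s2 ++ (t ++ v)) (by rw [k1]; simp)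
  obtain ⟨rfl, L1', X1', L2', a1', a2'⟩ := marker h h' hX hz (p := u' ++ s1) (q := s2 ++ (t' ++ v')) (by rw [k2]; simp)
  refine ⟨rfl, ?_⟩
  have ul : u.length = u'.length := by
    obtain ⟨rfl, hL⟩ := idx_unique h.nd a1 a1'
    have l1 := congrArg List.length a2
    have l2 := congrArg List.length a2'
    simp only [List.length_append] at l1 l2
    have hw : (wd (c.y, true) c.L).length = c.word.length := rfl
    rcases hL with rfl | rfl | rfl
    · omega
    · rw [wd_append, List.length_append, hw] at l1; omega
    · rw [wd_append, List.length_append, hw] at l2; omega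
  exact (List.append_inj (e1.symm.trans e1') ul).1

/-- normalised rotation -/
theorem rot_split {β : Type} {r q : List β} (hq : q ≠ []) (h : r ~r q) : ∃ u v, q = u ++ v ∧ r = v ++ u ∧ u.length < q.length := by
  obtain ⟨n, hn⟩ := h.symm
  rw [List.rotate_eq_drop_append_take_mod] at hn
  refine ⟨q.take (n % q.length), q.drop (n % q.length), by simp, hn.symm, ?_⟩
  have := Nat.mod_lt n (List.length_pos_iff.2 hq)
  simp; omega

end SC

set_option linter.unusedSectionVars false
set_option linter.unusedSimpArgs false
namespace SC
open List
variable {S : IndexedStructure} {p₁ p₂ : ℕ}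

/-- proper-power base words -/
inductive IsPow (S : IndexedStructure) (p₁ p₂ : ℕ) : GenSym S.A → ℕ → Prop
  | p1 : IsPow S p₁ p₂ GenSym.f1 p₁
  | p2 : IsPow S p₁ p₂ GenSym.f2 p₂

inductive IsBase (S : IndexedStructure) (p₁ p₂ : ℕ) : List (Ltr S) → Prop
  | pow (g n) : IsPow S p₁ p₂ g n → IsBase S p₁ p₂ (replicate n (g, true))
  | code (c) : IsCode S c → IsBase S p₁ p₂ c.word

def Rp (S : IndexedStructure) (p₁ p₂ : ℕ) : Set (List (Ltr S)) :=
  {r | ∃ q, IsBase S p₁ p₂ q ∧ (r ~r q ∨ iW r ~r q)}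

theorem iW_rot {β : Type} {r q : List (β × Bool)} (h : r ~r q) : iW r ~r iW q := by
  by_cases hq : q = []
  · subst hq; rw [List.isRotated_nil_iff] at h; subst h; exact List.IsRotated.refl _
  obtain ⟨u, v, rfl, rfl, -⟩ := rot_split hq h
  simp only [iW_append]
  exact List.isRotated_append

theorem Rp_inv {r} (h : r ∈ Rp S p₁ p₂) : iW r ∈ Rp S p₁ p₂ := by
  obtain ⟨q, hq, h | h⟩ := h
  · exact ⟨q, hq, Or.inr (by rwa [iW_iW])⟩
  · exact ⟨q, hq, Or.inl h⟩

theorem Rp_rot {u v} (h : u ++ v ∈ Rp S p₁ p₂) : v ++ u ∈ Rp S p₁ p₂ := by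
  obtain ⟨q, hq, h | h⟩ := h
  · exact ⟨q, hq, Or.inl (List.isRotated_append.trans h)⟩
  · exact ⟨q, hq, Or.inr ((iW_rot List.isRotated_append).trans h)⟩

theorem code_ne {c : Code S} (h : IsCode S c) : c.word ≠ [] := by
  intro h'; have := h.len; rw [h'] at this; simp at this

theorem run_code {c : Code S} (h : IsCode S c) {n g t} (e : replicate n g ++ t ~r c.word) : 15 * n ≤ c.word.length := by
  obtain ⟨u, v, e1, e2, hu⟩ := rot_split (code_ne h) e
  by_contra hlt
  obtain ⟨X, e', z, s1, s2, hX, hz, hs⟩ := h.win e1 hu e2.symm (by simpa using hlt)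
  have hXL : (X, e') ∈ c.L := by simp [Code.L, hX]
  obtain ⟨g1, g2, g3⟩ := h.good _ hXL
  have hall : ∀ w ∈ s1 ++ (X ++ (replicate e' (c.y, true) ++ z :: s2)), w = g := by
    intro w hw; rw [← hs] at hw; exact List.eq_of_mem_replicate hw
  obtain ⟨x, X', hx⟩ := List.exists_cons_of_ne_nil g1
  simp only at hx g2
  have h1 := hall x (by simp [hx])
  have h2 := hall z (by simp)
  have h3 := hall (c.y, true) (by simp; right; right; left; intro h0; simp [h0] at g3)
  exact hz (h2.trans h3.symm)

theorem Tri.lo_le {lo x y} (h : Tri S lo x y) : lo ≤ 4000 := by cases h <;> omega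

theorem run_ch {lo x y} (h : Tri S lo x y) {n g t} (e : replicate n g ++ t ~r (chC (S := S) lo x y).word) :
    n ≤ (lo + 1) ^ 2 + 3 * (lo + 1000) ^ 2 + 5 := by
  have hC : IsCode S (chC lo x y) := .ch _ _ _ h
  obtain ⟨u, v, e1, e2, hu⟩ := rot_split (code_ne hC) e
  by_contra hlt
  have hlo := h.lo_le
  have hb : (lo + 1000) ^ 2 ≤ 5000 ^ 2 := Nat.pow_le_pow_left (by omega) 2
  have hb' : (lo + 1) ^ 2 ≤ (lo + 1000) ^ 2 := Nat.pow_le_pow_left (by omega) 2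
  obtain ⟨X, e', z, s1, s2, hX, hz, hs⟩ := window (y := ((chC (S := S) lo x y).y, true)) hC.midne (M := 1 + (lo + 1000) ^ 2) (by
      intro P hP
      have hP' : P ∈ (chC lo x y).L := by simp [Code.L, hP]
      obtain ⟨h1, k, hk, h2⟩ := chC_mem hP'
      rw [h1, h2]
      have : (lo + 1 + k) ^ 2 ≤ (lo + 1000) ^ 2 := Nat.pow_le_pow_left (by omega) 2
      simp; omega) hC.good (u := u) (s := replicate n g) (t := t ++ v) hu (by
    rw [wd_append]
    change (chC lo x y).word ++ (chC lo x y).word = _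
    rw [e1]
    calc u ++ v ++ (u ++ v) = u ++ (v ++ u) ++ v := by simp
      _ = _ := by rw [← e2]; simp) (by simp only [chC, List.length_singleton, List.length_replicate]; omega)
  have hXL : (X, e') ∈ (chC lo x y).L := by simp [Code.L, hX]
  obtain ⟨g1, g2, g3⟩ := hC.good _ hXL
  have hall : ∀ w ∈ s1 ++ (X ++ (replicate e' ((chC (S := S) lo x y).y, true) ++ z :: s2)), w = g := by
    intro w hw; rw [← hs] at hw; exact List.eq_of_mem_replicate hw
  have h2 := hall z (by simp)
  have h3 := hall ((chC (S := S) lo x y).y, true) (by simp; right; right; left; intro h0; simp [h0] at g3)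
  exact hz (h2.trans h3.symm)

theorem IsPow.f {g n} (h : IsPow S p₁ p₂ g n) : g ≠ GenSym.b ∧ ∀ a, g ≠ GenSym.elt a := by cases h <;> simp

theorem run_f {c : Code S} (h : IsCode S c) {g m} (hg : IsPow S p₁ p₂ g m) {n t} (e : replicate n (g, true) ++ t ~r c.word) :
    n ≤ 4 * (2 + 5000 ^ 2) := by
  cases h with
  | ch lo x y h =>
    have hlo := h.lo_le
    have hb : (lo + 1000) ^ 2 ≤ 5000 ^ 2 := Nat.pow_le_pow_left (by omega) 2
    have hb' : (lo + 1) ^ 2 ≤ (lo + 1000) ^ 2 := Nat.pow_le_pow_left (by omega) 2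
    have := run_ch h e
    omega
  | w m as c hm w =>
    cases n with
    | zero => simp
    | succ n =>
      exfalso
      have : (g, true) ∈ c.word := e.mem_iff.1 (by simp [replicate_succ])
      rcases mem_wd this with h | ⟨P, hP, h⟩
      · simp at h; rw [w.mid.1] at h; exact hg.f.1 h
      · obtain ⟨a, ha⟩ := w.letters P hP _ h
        exact hg.f.2 a ha

theorem rot_replicate {β : Type} {n} {g : β} {r} (h : r ~r replicate n g) : r = replicate n g := by
  rw [List.eq_replicate_iff]
  refine ⟨by simpa using h.perm.length_eq, fun b hb => List.eq_of_mem_replicate (h.mem_iff.1 hb)⟩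

theorem base_piece (hb₁ : 10 ^ 10 < p₁) (hb₂ : 10 ^ 10 < p₂) {q₁ q₂ s t₁ t₂} (h₁ : IsBase S p₁ p₂ q₁) (h₂ : IsBase S p₁ p₂ q₂)
    (e₁ : s ++ t₁ ~r q₁) (e₂ : s ++ t₂ ~r q₂) (hne : t₁ ≠ t₂) : 15 * s.length ≤ q₁.length := by
  by_cases hs : s = []
  · subst hs; simp
  obtain ⟨z, s', hz⟩ := List.exists_cons_of_ne_nil hs
  cases h₁ with
  | pow g n hg =>
    have a1 := rot_replicate e₁
    have hn : 10 ^ 10 < n := by cases hg <;> assumption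
    obtain ⟨k, hk⟩ : ∃ k, s = replicate k (g, true) := ⟨s.length, by
      rw [List.eq_replicate_iff]
      refine ⟨rfl, fun b hb => ?_⟩
      have : b ∈ s ++ t₁ := by simp [hb]
      rw [a1] at this
      exact List.eq_of_mem_replicate this⟩
    cases h₂ with
    | pow g' n' hg' =>
      exfalso
      have a2 := rot_replicate e₂
      have z1 : z = (g, true) := List.eq_of_mem_replicate (by rw [← a1, hz]; simp)
      have z2 : z = (g', true) := List.eq_of_mem_replicate (by rw [← a2, hz]; simp)
      have : g = g' := by rw [z1] at z2; simpa using z2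
      subst this
      have : n = n' := by cases hg <;> cases hg' <;> rfl
      subst this
      exact hne (List.append_cancel_left (a1.trans a2.symm))
    | code c hc =>
      rw [hk] at e₂ ⊢
      have := run_f hc hg e₂
      simp
      omega
  | code c hc =>
    cases h₂ with
    | pow g n hg =>
      have a1 := rot_replicate e₂
      obtain ⟨k, hk⟩ : ∃ k, s = replicate k (g, true) := ⟨s.length, by
        rw [List.eq_replicate_iff]
        refine ⟨rfl, fun b hb => ?_⟩
        have : b ∈ s ++ t₂ := by simp [hb]
        rw [a1] at this
        exact List.eq_of_mem_replicate this⟩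
      rw [hk] at e₁ ⊢
      simpa using run_code hc e₁
    | code c' hc' =>
      by_contra hlt
      obtain ⟨u, v, b1, b2, hu⟩ := rot_split (code_ne hc) e₁
      obtain ⟨u', v', b1', b2', hu'⟩ := rot_split (code_ne hc') e₂
      obtain ⟨rfl, rfl⟩ := strong hc hc' b1 b1' hu hu' b2.symm b2'.symm (by omega)
      have : v = v' := List.append_cancel_left (b1.symm.trans b1')
      subst this
      exact hne (List.append_cancel_left (b2.trans b2'.symm))

theorem base_negs {q} (h : IsBase S p₁ p₂ q) : negs q ≤ 1 := by
  cases h with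
  | pow g n hg => rw [negs_zero]; omega; intro z hz; rw [List.eq_of_mem_replicate hz]
  | code c hc => exact hc.neg

theorem base_len (hb₁ : 10 ^ 10 < p₁) (hb₂ : 10 ^ 10 < p₂) {q} (h : IsBase S p₁ p₂ q) : 15000 ≤ q.length := by
  cases h with
  | pow g n hg =>
    simp; cases hg <;> omega
  | code c hc => exact hc.len

theorem negs_rot {r q : List (Ltr S)} (h : r ~r q) : negs r = negs q := h.perm.countP_eq _

theorem negs_append (u v : List (Ltr S)) : negs (u ++ v) = negs u + negs v := by simp [negs]

theorem negs_iW (u : List (Ltr S)) : negs u + negs (iW u) = u.length := by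
  induction u with
  | nil => simp [negs]
  | cons a u ih =>
    have : negs (a :: u) = negs [a] + negs u := negs_append [a] u
    rw [this, iW_cons, negs_append]
    have : negs [a] + negs [iL a] = 1 := by
      obtain ⟨x, b⟩ := a
      cases b <;> simp [negs, iL]
    simp; omega

/-- F1 -/
theorem base_mixed {q₁ q₂ s t₁ t₂} (h₁ : IsBase S p₁ p₂ q₁) (h₂ : IsBase S p₁ p₂ q₂)
    (e₁ : s ++ t₁ ~r q₁) (e₂ : iW s ++ t₂ ~r q₂) : s.length ≤ 2 := by
  have a1 := base_negs h₁
  have a2 := base_negs h₂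
  rw [← negs_rot e₁, negs_append] at a1
  rw [← negs_rot e₂, negs_append] at a2
  have := negs_iW s
  omega

theorem Rp_cases {s t} (h : s ++ t ∈ Rp S p₁ p₂) : ∃ q, IsBase S p₁ p₂ q ∧ (s ++ t).length = q.length ∧
    (s ++ t ~r q ∨ iW s ++ iW t ~r q) := by
  obtain ⟨q, hq, h | h⟩ := h
  · exact ⟨q, hq, h.perm.length_eq, Or.inl h⟩
  · refine ⟨q, hq, ?_, Or.inr ?_⟩
    · have := h.perm.length_eq; rw [← this]; simp; omega
    · rw [iW_append] at h; exact List.isRotated_append.trans h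

theorem Rp_piece (hb₁ : 10 ^ 10 < p₁) (hb₂ : 10 ^ 10 < p₂) {s t₁ t₂} (h₁ : s ++ t₁ ∈ Rp S p₁ p₂) (h₂ : s ++ t₂ ∈ Rp S p₁ p₂)
    (hne : t₁ ≠ t₂) : 15 * s.length ≤ (s ++ t₁).length := by
  obtain ⟨q₁, b1, l1, c1⟩ := Rp_cases h₁
  obtain ⟨q₂, b2, l2, c2⟩ := Rp_cases h₂
  have hl := base_len hb₁ hb₂ b1
  rw [l1]
  rcases c1 with c1 | c1 <;> rcases c2 with c2 | c2
  · exact base_piece hb₁ hb₂ b1 b2 c1 c2 hne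
  · have := base_mixed b1 b2 c1 c2; omega
  · have := base_mixed b2 b1 c2 c1; omega
  · have := base_piece hb₁ hb₂ b1 b2 c1 c2 (fun h => hne (by rw [← iW_iW t₁, h, iW_iW]))
    simpa using this

theorem base_red {q x y t} (h : IsBase S p₁ p₂ q) (e : x :: y :: t ~r q) : y ≠ iL x := by
  cases h with
  | pow g n hg =>
    have := rot_replicate e
    have h1 : x = (g, true) := List.eq_of_mem_replicate (by rw [← this]; simp)
    have h2 : y = (g, true) := List.eq_of_mem_replicate (by rw [← this]; simp)
    rw [h1, h2]; simp [iL]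
  | code c hc =>
    obtain ⟨u, v, e1, e2, -⟩ := rot_split (code_ne hc) e
    have hch := wd_chain c.y (L := c.L ++ c.L) (by
      intro P hP; rcases List.mem_append.1 hP with h | h <;> exact hc.chain P h) (by
      intro P hP; rcases List.mem_append.1 hP with h | h <;> exact hc.gens P h) (by
      intro P hP; rcases List.mem_append.1 hP with h | h <;> exact hc.good P h)
    rw [wd_append] at hch
    change (c.word ++ c.word).IsChain _ at hch
    rw [e1, show u ++ v ++ (u ++ v) = u ++ ((v ++ u) ++ v) by simp, ← e2] at hch
    have := hch.right_of_append
    simp only [List.cons_append, List.isChain_cons_cons] at this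
    exact this.1

theorem Rp_sys {G : Type} [Group G] {f : FreeGroup (GenSym S.A) →* G} (hb₁ : 10 ^ 10 < p₁) (hb₂ : 10 ^ 10 < p₂)
    (hone : ∀ q, IsBase S p₁ p₂ q → ev f q = 1) : Sys (Rp S p₁ p₂) 15 f where
  hN := by omega
  len r hr := by
    obtain ⟨q, b, l, -⟩ := Rp_cases (s := r) (t := []) (by simpa using hr)
    have := base_len hb₁ hb₂ b
    simp at l; omega
  red x y t h := by
    obtain ⟨q, b, h | h⟩ := h
    · exact base_red b h
    · have h2 : iL y :: iL x :: iW t ~r q := by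
        have : iW (x :: y :: t) = iW t ++ [iL y, iL x] := by simp
        rw [this] at h
        exact (List.isRotated_append (l := [iL y, iL x]) (l' := iW t)).trans h
      have := base_red b h2
      rintro rfl
      simp at this
  rot u v h := Rp_rot h
  inv r h := Rp_inv h
  noninv u v h e := by
    obtain ⟨q, b, l, -⟩ := Rp_cases h
    have hl := base_len hb₁ hb₂ b
    have h1 : negs (v ++ u) = negs (u ++ v) := negs_rot List.isRotated_append
    have h2 := negs_iW (u ++ v)
    rw [← e, h1] at h2
    have h3 := base_negs b
    obtain ⟨q, b, h | h⟩ := h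
    · have h4 := base_negs b
      rw [← negs_rot h] at h4; omega
    · have h4 := base_negs b
      rw [← negs_rot h, ← e, h1] at h4; omega
  piece s t₁ t₂ h₁ h₂ hne := Rp_piece hb₁ hb₂ h₁ h₂ hne
  one r h := by
    have key : ∀ r q : List (Ltr S), IsBase S p₁ p₂ q → r ~r q → ev f r = 1 := by
      intro r q hq hr
      have hqn : q ≠ [] := by rintro rfl; have := base_len hb₁ hb₂ hq; simp at this
      obtain ⟨u, v, rfl, rfl, -⟩ := rot_split hqn hr
      have := hone _ hq
      rw [ev_append] at this ⊢
      rw [← mul_left_cancel_iff (a := ev f u), ← mul_assoc, this]; simp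
    obtain ⟨q, b, h | h⟩ := h
    · exact key _ _ b h
    · have := key _ _ b h
      simpa using this
end SC

set_option linter.unusedSectionVars false
set_option linter.unusedSimpArgs false
namespace SC
open List
variable {S : IndexedStructure} {p₁ p₂ : ℕ}

theorem mk_replicate {β : Type} (n : ℕ) (z : β × Bool) : FreeGroup.mk (replicate n z) = FreeGroup.mk [z] ^ n := by
  induction n with
  | zero => rfl
  | succ n ih => rw [pow_succ', ← ih, FreeGroup.mul_mk]; rfl

theorem mk_wd {β : Type} (y : β × Bool) (L : List (List (β × Bool) × ℕ)) :
    FreeGroup.mk (wd y L) = (L.map fun p => FreeGroup.mk p.1 * FreeGroup.mk [y] ^ p.2).prod := by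
  induction L with
  | nil => rfl
  | cons p L ih =>
    rw [wd_cons, List.map_cons, List.prod_cons, ← ih, ← mk_replicate, FreeGroup.mul_mk, FreeGroup.mul_mk, List.append_assoc]

theorem mk_ch (lo) (x y : GenSym S.A) : FreeGroup.mk (chC lo x y).word = chainProd lo (FreeGroup.of x) (FreeGroup.of y) := by
  rw [Code.word, chC_L, mk_wd]
  unfold chainProd
  rw [List.map_map]
  refine congrArg List.prod (List.map_congr_left ?_)
  intro k _
  simp only [Function.comp]
  rw [show lo + 1 + k = lo + k + 1 by ring]
  rfl

theorem mk_ofFn {β : Type} {n} (g : Fin n → β) : FreeGroup.mk (List.ofFn fun i => (g i, true)) = (List.ofFn fun i => FreeGroup.of (g i)).prod := by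
  induction n with
  | zero => rfl
  | succ n ih =>
    rw [List.ofFn_succ, List.ofFn_succ, List.prod_cons, ← ih]
    rfl

theorem split100 {M : Type} [Monoid M] (F : ℕ → M) : ((List.range 100).map F).prod =
    F 0 * (((List.range 98).map fun k => F (k + 1)).prod * F 99) := by
  rw [show 100 = 98 + 1 + 1 from rfl, List.range_succ, List.range_succ_eq_map]
  simp only [List.map_append, List.map_cons, List.prod_append, List.prod_cons, List.map_map, List.map_nil, List.prod_nil, mul_one, mul_assoc]
  rfl

theorem split98 {M : Type} [Monoid M] (F : ℕ → M) : ((List.range 98).map F).prod =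
    F 0 * (((List.range 97).map fun k => F (k + 1)).prod) := by
  rw [show 98 = 97 + 1 from rfl, List.range_succ_eq_map]
  simp only [List.map_append, List.map_cons, List.prod_append, List.prod_cons, List.map_map, List.map_nil, List.prod_nil, mul_one, mul_assoc]
  rfl

theorem wProd_eq (m) (as : Fin (S.arity m) → S.A) :
    wProd m (fun i => FreeGroup.of (GenSym.elt (as i))) (FreeGroup.of (GenSym.b : GenSym S.A)) =
     FreeGroup.mk (xsW m as) * FreeGroup.mk [(GenSym.b, true)] ^ (100 * m + 1) *
      ((((List.range 98).map fun k => FreeGroup.mk (xsW m as) * FreeGroup.mk [(GenSym.b, true)] ^ (100 * m + 2 + k)).prod) *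
      (FreeGroup.mk (xsW m as) * FreeGroup.mk [(GenSym.b, true)] ^ (100 * m + 100))) := by
  unfold wProd
  rw [split100, xsW, mk_ofFn]
  have e : ∀ (X b : FreeGroup (GenSym S.A)), ((List.range 98).map fun k => X * b ^ (100 * m + (k + 1) + 1)) =
    (List.range 98).map fun k => X * b ^ (100 * m + 2 + k) := by
    intro X b
    apply List.map_congr_left
    intro k _
    rw [show 100 * m + (k + 1) + 1 = 100 * m + 2 + k by ring]
  rw [e, Nat.add_zero, show 100 * m + 99 + 1 = 100 * m + 100 by ring]
  simp only [FreeGroup.of]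

theorem WC.relmk {m as} {c : Code S} (h : WC S m as c) (hf : ¬ S.isFunc m) :
    S.relInterp m as ∧ FreeGroup.mk c.word = wProd m (fun i => FreeGroup.of (GenSym.elt (as i))) (FreeGroup.of GenSym.b) := by
  cases h with
  | rel h1 h2 =>
    refine ⟨h2, ?_⟩
    rw [wProd_eq, Code.word, mk_wd]
    simp only [Code.L, List.map_append, List.map_cons, List.prod_append, List.prod_cons, List.map_map, List.map_nil, List.prod_nil, mul_one, mul_assoc, List.cons_append]
    rfl
  | fn => contradiction
  | fn' => contradiction
  | fn1 => contradiction

theorem WC.fnmk {m as} {c : Code S} (h : WC S m as c) (hf : S.isFunc m) :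
    IsConj (wProd m (fun i => FreeGroup.of (GenSym.elt (as i))) (FreeGroup.of GenSym.b) *
        (FreeGroup.of (GenSym.elt (S.funcInterp m as)))⁻¹) (FreeGroup.mk c.word) := by
  rw [wProd_eq, Code.word, mk_wd]
  cases h with
  | rel h1 h2 => contradiction
  | fn x X h1 h2 h3 =>
    rw [isConj_iff]
    refine ⟨(FreeGroup.of (GenSym.elt (S.funcInterp m as)))⁻¹, ?_⟩
    simp only [Code.L, List.map_append, List.map_cons, List.prod_append, List.prod_cons, List.map_map, List.map_nil, List.prod_nil, mul_one, mul_assoc, List.cons_append]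
    rw [show FreeGroup.mk ((GenSym.elt (S.funcInterp m as), false) :: xsW m as) =
      (FreeGroup.of (GenSym.elt (S.funcInterp m as)))⁻¹ * FreeGroup.mk (xsW m as) from rfl]
    simp [mul_assoc, Function.comp_def]
  | fn' X h1 h2 h3 =>
    rw [isConj_iff]
    refine ⟨(FreeGroup.of (GenSym.elt (S.funcInterp m as)))⁻¹, ?_⟩
    simp only [Code.L, List.map_append, List.map_cons, List.prod_append, List.prod_cons, List.map_map, List.map_nil, List.prod_nil, mul_one, mul_assoc, List.cons_append]
    have e : FreeGroup.mk X = (FreeGroup.of (GenSym.elt (S.funcInterp m as)))⁻¹ * FreeGroup.mk (xsW m as) := by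
      rw [h2, eq_inv_mul_iff_mul_eq]; rfl
    rw [e]
    simp [mul_assoc, Function.comp_def]
  | fn1 h1 h2 =>
    rw [isConj_iff]
    have e : FreeGroup.mk (xsW m as) = (FreeGroup.of (GenSym.elt (S.funcInterp m as))) := by rw [h2]; rfl
    refine ⟨(FreeGroup.mk [(GenSym.b, true)] ^ (100 * m + 1))⁻¹ * (FreeGroup.of (GenSym.elt (S.funcInterp m as)))⁻¹, ?_⟩
    simp only [Code.L, List.map_append, List.map_cons, List.prod_append, List.prod_cons, List.map_map, List.map_nil, List.prod_nil, mul_one, mul_assoc, List.cons_append]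
    rw [split98, e, show 200 * m + 101 = (100 * m + 100) + (100 * m + 1) by ring, pow_add _ (100 * m + 100)]
    simp only [mul_inv_rev, inv_inv, mul_assoc, inv_mul_cancel_left, Function.comp_def, e, mul_inv_cancel_left]
    have e : ∀ (X b : FreeGroup (GenSym S.A)), ((List.range 97).map fun k => X * b ^ (100 * m + 2 + (k + 1))) =
      (List.range 97).map fun k => X * b ^ (100 * m + 3 + k) := by
      intro X b
      apply List.map_congr_left
      intro k _
      rw [show 100 * m + 2 + (k + 1) = 100 * m + 3 + k by ring]
    rw [e, Nat.add_zero]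

theorem WC.ex_fn {m} (hm : 1 ≤ m) (as : Fin (S.arity m) → S.A) (hf : S.isFunc m) : ∃ c, WC S m as c := by
  obtain ⟨x, X, hx⟩ := List.exists_cons_of_ne_nil (xsW_ne hm as)
  by_cases h : x = (GenSym.elt (S.funcInterp m as), true)
  · subst h
    by_cases h' : X = []
    · subst h'; exact ⟨_, .fn1 hf hx⟩
    · exact ⟨_, .fn' X hf hx h'⟩
  · exact ⟨_, .fn x X hf hx h⟩

theorem base_rel {q} (h : IsBase S p₁ p₂ q) : ∃ r ∈ grpRels S p₁ p₂, IsConj r (FreeGroup.mk q) := by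
  cases h with
  | pow g n hg =>
    refine ⟨_, ?_, IsConj.refl _⟩
    rw [mk_replicate]
    cases hg <;> simp [grpRels, FreeGroup.of]
  | code c hc =>
    cases hc with
    | ch lo x y h =>
      refine ⟨_, ?_, IsConj.refl _⟩
      rw [mk_ch]
      cases h
      case ac a => left; left; right; exact ⟨a, Or.inl rfl⟩
      case ad a => left; left; right; exact ⟨a, Or.inr rfl⟩
      all_goals left; left; left; simp
    | w m as c hm w =>
      by_cases hf : S.isFunc m
      · exact ⟨_, Or.inl (Or.inr ⟨m, hm, hf, as, rfl⟩), w.fnmk hf⟩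
      · obtain ⟨h1, h2⟩ := w.relmk hf
        exact ⟨_, Or.inr ⟨m, hm, hf, as, h1, h2⟩, IsConj.refl _⟩

theorem isConj_of_eq {G : Type} [Group G] {a b : G} (h : a = b) : IsConj a b := by rw [h]

theorem rel_base {r} (h : r ∈ grpRels S p₁ p₂) : ∃ q, IsBase S p₁ p₂ q ∧ IsConj r (FreeGroup.mk q) := by
  have hch : ∀ {lo x y}, Tri S lo x y → ∃ q, IsBase S p₁ p₂ q ∧ IsConj (chainProd lo (FreeGroup.of x) (FreeGroup.of y)) (FreeGroup.mk q) :=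
    fun {lo x y} h => ⟨(chC lo x y).word, .code _ (.ch _ _ _ h), isConj_of_eq (mk_ch lo x y).symm⟩
  rcases h with ((h | ⟨a, h⟩) | ⟨m, hm, hf, as, h⟩) | ⟨m, hm, hf, as, h1, h⟩
  · simp only [Set.mem_insert_iff, Set.mem_singleton_iff] at h
    rcases h with h | h | h | h | h | h | h | h | h | h <;> rw [h]
    · exact ⟨_, .pow _ _ .p1, by rw [mk_replicate]; exact IsConj.refl _⟩
    · exact ⟨_, .pow _ _ .p2, by rw [mk_replicate]; exact IsConj.refl _⟩
    · exact hch .f12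
    · exact hch .f21
    · exact hch .b1
    · exact hch .b2
    · exact hch .c1
    · exact hch .c2
    · exact hch .d1
    · exact hch .d2
  · rcases h with h | h <;> rw [h]
    · exact hch (.ac a)
    · exact hch (.ad a)
  · subst h
    obtain ⟨c, hc⟩ := WC.ex_fn hm as hf
    exact ⟨_, .code c (.w m as c hm hc), hc.fnmk hf⟩
  · subst h
    have hc := WC.rel hf h1
    exact ⟨_, .code _ (.w m as _ hm hc), isConj_of_eq (hc.relmk hf).2.symm⟩

/-- the quotient map -/
abbrev qf (S : IndexedStructure) (p₁ p₂ : ℕ) : FreeGroup (GenSym S.A) →* GA S p₁ p₂ := PresentedGroup.mk (grpRels S p₁ p₂)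

theorem qf_one {q} (h : IsBase S p₁ p₂ q) : ev (qf S p₁ p₂) q = 1 := by
  obtain ⟨r, hr, hc⟩ := base_rel h
  obtain ⟨g, hg⟩ := isConj_iff.1 hc
  unfold ev
  rw [← hg]
  have : qf S p₁ p₂ r = 1 := PresentedGroup.one_of_mem hr
  simp [this]

theorem qf_ker (g : FreeGroup (GenSym S.A)) (h : qf S p₁ p₂ g = 1) :
    g ∈ Subgroup.normalClosure (FreeGroup.mk '' Rp S p₁ p₂) := by
  have h1 : g ∈ Subgroup.normalClosure (grpRels S p₁ p₂) := PresentedGroup.mk_eq_one_iff.1 h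
  refine Subgroup.normalClosure_le_normal ?_ h1
  intro r hr
  obtain ⟨q, hq, hc⟩ := rel_base hr
  obtain ⟨k, hk⟩ := isConj_iff.1 hc.symm
  have : FreeGroup.mk q ∈ Subgroup.normalClosure (FreeGroup.mk '' Rp S p₁ p₂) :=
    Subgroup.subset_normalClosure ⟨q, ⟨q, hq, Or.inl (List.IsRotated.refl _)⟩, rfl⟩
  have h3 := Subgroup.normalClosure_normal.conj_mem _ this k
  rwa [hk] at h3

instance : Inhabited (GenSym S.A) := ⟨GenSym.b⟩

theorem green (hb₁ : 10 ^ 10 < p₁) (hb₂ : 10 ^ 10 < p₂) {w : List (Ltr S)} (hw : FreeGroup.IsReduced w) (hne : w ≠ [])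
    (h1 : ev (qf S p₁ p₂) w = 1) : ∃ s t, s <:+: w ∧ s ++ t ∈ Rp S p₁ p₂ ∧ 15 * t.length ≤ 3 * (s ++ t).length :=
  greendlinger (Rp_sys hb₁ hb₂ fun _ h => qf_one h) qf_ker _ w rfl hw hne h1
end SC

set_option linter.unusedSectionVars false
set_option linter.unusedSimpArgs false
namespace SC
open List
variable {S : IndexedStructure} {p₁ p₂ : ℕ}

theorem ch_letters {lo} {x y : GenSym S.A} {z} (h : z ∈ (chC lo x y).word) : z = (x, true) ∨ z = (y, true) := by
  rcases mem_wd h with h | ⟨P, hP, h⟩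
  · exact Or.inr h
  · rw [(chC_mem hP).1] at h; exact Or.inl (by simpa using h)

theorem all_rep {β : Type} {u : List β} {z} (h : ∀ w ∈ u, w = z) : u = replicate u.length z :=
  List.eq_replicate_iff.2 ⟨rfl, h⟩

/-- no two adjacent x in the cyclic word -/
theorem ch_noadj {lo} {x y : GenSym S.A} (h : Tri S lo x y) {p q} (e : p ++ (x, true) :: (x, true) :: q ~r (chC lo x y).word) : False := by
  obtain ⟨u, v, e1, e2, -⟩ := rot_split (code_ne (.ch _ _ _ h)) e
  refine noadj' (x := (x, true)) (y := (y, true)) (by simpa using h.ne) (L := (chC lo x y).L ++ (chC lo x y).L) ?_ (u ++ p) (q ++ v) ?_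
  · intro P hP
    have hP' : P ∈ (chC lo x y).L := by rcases List.mem_append.1 hP with h | h <;> exact h
    obtain ⟨h1, k, -, h2⟩ := chC_mem hP'
    exact ⟨h1, by rw [h2]; exact Nat.pow_pos (by omega)⟩
  · rw [wd_append]
    change (chC lo x y).word ++ (chC lo x y).word = _
    rw [e1]
    calc u ++ v ++ (u ++ v) = u ++ (v ++ u) ++ v := by simp
      _ = _ := by rw [← e2]; simp

def CD (y : GenSym S.A) : Prop := y = GenSym.c ∨ y = GenSym.d

theorem base_run {y : GenSym S.A} (hy : CD y) {q u t} (hb₁ : 10 ^ 10 < p₁) (hb₂ : 10 ^ 10 < p₂) (hq : IsBase S p₁ p₂ q)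
    (hu : ∀ z ∈ u, z.1 = y) (e : u ++ t ~r q) : 100 * u.length ≤ q.length := by
  have hl := base_len hb₁ hb₂ hq
  by_cases hu0 : u = []
  · subst hu0; simp
  obtain ⟨z, u', hz⟩ := List.exists_cons_of_ne_nil hu0
  have hzq : z ∈ q := e.mem_iff.1 (by simp [hz])
  have hzy := hu z (by simp [hz])
  cases hq with
  | pow g n hg =>
    exfalso
    have := List.eq_of_mem_replicate hzq
    subst this
    simp at hzy; subst hzy
    rcases hy with h | h <;> cases h <;> cases hg
  | code c hc =>
    cases hc with
    | w m as c hm w =>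
      exfalso
      rcases mem_wd hzq with h | ⟨P, hP, h⟩
      · rw [h] at hzy; simp at hzy; rw [w.mid.1] at hzy
        rcases hy with h | h <;> rw [h] at hzy <;> cases hzy
      · obtain ⟨a, ha⟩ := w.letters P hP _ h
        rw [ha] at hzy
        rcases hy with h | h <;> rw [h] at hzy <;> cases hzy
    | ch lo x y' tri =>
      have hall : ∀ w ∈ u, w = (x, true) ∨ w = (y', true) := fun w hw => ch_letters (e.mem_iff.1 (by simp [hw]))
      by_cases hx : y = x
      · subst hx
        have hr : u = replicate u.length (y, true) := all_rep fun w hw => by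
          rcases hall w hw with h | h
          · exact h
          · have := hu w hw; rw [h] at this; exact absurd this.symm tri.ne
        have : u.length ≤ 1 := by
          by_contra h2
          obtain ⟨k, hk⟩ : ∃ k, u.length = k + 2 := ⟨u.length - 2, by omega⟩
          rw [hk] at hr
          rw [hr] at e
          exact ch_noadj tri (p := []) (q := replicate k (y, true) ++ t) (by simpa [replicate_succ] using e)
        omega
      · have hr : u = replicate u.length (y', true) := all_rep fun w hw => by
          rcases hall w hw with h | h
          · have := hu w hw; rw [h] at this; exact absurd this.symm hx
          · exact h
        have hy' : y = y' := by rw [hr] at hz; rw [← hzy]; have : z ∈ replicate u.length (y', true) := by rw [hz]; simp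
                                rw [List.eq_of_mem_replicate this]
        subst hy'
        have hlo : lo = 0 := by rcases hy with h | h <;> subst h <;> cases tri <;> rfl
        subst hlo
        rw [hr] at e
        have := run_ch tri e
        rw [chC_length]
        omega

theorem Rp_run {y : GenSym S.A} (hy : CD y) {u t} (hb₁ : 10 ^ 10 < p₁) (hb₂ : 10 ^ 10 < p₂) 
    (hu : ∀ z ∈ u, z.1 = y) (h : u ++ t ∈ Rp S p₁ p₂) : 100 * u.length ≤ (u ++ t).length := by
  obtain ⟨q, b, l, h | h⟩ := Rp_cases h
  · rw [l]; exact base_run hy hb₁ hb₂ b hu h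
  · have := base_run hy hb₁ hb₂ b (u := iW u) ?_ h
    · rw [l]; simpa using this
    · intro z hz
      have : iL z ∈ u := by
        have : ∀ u : List (Ltr S), z ∈ iW u → iL z ∈ u := by
          intro u
          induction u with
          | nil => simp
          | cons a u ih =>
            simp only [iW_cons, List.mem_append, List.mem_cons, List.not_mem_nil, or_false]
            rintro (h | h)
            · exact Or.inr (ih h)
            · left; rw [h]; simp
        exact this u hz
      exact hu (iL z) this

theorem mem_iW {u : List (Ltr S)} {z} : z ∈ iW u ↔ iL z ∈ u := by
  induction u with
  | nil => simp
  | cons a u ih =>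
    simp only [iW_cons, List.mem_append, List.mem_cons, List.not_mem_nil, or_false, ih]
    constructor
    · rintro (h | h)
      · exact Or.inr h
      · left; rw [h]; simp
    · rintro (h | h)
      · right; rw [← h]; simp
      · exact Or.inl h

/-- classification of relators containing c -/
theorem base_c {q z} (hq : IsBase S p₁ p₂ q) (hz : z ∈ q) (hzy : z.1 = GenSym.c) :
    (∃ f, q = (chC 2000 GenSym.c f).word ∧ Tri S 2000 GenSym.c f ∧ (f = GenSym.f1 ∨ f = GenSym.f2)) ∨
      ∃ a, q = (chC 0 (GenSym.elt a) GenSym.c).word := by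
  cases hq with
  | pow g n hg =>
    exfalso
    have := List.eq_of_mem_replicate hz
    subst this
    simp at hzy; subst hzy
    cases hg
  | code c hc =>
    cases hc with
    | w m as c hm w =>
      exfalso
      rcases mem_wd hz with h | ⟨P, hP, h⟩
      · rw [h] at hzy; simp at hzy; rw [w.mid.1] at hzy
        cases hzy
      · obtain ⟨a, ha⟩ := w.letters P hP _ h
        rw [ha] at hzy
        cases hzy
    | ch lo x y' tri =>
      have := ch_letters hz
      have hh : x = GenSym.c ∨ y' = GenSym.c := by
        rcases this with h | h <;> rw [h] at hzy
        · exact Or.inl hzy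
        · exact Or.inr hzy
      cases tri <;> simp at hh
      · left; exact ⟨_, rfl, .c1, by simp⟩
      · left; exact ⟨_, rfl, .c2, by simp⟩
      · right; exact ⟨_, rfl⟩

theorem base_ncd {q z w} (hq : IsBase S p₁ p₂ q) (hz : z ∈ q) (hw : w ∈ q) (hzc : z.1 = GenSym.c) (hwd : w.1 = GenSym.d) : False := by
  rcases base_c hq hz hzc with ⟨f, e, -, hf⟩ | ⟨a, e⟩
  · rw [e] at hw
    rcases ch_letters hw with h | h <;> rw [h] at hwd <;> simp at hwd
    rcases hf with h | h <;> rw [h] at hwd <;> cases hwd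
  · rw [e] at hw
    rcases ch_letters hw with h | h <;> rw [h] at hwd <;> simp at hwd

theorem Rp_ncd {r z w} (hr : r ∈ Rp S p₁ p₂) (hz : z ∈ r) (hw : w ∈ r) (hzc : z.1 = GenSym.c) (hwd : w.1 = GenSym.d) : False := by
  obtain ⟨q, b, h | h⟩ := hr
  · exact base_ncd b (h.mem_iff.1 hz) (h.mem_iff.1 hw) hzc hwd
  · exact base_ncd b (z := iL z) (w := iL w) (h.mem_iff.1 (mem_iW.2 (by simpa using hz))) (h.mem_iff.1 (mem_iW.2 (by simpa using hw))) hzc hwd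

/-- F1 -/
theorem Rp_mixed {r p o q p' q'} (hr : r ∈ Rp S p₁ p₂) (e : r = p ++ (o ++ q)) (e' : r = p' ++ (iW o ++ q')) : o.length ≤ 2 := by
  have rot : ∀ {p o q : List (Ltr S)}, o ++ (q ++ p) ~r p ++ (o ++ q) := fun {p o q} => by
    rw [← List.append_assoc]; exact List.isRotated_append
  obtain ⟨b, hb, h | h⟩ := hr
  · refine base_mixed hb hb (s := o) (t₁ := q ++ p) (t₂ := q' ++ p') (rot.trans (e ▸ h)) (rot.trans (e' ▸ h))
  · have h1 : iW o ++ (iW p ++ iW q) ~r b := by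
      refine rot.trans ?_; rw [e] at h; simpa using h
    have h2 : iW (iW o) ++ (iW p' ++ iW q') ~r b := by
      refine rot.trans ?_; rw [e'] at h; simpa using h
    have := base_mixed hb hb h1 h2
    simpa using this

theorem aperiodic {c : Code S} (hc : IsCode S c) {w d} (h : w ~r c.word) (hd : w.rotate d = w) (hlt : d < w.length) : d = 0 := by
  have hl : w.length = c.word.length := h.perm.length_eq
  have hlen := hc.len
  obtain ⟨u, v, e1, e2, hu⟩ := rot_split (code_ne hc) h
  have hw : w = c.word.rotate u.length := by rw [e1, e2, List.rotate_append_length_eq]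
  have hw2 : w = c.word.rotate ((u.length + d) % c.word.length) := by
    rw [List.rotate_mod, ← List.rotate_rotate, ← hw, hd]
  have hlt' : (u.length + d) % c.word.length < c.word.length := Nat.mod_lt _ (by omega)
  rw [List.rotate_eq_drop_append_take hlt'.le] at hw2
  obtain ⟨-, hu'⟩ := strong hc hc (s := w) (t := []) (t' := []) e1 (List.take_append_drop _ _).symm hu
    (by simpa using hlt') (by rw [← e2]; simp) (by rw [← hw2]; simp) (by omega)
  have := congrArg List.length hu'
  rw [List.length_take, min_eq_left hlt'.le] at this
  by_contra hd0
  by_cases hcase : u.length + d < c.word.length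
  · rw [Nat.mod_eq_of_lt hcase] at this; omega
  · rw [Nat.mod_eq_sub_mod (by omega), Nat.mod_eq_of_lt (by omega)] at this; omega

theorem code_two (hb₁ : 10 ^ 10 < p₁) (hb₂ : 10 ^ 10 < p₂) {c : Code S} (hc : IsCode S c) {r p o q p' q'} (hr : r ~r c.word) (e : r = p ++ (o ++ q)) (e' : r = p' ++ (o ++ q'))
    (hlt : p.length < p'.length) (hne : o ≠ []) : 15 * o.length ≤ r.length := by
  have hl : r.length = c.word.length := hr.perm.length_eq
  have rot : ∀ {p o q : List (Ltr S)}, o ++ (q ++ p) ~r p ++ (o ++ q) := fun {p o q} => by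
    rw [← List.append_assoc]; exact List.isRotated_append
  have h1 : o ++ (q ++ p) ~r c.word := rot.trans (e ▸ hr)
  have h2 : o ++ (q' ++ p') ~r c.word := rot.trans (e' ▸ hr)
  by_cases ht : q ++ p = q' ++ p'
  · exfalso
    have a1 : r.rotate p.length = o ++ (q ++ p) := by
      rw [e, List.rotate_append_length_eq]; simp
    have a2 : r.rotate p'.length = o ++ (q ++ p) := by
      rw [e', List.rotate_append_length_eq, ht]; simp
    have hol := List.length_pos_iff.2 hne
    have hrl := congrArg List.length e'
    simp at hrl
    have := aperiodic hc h1 (d := p'.length - p.length) (by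
      rw [← a1, List.rotate_rotate, show p.length + (p'.length - p.length) = p'.length by omega, a2, a1]) (by
      rw [h1.perm.length_eq]; omega)
    omega
  · rw [hl]
    exact base_piece hb₁ hb₂ (.code c hc) (.code c hc) h1 h2 ht

/-- F2 -/
theorem Rp_two (hb₁ : 10 ^ 10 < p₁) (hb₂ : 10 ^ 10 < p₂) {r p o q p' q' z} (hr : r ∈ Rp S p₁ p₂) (hz : z ∈ r) (hzc : z.1 = GenSym.c)
    (e : r = p ++ (o ++ q)) (e' : r = p' ++ (o ++ q'))
    (hlt : p.length < p'.length) : 15 * o.length ≤ r.length := by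
  by_cases hne : o = []
  · subst hne; simp
  have code : ∀ b z, IsBase S p₁ p₂ b → z ∈ b → z.1 = GenSym.c → ∃ c, IsCode S c ∧ b = c.word := by
    intro b z hb hz hzc
    rcases base_c hb hz hzc with ⟨f, e, t, hf⟩ | ⟨a, e⟩
    · exact ⟨_, .ch _ _ _ t, e⟩
    · exact ⟨_, .ch _ _ _ (.ac a), e⟩
  obtain ⟨b, hb, h | h⟩ := hr
  · obtain ⟨c, hc, rfl⟩ := code b z hb (h.mem_iff.1 hz) hzc
    exact code_two hb₁ hb₂ hc h e e' hlt hne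
  · obtain ⟨c, hc, rfl⟩ := code b (iL z) hb (h.mem_iff.1 (mem_iW.2 (by simpa using hz))) hzc
    have := code_two hb₁ hb₂ hc (o := iW o) (p := iW q') (q := iW p') (p' := iW q) (q' := iW p) h
      (by rw [e']; simp) (by rw [e]; simp) (by
        have := congrArg List.length e; have := congrArg List.length e'; simp at *; omega) (by
        intro h; apply hne; have := congrArg List.length h; simp at this; exact this)
    simpa using this
end SC

set_option linter.unusedSectionVars false
set_option linter.unusedSimpArgs false
namespace SC
open List
variable {α : Type} {G : Type} [Group G] {f : FreeGroup α →* G} {γ : G}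

/-- the conjugate word is improvable modulo powers of γ -/
def Imp (f : FreeGroup α →* G) (γ : G) (g z : List (α × Bool)) : Prop :=
  ∃ g' z' : List (α × Bool), ∃ i j : ℤ, g'.length + z'.length < g.length + z.length ∧
    ev f g * ev f z * (ev f g)⁻¹ = γ ^ i * (ev f g' * ev f z' * (ev f g')⁻¹) * γ ^ j

theorem Imp.inv {g z} (h : Imp f γ g (iW z)) : Imp f γ g z := by
  obtain ⟨g', z', i, j, hl, e⟩ := h
  refine ⟨g', iW z', -j, -i, by simpa using hl, ?_⟩
  have := congrArg (·⁻¹) e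
  simp [mul_assoc] at this
  simp [mul_assoc, this]

theorem Imp.mk0 {g z} (g' z') (hl : g'.length + z'.length < g.length + z.length)
    (e : ev f g * ev f z * (ev f g)⁻¹ = ev f g' * ev f z' * (ev f g')⁻¹) : Imp f γ g z :=
  ⟨g', z', 0, 0, hl, by simp [e]⟩

theorem core4 {p s1 s2 z2 t : List (α × Bool)} (e : ev f s1 * ev f s2 * ev f t = 1) (hl : 2 * t.length < s1.length + s2.length) :
    Imp f γ (p ++ s1) (s2 ++ z2) := by
  have et := eq_inv_of_mul_eq_one_right e
  by_cases h : t.length < s2.length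
  · refine .mk0 p (iW t ++ z2 ++ iW s1) (by simp; omega) ?_
    simp only [ev_append, ev_iW, et]; group
  · refine .mk0 (p ++ iW t) (z2 ++ s2) (by simp; omega) ?_
    simp only [ev_append, ev_iW, et]; group

theorem core6 {p h s3 z t : List (α × Bool)} (e : ev f h * ev f s3 * ev f z * (ev f s3)⁻¹ * ev f t = 1) (h3 : s3.length ≤ 2)
    (hl : 2 * t.length + 4 ≤ h.length + z.length + 2 * s3.length) (hz : z ≠ []) :
    Imp f γ (p ++ (h ++ s3)) z := by
  have et := eq_inv_of_mul_eq_one_right e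
  have hz' := List.length_pos_iff.2 hz
  by_cases h' : t.length < z.length + s3.length
  · refine .mk0 p (iW t ++ iW h) (by simp; omega) ?_
    simp only [ev_append, ev_iW, et]; group
  · refine .mk0 (p ++ iW t ++ s3) z (by simp; omega) ?_
    simp only [ev_append, ev_iW, et]; group

theorem coreN {g P M T t : List (α × Bool)} {n : ℤ} (e : ev f T * (ev f g)⁻¹ * γ ^ n * ev f g * ev f P * ev f t = 1)
    (hl : 2 * t.length < T.length + P.length) : Imp f γ g (P ++ M ++ T) := by
  have et := eq_inv_of_mul_eq_one_right e
  by_cases h : t.length < T.length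
  · refine ⟨g ++ P, M ++ iW t, 0, -n, by simp; omega, ?_⟩
    simp only [ev_append, ev_iW, et]; group
  · refine ⟨g ++ iW T, iW t ++ M, -n, 0, by simp; omega, ?_⟩
    simp only [ev_append, ev_iW, et]; group

theorem coreO {g A o B t : List (α × Bool)} {n : ℤ} (e : ev f o * ev f B * (ev f g)⁻¹ * γ ^ n * ev f g * ev f A * ev f o * ev f t = 1)
    (hl : 2 * t.length < A.length + B.length) : Imp f γ g (A ++ o ++ B) := by
  have et := eq_inv_of_mul_eq_one_right e
  by_cases h : t.length < B.length
  · refine ⟨g ++ A, iW t ++ iW o, 0, -n, by simp; omega, ?_⟩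
    simp only [ev_append, ev_iW, et]; group
  · refine ⟨g ++ iW B, iW o ++ iW t, -n, 0, by simp; omega, ?_⟩
    simp only [ev_append, ev_iW, et]; group

/-- replacement inside one block -/
theorem G0 {g z p s q t : List (α × Bool)} (hz : z ≠ []) (hp : g ++ (z ++ iW g) = p ++ (s ++ q)) (e : ev f s * ev f t = 1)
    (hl : 2 * t.length + 4 ≤ s.length)
    (F1 : ∀ o p₁ q₁ p₂ q₂ : List (α × Bool), s = p₁ ++ (o ++ q₁) → s = p₂ ++ (iW o ++ q₂) → o.length ≤ 2) : Imp f γ g z := by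
  have et : ev f t = (ev f s)⁻¹ := eq_inv_of_mul_eq_one_right e
  have es : ev f s = (ev f t)⁻¹ := by rw [et, inv_inv]
  rcases List.append_eq_append_iff.1 hp with ⟨a, ha, hb⟩ | ⟨a, ha, hb⟩
  · -- p = g ++ a
    rcases List.append_eq_append_iff.1 hb with ⟨a', ha', hb'⟩ | ⟨a', ha', hb'⟩
    · have hg : g = iW q ++ iW s ++ iW a' := by
        have := congrArg iW hb'; simpa using this
      refine .mk0 (iW q ++ t ++ iW a') z (by rw [hg]; simp; omega) ?_
      rw [hg]; simp only [ev_append, ev_iW, et]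
    · -- z = a ++ a', a' ++ iW g = s ++ q
      rcases List.append_eq_append_iff.1 hb'.symm with ⟨b, hb1, hb2⟩ | ⟨b, hb1, hb2⟩
      · -- s = a' ++ b, iW g = b ++ q
        have hg : g = iW q ++ iW b := by have := congrArg iW hb2; simpa using this
        apply Imp.inv
        rw [hg, ha']
        have : iW (a ++ a') = iW a' ++ iW a := by simp
        rw [this]
        refine core4 (t := iW t) ?_ (by simp; rw [hb1] at hl; simp at hl; omega)
        simp only [ev_append, ev_iW, et, hb1]; group
      · rw [ha', hb1]
        refine .mk0 g (a ++ (iW t ++ b)) (by simp; omega) ?_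
        simp only [ev_append, ev_iW, es]
  · rcases List.append_eq_append_iff.1 hb.symm with ⟨b, hb1, hb2⟩ | ⟨b, hb1, hb2⟩
    · -- s = a ++ b
      rcases List.append_eq_append_iff.1 hb2 with ⟨d, hd1, hd2⟩ | ⟨d, hd1, hd2⟩
      · -- covering: b = z ++ d, iW g = d ++ q
        have hg : g = iW q ++ iW d := by have := congrArg iW hd2; simpa using this
        have hl' := hl
        rw [hb1, hd1] at hl'
        simp at hl'
        rw [hb1, hd1] at es
        simp only [ev_append] at es
        rcases List.append_eq_append_iff.1 (ha.symm.trans hg) with ⟨h, h1, h2⟩ | ⟨h, h1, h2⟩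
        · -- iW q = p ++ h, a = h ++ iW d
          have hd : d.length ≤ 2 := by
            have := F1 (iW d) h (z ++ d) (a ++ z) [] (by rw [hb1, hd1, h2]; simp) (by rw [hb1, hd1]; simp)
            simpa using this
          rw [ha, h2]
          refine core6 (t := t) ?_ (by simpa using hd) (by simp; rw [h2] at hl'; simp at hl'; omega) hz
          rw [h2] at es; simp only [ev_append, ev_iW] at es ⊢
          have et2 : ev f t = (ev f h * (ev f d)⁻¹ * (ev f z * ev f d))⁻¹ := by rw [es, inv_inv]
          rw [et2]; group
        · -- p = iW q ++ h, iW d = h ++ a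
          have hd : d = iW a ++ iW h := by have := congrArg iW h2; simpa using this
          have ha2 : a.length ≤ 2 := F1 a [] (z ++ d) (a ++ z) (iW h) (by rw [hb1, hd1]; simp) (by rw [hb1, hd1, hd]; simp)
          apply Imp.inv
          rw [hg, h2]
          refine core6 (t := iW t) ?_ ha2 (by simp; rw [hd] at hl'; simp at hl'; omega) (by
            intro h; apply hz; have := congrArg List.length h; simp at this; exact this)
          rw [hd] at es; simp only [ev_append, ev_iW] at es ⊢
          have et2 : ev f t = (ev f a * (ev f z * ((ev f a)⁻¹ * (ev f h)⁻¹)))⁻¹ := by rw [es, inv_inv]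
          rw [et2]; group
      · rw [ha, hd1]
        refine core4 (t := t) ?_ (by rw [hb1] at hl; simp at hl; omega)
        rw [et, hb1, ev_append]; group
    · -- a = s ++ b
      rw [ha, hb1]
      refine .mk0 (p ++ (iW t ++ b)) z (by simp; omega) ?_
      simp only [ev_append, ev_iW, es]

theorem G1 {g z P Y2 T Y1 C t r : List (α × Bool)} {n : ℤ} (hz : z ≠ []) (hP : g ++ (z ++ iW g) = P ++ Y2) (hT : g ++ (z ++ iW g) = Y1 ++ T)
    (hr : r = T ++ (C ++ (P ++ t))) (e : ev f r = 1) (hC : ev f C = γ ^ n) (hlC : 100 * C.length ≤ r.length) (hlt : 100 * t.length ≤ 22 * r.length)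
    (hlr : 15000 ≤ r.length)
    (F1 : ∀ o p₁ q₁ p₂ q₂ : List (α × Bool), r = p₁ ++ (o ++ q₁) → r = p₂ ++ (iW o ++ q₂) → o.length ≤ 2)
    (F2 : ∀ o p₁ q₁ p₂ q₂ : List (α × Bool), r = p₁ ++ (o ++ q₁) → r = p₂ ++ (o ++ q₂) → p₁.length < p₂.length → 15 * o.length ≤ r.length) :
    Imp f γ g z := by
  have hlen := congrArg List.length hr
  simp at hlen
  have er := e
  rw [hr] at er
  simp only [ev_append] at er
  by_cases hP2 : P.length ≤ 2
  · refine G0 (p := Y1) (s := T) (q := []) (t := C ++ (P ++ t)) hz (by simpa using hT) (by simpa using er) (by simp; omega) ?_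
    intro o p₁ q₁ p₂ q₂ h1 h2
    exact F1 o p₁ (q₁ ++ (C ++ (P ++ t))) p₂ (q₂ ++ (C ++ (P ++ t))) (by rw [hr]; nth_rw 1 [h1]; simp) (by rw [hr]; nth_rw 1 [h2]; simp)
  by_cases hT2 : T.length ≤ 2
  · refine G0 (p := []) (s := P) (q := Y2) (t := t ++ (T ++ C)) hz (by simpa using hP) (by
      have : ev f t = (ev f T * ev f C * ev f P)⁻¹ := eq_inv_of_mul_eq_one_right (by rw [← er]; simp [mul_assoc])
      simp only [ev_append]
      rw [this]; group) (by simp; omega) ?_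
    intro o p₁ q₁ p₂ q₂ h1 h2
    exact F1 o (T ++ (C ++ p₁)) (q₁ ++ t) (T ++ (C ++ p₂)) (q₂ ++ t) (by rw [hr]; nth_rw 1 [h1]; simp) (by rw [hr]; nth_rw 1 [h2]; simp)
  by_cases hg : 3 ≤ g.length
  · exfalso
    have hg3 : g = g.take 3 ++ g.drop 3 := by simp
    have l3 : (g.take 3).length = 3 := by simp [hg]
    generalize g.take 3 = o at hg3 l3
    generalize g.drop 3 = g' at hg3
    have a1 : ∃ P', P = o ++ P' := by
      rw [hg3] at hP; simp only [List.append_assoc] at hP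
      rcases List.append_eq_append_iff.1 hP with ⟨a, ha, hb⟩ | ⟨a, ha, hb⟩
      · exact ⟨a, ha⟩
      · have := congrArg List.length ha; simp at this
        have : a = [] := List.length_eq_zero_iff.1 (by omega)
        subst this; exact ⟨[], by simpa using ha.symm⟩
    have a2 : ∃ T', T = T' ++ iW o := by
      rw [hg3] at hT; simp only [List.append_assoc, iW_append] at hT
      have hT' : (o ++ (g' ++ (z ++ iW g'))) ++ iW o = Y1 ++ T := by rw [← hT]; simp
      rcases List.append_eq_append_iff.1 hT' with ⟨a, ha, hb⟩ | ⟨a, ha, hb⟩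
      · have := congrArg List.length hb; simp at this
        have : a = [] := List.length_eq_zero_iff.1 (by omega)
        subst this; exact ⟨[], by simpa using hb.symm⟩
      · exact ⟨a, hb⟩
    obtain ⟨P', rfl⟩ := a1
    obtain ⟨T', rfl⟩ := a2
    have := F1 o (T' ++ iW o ++ C) (P' ++ t) T' (C ++ (o ++ P' ++ t)) (by rw [hr]; simp) (by rw [hr]; simp)
    omega
  -- |g| ≤ 2
  obtain ⟨P0, hP0, hP1⟩ : ∃ P0, P = g ++ P0 ∧ z ++ iW g = P0 ++ Y2 := by
    rcases List.append_eq_append_iff.1 hP with ⟨a, ha, hb⟩ | ⟨a, ha, hb⟩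
    · exact ⟨a, ha, hb⟩
    · have := congrArg List.length ha; simp at this; omega
  obtain ⟨T0, hT0, hT1⟩ : ∃ T0, T = T0 ++ iW g ∧ g ++ z = Y1 ++ T0 := by
    rw [← List.append_assoc] at hT
    rcases List.append_eq_append_iff.1 hT with ⟨a, ha, hb⟩ | ⟨a, ha, hb⟩
    · have := congrArg List.length hb; simp at this; omega
    · exact ⟨a, hb, ha⟩
  obtain ⟨Pz, P', z2, hPz, hP', hzP⟩ : ∃ Pz P' z2, P0 = Pz ++ P' ∧ P'.length ≤ 2 ∧ z = Pz ++ z2 := by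
    rcases List.append_eq_append_iff.1 hP1 with ⟨a, ha, hb⟩ | ⟨a, ha, hb⟩
    · refine ⟨z, a, [], ha, ?_, by simp⟩
      have := congrArg List.length hb; simp at this; omega
    · exact ⟨P0, [], a, by simp, by simp, ha⟩
  obtain ⟨Tz, T', z1, hTz, hT', hzT⟩ : ∃ Tz T' z1, T0 = T' ++ Tz ∧ T'.length ≤ 2 ∧ z = z1 ++ Tz := by
    rcases List.append_eq_append_iff.1 hT1 with ⟨a, ha, hb⟩ | ⟨a, ha, hb⟩
    · exact ⟨T0, [], a, by simp, by simp, hb⟩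
    · refine ⟨z, a, [], hb, ?_, by simp⟩
      have := congrArg List.length ha; simp at this; omega
  subst hP0; subst hT0; subst hPz; subst hTz
  have er2 : ev f Tz * (ev f g)⁻¹ * γ ^ n * ev f g * ev f Pz * ev f (P' ++ (t ++ T')) = 1 := by
    have : ev f t = (ev f T' * ev f Tz * (ev f g)⁻¹ * γ ^ n * ev f g * ev f Pz * ev f P')⁻¹ := by
      apply eq_inv_of_mul_eq_one_right
      rw [← er, hC]; simp [mul_assoc]
    simp only [ev_append, this]; group
  simp at hlen
  rcases List.append_eq_append_iff.1 (hzP.symm.trans hzT) with ⟨a, ha, hb⟩ | ⟨a, ha, hb⟩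
  · -- z1 = Pz ++ a, z = Pz ++ a ++ Tz
    rw [hzT, ha]
    exact coreN er2 (by simp; omega)
  · -- Pz = z1 ++ a, Tz = a ++ z2
    rw [hzP, ha]
    have ho := F2 a T' (z2 ++ (iW g ++ (C ++ (g ++ (Pz ++ (P' ++ t)))))) (T' ++ (Tz ++ (iW g ++ (C ++ (g ++ z1))))) (P' ++ t)
      (by rw [hr, hb]; simp) (by rw [hr, ha]; simp) (by
        have := List.length_pos_iff.2 hz
        have h1 := congrArg List.length ha
        have h2 := congrArg List.length hb
        have h3 := congrArg List.length hzT
        simp at h1 h2 h3 ⊢; omega)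
    have h1 := congrArg List.length ha
    have h2 := congrArg List.length hb
    simp at h1 h2
    refine coreO (n := n) (t := P' ++ (t ++ T')) ?_ (by simp; omega)
    rw [← er2, ha, hb]; simp only [ev_append]; group
end SC

set_option linter.unusedSectionVars false
set_option linter.unusedSimpArgs false
namespace SC
open List
variable {α : Type} {G : Type} [Group G] {f : FreeGroup α →* G}

/-- the word c^n -/
def cp (c : α) (n : ℤ) : List (α × Bool) := replicate n.natAbs (c, decide (0 < n))

/-- Y c^{n₁} Y c^{n₂} … -/
def blk (c : α) (Y : List (α × Bool)) (ns : List ℤ) : List (α × Bool) := ns.flatMap fun n => Y ++ cp c n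

@[simp] theorem blk_nil (c : α) (Y) : blk c Y [] = [] := rfl
@[simp] theorem blk_cons (c : α) (Y n ns) : blk c Y (n :: ns) = Y ++ (cp c n ++ blk c Y ns) := by simp [blk]
@[simp] theorem blk_append (c : α) (Y ns ms) : blk c Y (ns ++ ms) = blk c Y ns ++ blk c Y ms := by simp [blk]
@[simp] theorem cp_length (c : α) (n) : (cp c n).length = n.natAbs := by simp [cp]
@[simp] theorem cp_zero (c : α) : cp c 0 = [] := rfl
theorem cp_mem {c : α} {n z} (h : z ∈ cp c n) : z.1 = c := by
  rw [cp] at h; rw [List.eq_of_mem_replicate h]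

theorem ev_replicate (n : ℕ) (z : α × Bool) : ev f (replicate n z) = ev f [z] ^ n := by
  rw [ev, mk_replicate, map_pow]; rfl

theorem ev_cp (c : α) (n : ℤ) : ev f (cp c n) = ev f [(c, true)] ^ n := by
  rw [cp, ev_replicate]
  by_cases h : 0 < n
  · have : ((n.natAbs : ℕ) : ℤ) = n := by omega
    rw [← zpow_natCast, this]; simp [h]
  · have : ((n.natAbs : ℕ) : ℤ) = -n := by omega
    rw [← zpow_natCast, this]
    simp only [h, decide_false]
    have e : [(c, false)] = iW [(c, true)] := by simp [iW, iL]
    rw [e, ev_iW]; simp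

theorem ev_blk (c : α) (Y ns) : ev f (blk c Y ns) = (ns.map fun n => ev f Y * ev f [(c, true)] ^ n).prod := by
  induction ns with
  | nil => simp
  | cons n ns ih => simp [ih, ev_cp, mul_assoc]

/-- first letter not c -/
def HN (c : α) (s : List (α × Bool)) : Prop := ∀ z u, s = z :: u → z.1 ≠ c
def LN (c : α) (s : List (α × Bool)) : Prop := ∀ z u, s = u ++ [z] → z.1 ≠ c

theorem strip (c : α) (s : List (α × Bool)) : ∃ u s0 v, s = u ++ (s0 ++ v) ∧ (∀ z ∈ u, z.1 = c) ∧ (∀ z ∈ v, z.1 = c) ∧ HN c s0 ∧ LN c s0 := by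
  have h1 : ∀ s : List (α × Bool), ∃ u s0, s = u ++ s0 ∧ (∀ z ∈ u, z.1 = c) ∧ HN c s0 := by
    intro s
    induction s with
    | nil => exact ⟨[], [], by simp, by simp, by intro z u h; simp at h⟩
    | cons a s ih =>
      by_cases h : a.1 = c
      · obtain ⟨u, s0, e, hu, hs⟩ := ih
        exact ⟨a :: u, s0, by simp [e], by simpa [h] using hu, hs⟩
      · exact ⟨[], a :: s, by simp, by simp, by intro z u e; simp at e; rw [← e.1]; exact h⟩
  have h2 : ∀ s : List (α × Bool), HN c s → ∃ s0 v, s = s0 ++ v ∧ (∀ z ∈ v, z.1 = c) ∧ HN c s0 ∧ LN c s0 := by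
    intro s
    induction s using List.reverseRecOn with
    | nil => intro _; exact ⟨[], [], by simp, by simp, by intro z u h; simp at h, by intro z u h; simp at h⟩
    | append_singleton s a ih =>
      intro hs
      by_cases h : a.1 = c
      · obtain ⟨s0, v, e, hv, hh⟩ := ih (by intro z u e; exact hs z (u ++ [a]) (by simp [e]))
        refine ⟨s0, v ++ [a], by simp [e], ?_, hh⟩
        intro z hz
        rcases List.mem_append.1 hz with hz | hz
        · exact hv z hz
        · simp at hz; rw [hz]; exact h
      · refine ⟨s ++ [a], [], by simp, by simp, hs, ?_⟩
        intro z u e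
        have := (List.append_inj' e rfl).2
        simp at this; rw [← this]; exact h
  obtain ⟨u, s1, e1, hu, hs1⟩ := h1 s
  obtain ⟨s0, v, e2, hv, hh⟩ := h2 s1 hs1
  exact ⟨u, s0, v, by rw [e1, e2], hu, hv, hh⟩

theorem LN.suffix {c : α} {s t : List (α × Bool)} (h : LN c (s ++ t)) : LN c t := by
  intro z u e; exact h z (s ++ u) (by simp [e])

theorem LN.no {c : α} {s : List (α × Bool)} (h : LN c s) (hs : s ≠ []) (hc : ∀ z ∈ s, z.1 = c) : False := by
  obtain ⟨u, z, e⟩ := List.eq_nil_or_concat s |>.resolve_left hs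
  exact h z u (by simp [e]) (hc z (by simp [e]))

theorem HN.no {c : α} {s : List (α × Bool)} {z} (h : HN c s) (hs : s ≠ []) (hc : ∀ u q q', s ++ q = z :: u ++ q' → z.1 = c) {u q} (e : s ++ q = z :: u) : False := by
  cases s with
  | nil => exact hs rfl
  | cons a s =>
    have h2 := e
    simp at h2
    exact h a s rfl (by rw [h2.1]; exact hc u q [] (by simpa using e))

theorem blk_front {c : α} {Y b q ns} (hb : b ≠ []) (hl : LN c b) (e : blk c Y ns = b ++ q) :
    ∃ ms n ns2 P Y2, ns = ms ++ n :: ns2 ∧ b = blk c Y ms ++ P ∧ Y = P ++ Y2 ∧ P ≠ [] := by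
  induction ns generalizing b with
  | nil => simp at e; exact absurd e.1 hb
  | cons n ns ih =>
    rw [blk_cons] at e
    rcases List.append_eq_append_iff.1 e with ⟨a, ha, h2⟩ | ⟨a, ha, h2⟩
    · by_cases ha0 : a = []
      · exact ⟨[], n, ns, Y, [], by simp, by simpa [ha0] using ha, by simp, by rintro rfl; simp [ha0] at ha; exact hb ha⟩
      rcases List.append_eq_append_iff.1 h2 with ⟨a', ha', h3⟩ | ⟨a', ha', h3⟩
      · by_cases ha1 : a' = []
        · exfalso
          refine LN.no (by rw [ha] at hl; exact hl.suffix) ha0 ?_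
          intro z hz; rw [ha', ha1] at hz; simp at hz; exact cp_mem hz
        · obtain ⟨ms, n', ns2, P, Y2, h4, h5, h6, h7⟩ := ih (b := a') ha1 (by rw [ha, ha', ← List.append_assoc] at hl; exact hl.suffix) h3
          exact ⟨n :: ms, n', ns2, P, Y2, by simp [h4], by rw [ha, ha', h5]; simp, h6, h7⟩
      · exfalso
        refine LN.no (by rw [ha] at hl; exact hl.suffix) ha0 ?_
        intro z hz; exact cp_mem (c := c) (n := n) (by rw [ha']; simp [hz])
    · exact ⟨[], n, ns, b, a, by simp, by simp, ha, hb⟩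

theorem blk_inner {c : α} {Y p s q ns} (hs : s ≠ []) (hh : HN c s) (hl : LN c s) (e : blk c Y ns = p ++ (s ++ q)) :
    (∃ u v, Y = u ++ (s ++ v)) ∨ ∃ ns1 m ms n ns2 T P Y1 Y2, ns = ns1 ++ (m :: (ms ++ n :: ns2)) ∧ Y = Y1 ++ T ∧ Y = P ++ Y2 ∧ T ≠ [] ∧ P ≠ [] ∧
      s = T ++ (cp c m ++ (blk c Y ms ++ P)) := by
  induction ns generalizing p with
  | nil => simp at e; exact absurd e.2.1 hs
  | cons n ns ih =>
    rw [blk_cons] at e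
    rcases List.append_eq_append_iff.1 e with ⟨a, ha, h2⟩ | ⟨a, ha, h2⟩
    · rcases List.append_eq_append_iff.1 h2 with ⟨a', ha', h3⟩ | ⟨a', ha', h3⟩
      · rcases ih h3 with h | ⟨ns1, m, ms, n', ns2, T, P, Y1, Y2, h⟩
        · exact Or.inl h
        · exact Or.inr ⟨n :: ns1, m, ms, n', ns2, T, P, Y1, Y2, by simp [h.1], h.2⟩
      · by_cases ha0 : a' = []
        · rw [ha0] at h3
          rcases ih (p := []) (by simpa using h3.symm) with h | ⟨ns1, m, ms, n', ns2, T, P, Y1, Y2, h⟩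
          · exact Or.inl h
          · exact Or.inr ⟨n :: ns1, m, ms, n', ns2, T, P, Y1, Y2, by simp [h.1], h.2⟩
        · exfalso
          obtain ⟨z, u, hz⟩ := List.exists_cons_of_ne_nil ha0
          cases s with
          | nil => exact hs rfl
          | cons w s =>
            rw [hz] at h3
            simp at h3
            refine hh w s rfl ?_
            rw [h3.1]
            exact cp_mem (n := n) (by rw [ha', hz]; simp)
    · by_cases ha0 : a = []
      · rw [ha0] at h2
        rcases List.append_eq_append_iff.1 (show s ++ q = cp c n ++ blk c Y ns by simpa using h2) with ⟨a', ha', h3⟩ | ⟨a', ha', h3⟩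
        · exfalso
          exact LN.no hl hs (fun z hz => cp_mem (n := n) (by rw [ha']; simp [hz]))
        · cases hn : cp c n with
          | nil =>
            rw [hn] at ha'
            rcases ih (p := []) (by simpa [ha'] using h3) with h | ⟨ns1, m, ms, n', ns2, T, P, Y1, Y2, h⟩
            · exact Or.inl h
            · exact Or.inr ⟨n :: ns1, m, ms, n', ns2, T, P, Y1, Y2, by simp [h.1], h.2⟩
          | cons z u =>
            exfalso
            rw [hn] at ha'
            exact hh z (u ++ a') (by simpa using ha') (cp_mem (n := n) (by rw [hn]; simp))
      · rcases List.append_eq_append_iff.1 h2 with ⟨b, hb, h3⟩ | ⟨b, hb, h3⟩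
        · left; exact ⟨p, b, by rw [ha, hb]⟩
        · by_cases hb0 : b = []
          · left; exact ⟨p, [], by rw [ha, hb, hb0]; simp⟩
          have hlb : LN c b := by rw [hb] at hl; exact hl.suffix
          rcases List.append_eq_append_iff.1 h3 with ⟨b', hb', h4⟩ | ⟨b', hb', h4⟩
          · by_cases hb1 : b' = []
            · exfalso
              refine LN.no hlb hb0 ?_
              intro z hz; rw [hb', hb1] at hz; simp at hz; exact cp_mem hz
            · obtain ⟨ms, n', ns2, P, Y2, h4, h5, h6, h7⟩ := blk_front hb1 (by rw [hb'] at hlb; exact hlb.suffix) h4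
              right
              exact ⟨[], n, ms, n', ns2, a, P, p, Y2, by simp [h4], ha, h6, ha0, h7, by rw [hb, hb', h5]⟩
          · exfalso
            exact LN.no hlb hb0 (fun z hz => cp_mem (n := n) (by rw [hb']; simp [hz]))

theorem cp_red (c : α) (n : ℤ) : (cp c n).IsChain (fun a b => b ≠ iL a) := by
  rw [cp]
  generalize n.natAbs = k
  induction k with
  | zero => simp
  | succ k ih =>
    rw [List.replicate_succ]
    cases k with
    | zero => simp
    | succ k =>
      rw [List.replicate_succ] at ih ⊢
      exact List.isChain_cons_cons.2 ⟨by simp [iL], ih⟩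

theorem blk_red {c : α} {Y ns} (hY : Y ≠ []) (hr : Y.IsChain (fun a b => b ≠ iL a)) (hh : HN c Y) (hl : LN c Y) (hns : ∀ n ∈ ns.dropLast, n ≠ 0) :
    (blk c Y ns).IsChain (fun a b => b ≠ iL a) := by
  have key : ∀ a b : α × Bool, (a.1 = c ∧ b.1 ≠ c ∨ a.1 ≠ c ∧ b.1 = c) → b ≠ iL a := by
    rintro a b h rfl
    simp [iL] at h
  have hhd : ∀ z ∈ Y.head?, z.1 ≠ c := by
    intro z hz
    cases Y with
    | nil => simp at hz
    | cons y Y => simp at hz; exact hh z Y (by simp [hz])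
  have hla : ∀ z ∈ Y.getLast?, z.1 ≠ c := by
    intro z hz
    obtain ⟨u, w, e⟩ := List.eq_nil_or_concat Y |>.resolve_left hY
    rw [e] at hz; simp at hz
    exact hl z u (by simp [e, hz])
  induction ns with
  | nil => simp
  | cons n ns ih =>
    rw [blk_cons]
    have hbh : ∀ z ∈ (blk c Y ns).head?, z.1 ≠ c := by
      intro z hz
      cases ns with
      | nil => simp at hz
      | cons m ms =>
        apply hhd
        rw [blk_cons] at hz
        cases Y with
        | nil => exact absurd rfl hY
        | cons y Y => simpa using hz
    have ih' := ih (by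
      cases ns with
      | nil => simp
      | cons m ms => intro k hk; exact hns k (by rw [List.dropLast_cons_of_ne_nil (by simp)]; simp [hk]))
    rw [List.isChain_append]
    refine ⟨hr, ?_, ?_⟩
    · rw [List.isChain_append]
      refine ⟨cp_red c n, ih', ?_⟩
      intro x hx y hy
      exact key x y (Or.inl ⟨cp_mem (List.mem_of_mem_getLast? hx), hbh y hy⟩)
    · intro x hx y hy
      by_cases hn : n = 0
      · cases ns with
        | nil => subst hn; simp at hy
        | cons m ms => exact absurd hn (hns n (by rw [List.dropLast_cons_of_ne_nil (by simp)]; simp))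
      · refine key x y (Or.inr ⟨hla x hx, ?_⟩)
        have : cp c n ≠ [] := by
          intro h; have := congrArg List.length h; simp at this; exact hn this
        obtain ⟨z, u, hz⟩ := List.exists_cons_of_ne_nil this
        rw [hz] at hy; simp at hy
        subst hy
        exact cp_mem (n := n) (by rw [hz]; simp)
end SC

set_option linter.unusedSectionVars false
set_option linter.unusedSimpArgs false
namespace SC
open List
variable {S : IndexedStructure} {p₁ p₂ : ℕ}

theorem consec {β : Type} {N : ℕ} {F : ℕ → β} {A B : List β} {e e'}
    (h : (List.range N).map F ++ (List.range N).map F = A ++ e :: e' :: B) :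
    (∃ k, k + 1 < N ∧ e = F k ∧ e' = F (k + 1)) ∨ (e = F (N - 1) ∧ e' = F 0) := by
  have hl := congrArg List.length h
  simp at hl
  have get : ∀ i, i < 2 * N → ((List.range N).map F ++ (List.range N).map F)[i]? = some (if i < N then F i else F (i - N)) := by
    intro i hi
    rw [List.getElem?_append]
    by_cases hN : i < N
    · simp [hN]
    · have : i - N < N := by omega
      simp [hN, this]
  have h1 := get A.length (by omega)
  have h2 := get (A.length + 1) (by omega)
  rw [h] at h1 h2
  rw [List.getElem?_append_right (by omega)] at h1 h2
  simp at h1 h2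
  by_cases c1 : A.length + 1 < N
  · left
    refine ⟨A.length, c1, ?_, ?_⟩
    · rw [h1, if_pos (by omega)]
    · rw [h2, if_pos (by omega)]
  by_cases c2 : A.length + 1 = N
  · right
    rw [if_pos (by omega)] at h1
    rw [if_neg (by omega)] at h2
    exact ⟨by rw [h1]; congr 1; omega, by rw [h2]; congr 1; omega⟩
  · left
    rw [if_neg (by omega)] at h1
    rw [if_neg (by omega)] at h2
    exact ⟨A.length - N, by omega, h1, by rw [h2]; congr 1; omega⟩

theorem wd_prefix_eq {β : Type} {y : β} {L A A' B B' : List (List β × ℕ)} (hL : Good y L) (h : L = A ++ B) (h' : L = A' ++ B')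
    (e : (wd y A).length = (wd y A').length) : A = A' := by
  have nil : ∀ D E, L = D ++ E → ∀ X Y, D = X ++ Y → (wd y Y).length = 0 → Y = [] := by
    intro D E hD X Y hX h0
    cases Y with
    | nil => rfl
    | cons P Y =>
      have := (hL P (by rw [hD, hX]; simp)).2.2
      simp at h0; omega
  rcases List.append_eq_append_iff.1 (h.symm.trans h') with ⟨a, ha, hb⟩ | ⟨a, ha, hb⟩
  · have := nil A' B' h' A a ha (by rw [ha] at e; simp at e ⊢; omega)
    rw [ha, this]; simp
  · have := nil A B h A' a ha (by rw [ha] at e; simp at e ⊢; omega)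
    rw [ha, this]; simp

theorem good2 {β : Type} {y : β} {L : List (List β × ℕ)} (hL : Good y L) : Good y (L ++ L) := by
  intro P hP
  exact hL P (by rcases List.mem_append.1 hP with h | h <;> exact h)

/-- uniqueness of exponents -/
theorem code_pos {c : Code S} (hc : IsCode S c) {r p q p' q' z z' w w'} {e : ℕ} (he : 1 ≤ e) (hr : r ~r c.word)
    (hz : z ≠ (c.y, true)) (hz' : z' ≠ (c.y, true)) (hw : w ≠ (c.y, true)) (hw' : w' ≠ (c.y, true))
    (e1 : r = p ++ z :: (replicate e (c.y, true) ++ z' :: q))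
    (e2 : r = p' ++ w :: (replicate e (c.y, true) ++ w' :: q')) : p.length = p'.length := by
  obtain ⟨u, v, eu, ev, -⟩ := rot_split (code_ne hc) hr
  have hd : wd (c.y, true) (c.L ++ c.L) = u ++ (r ++ v) := by
    rw [wd_append, ← Code.word, eu, ev]; simp
  have hg := good2 hc.good
  obtain ⟨L1, X, L2, a1, a2⟩ := parse hz hz' he _ hg (u ++ p) (q := q ++ v) (by rw [hd, e1]; simp)
  obtain ⟨L1', X', L2', b1, b2⟩ := parse hw hw' he _ hg (u ++ p') (q := q' ++ v) (by rw [hd, e2]; simp)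
  obtain ⟨hX, h⟩ := idx_unique hc.nd a1 b1
  have la := congrArg List.length a2
  have lb := congrArg List.length b2
  have l1 := congrArg List.length e1
  have l2 := congrArg List.length e2
  have lr : r.length = (wd (c.y, true) c.L).length := hr.perm.length_eq
  rw [hX] at la
  simp at la lb l1 l2
  rcases h with h | h | h
  · rw [h] at la; omega
  · rw [h, wd_append _ c.L, List.length_append] at la; omega
  · rw [h, wd_append _ c.L, List.length_append] at lb; omega

/-- consecutive exponents -/
theorem chain_pair {lo : ℕ} {x y : GenSym S.A} (tri : Tri S lo x y) {r p q} {e e' : ℕ} (he : 1 ≤ e) (he' : 1 ≤ e')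
    (hr : r ~r (chC lo x y).word)
    (e1 : r = p ++ (x, true) :: (replicate e (y, true) ++ (x, true) :: (replicate e' (y, true) ++ (x, true) :: q))) :
    (∃ k, k + 1 < 1000 ∧ e = (lo + 1 + k) ^ 2 ∧ e' = (lo + 1 + (k + 1)) ^ 2) ∨ (e = (lo + 1 + 999) ^ 2 ∧ e' = (lo + 1) ^ 2) := by
  have hc : IsCode S (chC lo x y) := .ch _ _ _ tri
  have hx : ((x, true) : Ltr S) ≠ ((chC lo x y).y, true) := by
    intro h; exact tri.ne (congrArg Prod.fst h)
  obtain ⟨u, v, eu, ev, -⟩ := rot_split (code_ne hc) hr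
  have hd : wd ((chC lo x y).y, true) ((chC lo x y).L ++ (chC lo x y).L) = u ++ (r ++ v) := by
    rw [wd_append, ← Code.word, eu, ev]; simp
  have hg := good2 hc.good
  have hyy : (chC lo x y).y = y := rfl
  obtain ⟨L1, X, L2, a1, a2⟩ := parse hx hx he _ hg (u ++ p) (q := replicate e' (y, true) ++ (x, true) :: q ++ v) (by rw [hd, e1, hyy]; simp)
  obtain ⟨L1', X', L2', b1, b2⟩ := parse hx hx he' _ hg (u ++ p ++ (x, true) :: replicate e (y, true)) (q := q ++ v) (by rw [hd, e1, hyy]; simp)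
  have mem : ∀ A B X e, (chC lo x y).L ++ (chC lo x y).L = A ++ (X, e) :: B → X = [(x, true)] := by
    intro A B X e h
    have : (X, e) ∈ (chC lo x y).L ++ (chC lo x y).L := by rw [h]; simp
    have : (X, e) ∈ (chC lo x y).L := by rcases List.mem_append.1 this with h | h <;> exact h
    exact (chC_mem this).1
  have hX := mem _ _ _ _ a1
  have hX' := mem _ _ _ _ b1
  have la := congrArg List.length a2
  have lb := congrArg List.length b2
  rw [hX] at la
  rw [hX'] at lb
  simp only [List.length_append, List.length_cons, List.length_nil, List.length_replicate] at la lb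
  have key : L1 ++ [(X, e)] = L1' := by
    refine wd_prefix_eq hg (B := L2) (B' := (X', e') :: L2') (by rw [a1]; simp) b1 ?_
    rw [hX]
    simp only [wd_append, wd_cons, wd_nil, List.length_append, List.length_cons, List.length_nil, List.length_replicate]
    omega
  rw [← key] at b1
  have b2 := congrArg (List.map Prod.snd) b1
  rw [chC_L] at b2
  simp only [List.map_append, List.map_map, List.map_cons, List.map_nil, List.append_assoc, List.cons_append, List.nil_append] at b2
  rcases consec b2 with ⟨k, hk, h1, h2⟩ | ⟨h1, h2⟩
  · left; exact ⟨k, hk, h1, h2⟩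
  · right; exact ⟨h1, h2⟩

theorem run_split {β : Type} {x y : β} (o : List β) (h : ∀ w ∈ o, w = x ∨ w = y) (hx : x ∈ o) : ∃ e o', o = replicate e y ++ x :: o' := by
  induction o with
  | nil => simp at hx
  | cons a o ih =>
    by_cases ha : a = x
    · exact ⟨0, o, by simp [ha]⟩
    · obtain ⟨e, o', he⟩ := ih (fun w hw => h w (by simp [hw])) (by
        rcases List.mem_cons.1 hx with h | h
        · exact absurd h.symm ha
        · exact h)
      have : a = y := (h a (by simp)).resolve_left ha
      exact ⟨e + 1, o', by rw [he, this, replicate_succ]; simp⟩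

/-- words with x-ends occur only once -/
theorem chain_once {lo : ℕ} {x y : GenSym S.A} (tri : Tri S lo x y) {r p q p' q' o} 
    (hr : r ~r (chC lo x y).word) (e1 : r = p ++ ((x, true) :: (o ++ [(x, true)]) ++ q))
    (e2 : r = p' ++ ((x, true) :: (o ++ [(x, true)]) ++ q')) : p.length = p'.length := by
  have hc : IsCode S (chC lo x y) := .ch _ _ _ tri
  have hx : ((x, true) : Ltr S) ≠ ((chC lo x y).y, true) := by
    intro h; exact tri.ne (congrArg Prod.fst h)
  obtain ⟨e, o', he⟩ := run_split (x := ((x, true) : Ltr S)) (y := (y, true)) (o ++ [(x, true)]) (by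
    intro w hw
    apply ch_letters (lo := lo)
    exact hr.mem_iff.1 (by rw [e1]; simp at hw ⊢; tauto)) (by simp)
  have hyy : (chC lo x y).y = y := rfl
  have he1 : 1 ≤ e := by
    by_contra h0
    have : e = 0 := by omega
    rw [he, this] at e1
    rw [e1] at hr
    exact ch_noadj tri (p := p) (q := o' ++ q) (by simpa using hr)
  exact code_pos hc he1 hr hx hx hx hx (q := o' ++ q) (q' := o' ++ q') (by rw [e1, he, hyy]; simp) (by rw [e2, he, hyy]; simp)
end SC

set_option linter.unusedSectionVars false
set_option linter.unusedSimpArgs false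
namespace SC
open List
variable {S : IndexedStructure} {p₁ p₂ : ℕ}

def Cs (σ m m' : ℤ) : Prop :=
  (∃ k : ℕ, k + 1 < 1000 ∧ m = (1 + (k : ℤ)) ^ 2 + σ ∧ m' = (1 + ((k : ℤ) + 1)) ^ 2 + σ) ∨ (m = 1000 ^ 2 + σ ∧ m' = 1 + σ)

theorem Rp_class {r z} (hr : r ∈ Rp S p₁ p₂) (hz : z ∈ r) (hzc : z.1 = GenSym.c) :
    (∃ q f, (r ~r q ∨ iW r ~r q) ∧ Tri S 2000 GenSym.c f ∧ q = (chC 2000 GenSym.c f).word) ∨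
    ∃ q a, (r ~r q ∨ iW r ~r q) ∧ q = (chC 0 (GenSym.elt a) GenSym.c).word := by
  obtain ⟨q, b, h⟩ := hr
  have : ∃ w ∈ q, w.1 = GenSym.c := by
    rcases h with h | h
    · exact ⟨z, h.mem_iff.1 hz, hzc⟩
    · exact ⟨iL z, h.mem_iff.1 (mem_iW.2 (by simpa using hz)), hzc⟩
  obtain ⟨w, hw, hwc⟩ := this
  rcases base_c b hw hwc with ⟨f, e, t, -⟩ | ⟨a, e⟩
  · exact Or.inl ⟨q, f, h, t, e⟩
  · exact Or.inr ⟨q, a, h, e⟩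

theorem noadj_sgn {f} (tri : Tri S 2000 GenSym.c f) {r p q z} (hr : r ~r (chC 2000 GenSym.c f).word ∨ iW r ~r (chC 2000 GenSym.c f).word)
    (hz : z.1 = GenSym.c) (e : r = p ++ z :: z :: q) : False := by
  rcases hr with h | h
  · have hz1 : z = (GenSym.c, true) := by
      rcases ch_letters (h.mem_iff.1 (show z ∈ r by rw [e]; simp)) with h | h
      · exact h
      · rw [h] at hz; exact absurd hz.symm tri.ne
    rw [e, hz1] at h
    exact ch_noadj tri h
  · have hz1 : iL z = (GenSym.c, true) := by
      rcases ch_letters (h.mem_iff.1 (mem_iW.2 (show iL (iL z) ∈ r by rw [e]; simp))) with h | h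
      · exact h
      · have : (iL z).1 = f := by rw [h]
        exact absurd (hz.symm.trans this) tri.ne
    rw [e] at h
    exact ch_noadj tri (p := iW q) (q := iW p) (by simpa [hz1] using h)

theorem cp_le_one {f} (tri : Tri S 2000 GenSym.c f) {r p q m} (hr : r ~r (chC 2000 GenSym.c f).word ∨ iW r ~r (chC 2000 GenSym.c f).word)
    (e : r = p ++ (cp GenSym.c m ++ q)) : m.natAbs ≤ 1 := by
  by_contra h2
  obtain ⟨k, hk⟩ : ∃ k, m.natAbs = k + 2 := ⟨m.natAbs - 2, by omega⟩
  rw [cp, hk] at e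
  exact noadj_sgn tri hr (p := p) (z := (GenSym.c, decide (0 < m))) (q := replicate k (GenSym.c, decide (0 < m)) ++ q) rfl
    (by rw [e]; simp [replicate_succ])

theorem Cs.odd {σ m m'} (h : Cs σ m m') (h1 : m.natAbs ≤ 1) (h2 : m'.natAbs ≤ 1) (h3 : m ≠ 0) (h4 : m' ≠ 0) : False := by
  rcases h with ⟨k, hk, e, e'⟩ | ⟨e, e'⟩
  · have : m' - m = 2 * k + 3 := by rw [e, e']; ring
    omega
  · omega

/-- letters of a signed relator -/
theorem sgn_letters {a : S.A} {r} (hr : r ~r (chC 0 (GenSym.elt a) GenSym.c).word ∨ iW r ~r (chC 0 (GenSym.elt a) GenSym.c).word) :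
    ∃ ε, (ε = true → r ~r (chC 0 (GenSym.elt a) GenSym.c).word) ∧ (ε = false → iW r ~r (chC 0 (GenSym.elt a) GenSym.c).word) ∧
     ∀ w ∈ r, w = (GenSym.elt a, ε) ∨ w = (GenSym.c, ε) := by
  rcases hr with h | h
  · exact ⟨true, fun _ => h, by simp, fun w hw => ch_letters (h.mem_iff.1 hw)⟩
  · refine ⟨false, by simp, fun _ => h, fun w hw => ?_⟩
    have := ch_letters (h.mem_iff.1 (mem_iW.2 (show iL (iL w) ∈ r by simpa using hw)))
    rcases this with h | h
    · left; have := congrArg iL h; simpa [iL] using this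
    · right; have := congrArg iL h; simpa [iL] using this

theorem sgn_once {a : S.A} {ε r p q p' q' o} 
    (h1 : ε = true → r ~r (chC 0 (GenSym.elt a) GenSym.c).word) (h2 : ε = false → iW r ~r (chC 0 (GenSym.elt a) GenSym.c).word)
    (e1 : r = p ++ ((GenSym.elt a, ε) :: (o ++ [(GenSym.elt a, ε)]) ++ q))
    (e2 : r = p' ++ ((GenSym.elt a, ε) :: (o ++ [(GenSym.elt a, ε)]) ++ q')) : p.length = p'.length := by
  cases ε with
  | true => exact chain_once (.ac a) (h1 rfl) e1 e2
  | false =>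
    have := chain_once (.ac a) (h2 rfl) (o := iW o) (p := iW q) (p' := iW q') (q := iW p) (q' := iW p') (by rw [e1]; simp [iL]) (by rw [e2]; simp [iL])
    have l1 := congrArg List.length e1
    have l2 := congrArg List.length e2
    simp at l1 l2 this
    omega

theorem cp_pos {m : ℤ} {α : Type} (c : α) (h : 0 < m) : cp c m = replicate m.natAbs (c, true) := by simp [cp, h]
theorem iW_rep {α : Type} (n : ℕ) (z : α × Bool) : iW (replicate n z) = replicate n (iL z) := by
  induction n with
  | zero => simp
  | succ n ih => rw [replicate_succ, iW_cons, ih, ← replicate_succ']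
theorem iW_cp_neg {m : ℤ} {α : Type} (c : α) (h : ¬ 0 < m) : iW (cp c m) = replicate m.natAbs (c, true) := by simp [cp, h, iW_rep, iL]

theorem pair_pos {a : S.A} {σ m m' : ℤ} {r p q} (hm : 0 < m) (hm' : 0 < m') (h : r ~r (chC 0 (GenSym.elt a) GenSym.c).word) (hC : Cs σ m m')
    (e : r = p ++ ((GenSym.elt a, true) :: (cp GenSym.c m ++ (GenSym.elt a, true) :: (cp GenSym.c m' ++ (GenSym.elt a, true) :: q)))) : σ = 0 := by
  rw [cp_pos _ hm, cp_pos _ hm'] at e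
  have := chain_pair (.ac a) (e := m.natAbs) (e' := m'.natAbs) (by omega) (by omega) h e
  have a1 : ((m.natAbs : ℕ) : ℤ) = m := by omega
  have a2 : ((m'.natAbs : ℕ) : ℤ) = m' := by omega
  rcases this with ⟨k, hk, e1, e2⟩ | ⟨e1, e2⟩
  · have b1 : m = (1 + (k : ℤ)) ^ 2 := by rw [← a1, e1]; push_cast; ring
    have b2 : m' = (1 + ((k : ℤ) + 1)) ^ 2 := by rw [← a2, e2]; push_cast; ring
    have b3 : m' - m = 2 * k + 3 := by rw [b1, b2]; ring
    rcases hC with ⟨j, hj, c1, c2⟩ | ⟨c1, c2⟩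
    · have c3 : m' - m = 2 * j + 3 := by rw [c1, c2]; ring
      have : j = k := by omega
      subst this
      linarith
    · omega
  · rcases hC with ⟨j, hj, c1, c2⟩ | ⟨c1, c2⟩
    · have c3 : m' - m = 2 * j + 3 := by rw [c1, c2]; ring
      omega
    · omega

theorem pair_neg {a : S.A} {m m' : ℤ} {r p q} (hm : m < 0) (hm' : m' < 0) (h : iW r ~r (chC 0 (GenSym.elt a) GenSym.c).word)
    (e : r = p ++ ((GenSym.elt a, false) :: (cp GenSym.c m ++ (GenSym.elt a, false) :: (cp GenSym.c m' ++ (GenSym.elt a, false) :: q)))) :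
    (∃ k : ℕ, k + 1 < 1000 ∧ m' = -(1 + (k : ℤ)) ^ 2 ∧ m = -(1 + ((k : ℤ) + 1)) ^ 2) ∨ (m' = -1000 ^ 2 ∧ m = -1) := by
  have e2 := congrArg iW e
  simp [iL, iW_cp_neg _ hm.not_gt, iW_cp_neg _ hm'.not_gt] at e2
  have := chain_pair (.ac a) (e := m'.natAbs) (e' := m.natAbs) (by omega) (by omega) h e2
  have a1 : ((m.natAbs : ℕ) : ℤ) = -m := by omega
  have a2 : ((m'.natAbs : ℕ) : ℤ) = -m' := by omega
  rcases this with ⟨k, hk, e1, e2⟩ | ⟨e1, e2⟩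
  · left
    refine ⟨k, hk, ?_, ?_⟩
    · have : -m' = (1 + (k : ℤ)) ^ 2 := by rw [← a2, e1]; push_cast; ring
      linarith
    · have : -m = (1 + ((k : ℤ) + 1)) ^ 2 := by rw [← a1, e2]; push_cast; ring
      linarith
  · right; omega

theorem neg_contra {σ m m' m'' : ℤ} (h1 : Cs σ m m') (h2 : Cs σ m' m'') 
   (k1 : (∃ k : ℕ, k + 1 < 1000 ∧ m' = -(1 + (k : ℤ)) ^ 2 ∧ m = -(1 + ((k : ℤ) + 1)) ^ 2) ∨ (m' = -1000 ^ 2 ∧ m = -1))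
   (k2 : (∃ k : ℕ, k + 1 < 1000 ∧ m'' = -(1 + (k : ℤ)) ^ 2 ∧ m' = -(1 + ((k : ℤ) + 1)) ^ 2) ∨ (m'' = -1000 ^ 2 ∧ m' = -1)) : False := by
  rcases h2 with ⟨j, hj, c1, c2⟩ | ⟨c1, c2⟩ <;> rcases k2 with ⟨l, hl, d1, d2⟩ | ⟨d1, d2⟩ <;>
  rcases h1 with ⟨i, hi, a1, a2⟩ | ⟨a1, a2⟩ <;> rcases k1 with ⟨k, hk, b1, b2⟩ | ⟨b1, b2⟩ <;> nlinarith
end SC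

set_option linter.unusedSectionVars false
set_option linter.unusedSimpArgs false
namespace SC
open List
variable {S : IndexedStructure} {p₁ p₂ : ℕ}

theorem Rp_infix_run (hb₁ : 10 ^ 10 < p₁) (hb₂ : 10 ^ 10 < p₂) {r p q} {m : ℤ} (hr : r ∈ Rp S p₁ p₂) (e : r = p ++ (cp GenSym.c m ++ q)) :
    100 * m.natAbs ≤ r.length := by
  have := Rp_run (y := GenSym.c) (Or.inl rfl) hb₁ hb₂ (u := cp GenSym.c m) (t := q ++ p) (fun z hz => cp_mem hz) (by
    have := Rp_rot (u := p) (v := cp GenSym.c m ++ q) (e ▸ hr)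
    simpa using this)
  rw [e]; simp at this ⊢; omega

theorem caseB2 (hb₁ : 10 ^ 10 < p₁) (hb₂ : 10 ^ 10 < p₂) {r T Y P t g z Y1 Y2 ms} {σ m m' : ℤ} {f : FreeGroup (GenSym S.A) →* GA S p₁ p₂} {γ}
    (hr : r ∈ Rp S p₁ p₂) (hf : ev f r = 1) (hY : Y = g ++ (z ++ iW g)) (hz : z ≠ []) (hHN : HN GenSym.c Y) (hLN : LN GenSym.c Y)
    (hT : Y = Y1 ++ T) (hP : Y = P ++ Y2) (hT0 : T ≠ []) (hP0 : P ≠ [])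
    (e : r = T ++ (cp GenSym.c m ++ (blk GenSym.c Y (m' :: ms) ++ (P ++ t)))) (ht : 100 * t.length ≤ 22 * r.length) (hlr : 15000 ≤ r.length)
    (hm : m ≠ 0) (hm' : m' ≠ 0) (hms : ∀ n ∈ ms, n ≠ 0) (hC : Cs σ m m') (hC' : ∀ m'' ms', ms = m'' :: ms' → Cs σ m' m'') :
    Imp f γ g z ∨ (σ = 0 ∧ g = [] ∧ ∃ a, z = [(GenSym.elt a, true)]) := by
  have e' := e
  rw [blk_cons] at e'
  have rm := Rp_infix_run hb₁ hb₂ hr e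
  have rm' := Rp_infix_run hb₁ hb₂ hr (p := T ++ (cp GenSym.c m ++ Y)) (q := blk GenSym.c Y ms ++ (P ++ t)) (m := m') (by rw [e']; simp)
  have hcp : cp (GenSym.c : GenSym S.A) m ≠ [] := by
    intro h; have := congrArg List.length h; simp at this; exact hm this
  obtain ⟨zc, hzc⟩ := List.exists_mem_of_ne_nil _ hcp
  have hzr : zc ∈ r := by rw [e]; simp [hzc]
  rcases Rp_class hr hzr (cp_mem hzc) with ⟨q, f', hq, tri, rfl⟩ | ⟨q, a, hq, rfl⟩
  · exfalso
    exact hC.odd (cp_le_one tri hq e) (cp_le_one tri hq (p := T ++ (cp GenSym.c m ++ Y)) (q := blk GenSym.c Y ms ++ (P ++ t)) (by rw [e']; simp)) hm hm'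
  · obtain ⟨ε, he1, he2, hlet⟩ := sgn_letters hq
    have hYr : ∀ w ∈ Y, w ∈ r := by intro w hw; rw [e']; simp [hw]
    have hg : g = [] := by
      cases g with
      | nil => rfl
      | cons l g =>
        exfalso
        have h1 := hlet l (hYr l (by rw [hY]; simp))
        have h2 := hlet (iL l) (hYr _ (by rw [hY]; simp))
        have b1 : l.2 = ε := by rcases h1 with h | h <;> rw [h]
        have b2 : (iL l).2 = ε := by rcases h2 with h | h <;> rw [h]
        simp [iL] at b2
        rw [b1] at b2
        cases ε <;> simp at b2
    have hYz : Y = z := by rw [hY, hg]; simp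
    have hY0 : Y ≠ [] := by rw [hYz]; exact hz
    -- head and last of Y
    have nonc : ∀ w ∈ Y, w.1 ≠ GenSym.c → w = (GenSym.elt a, ε) := by
      intro w hw h
      rcases hlet w (hYr w hw) with h' | h'
      · exact h'
      · rw [h'] at h; exact absurd rfl h
    obtain ⟨y0, Y0, hy0⟩ := List.exists_cons_of_ne_nil hY0
    have hy0' : y0 = (GenSym.elt a, ε) := nonc y0 (by rw [hy0]; simp) (hHN _ _ hy0)
    rw [hy0'] at hy0
    by_cases hY00 : Y0 = []
    · rw [hY00] at hy0
      have hlY : Y.length = 1 := by rw [hy0]; rfl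
      have hT1 : T = [(GenSym.elt a, ε)] := by
        have := List.length_pos_iff.2 hT0
        have h2 := congrArg List.length hT
        simp [hlY] at h2
        have : Y1 = [] := List.length_eq_zero_iff.1 (by omega)
        rw [this] at hT; rw [← hy0, hT]; simp
      have hP1 : P = [(GenSym.elt a, ε)] := by
        have := List.length_pos_iff.2 hP0
        have h2 := congrArg List.length hP
        simp [hlY] at h2
        have : Y2 = [] := List.length_eq_zero_iff.1 (by omega)
        rw [this] at hP; rw [← hy0, hP]; simp
      right
      cases ms with
      | nil =>
        exfalso
        have := congrArg List.length e'
        simp [hT1, hP1, hlY] at this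
        omega
      | cons m'' ms =>
        have e3 : r = [] ++ ((GenSym.elt a, ε) :: (cp GenSym.c m ++ (GenSym.elt a, ε) :: (cp GenSym.c m' ++ (GenSym.elt a, ε) :: (cp GenSym.c m'' ++ (blk GenSym.c Y ms ++ (P ++ t)))))) := by
          rw [e', hT1]; simp [hy0]
        obtain ⟨q, hq⟩ : ∃ q, blk GenSym.c Y ms ++ (P ++ t) = (GenSym.elt a, ε) :: q := by
          cases ms with
          | nil => exact ⟨t, by simp [hP1]⟩
          | cons n ms => exact ⟨cp GenSym.c n ++ (blk GenSym.c Y ms ++ (P ++ t)), by simp [hy0]⟩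
        have sg : ∀ n p q, n ≠ 0 → r = p ++ (cp GenSym.c n ++ q) → decide (0 < n) = ε := by
          intro n p q hn e
          have : (GenSym.c, decide (0 < n)) ∈ r := by
            rw [e, cp, List.mem_append, List.mem_append, List.mem_replicate]
            exact Or.inr (Or.inl ⟨by omega, rfl⟩)
          rcases hlet _ this with h | h
          · cases h
          · exact congrArg Prod.snd h
        have s1 := sg m _ _ hm e
        have s2 := sg m' (T ++ (cp GenSym.c m ++ Y)) (blk GenSym.c Y (m'' :: ms) ++ (P ++ t)) hm' (by rw [e']; simp)
        have s3 := sg m'' (T ++ (cp GenSym.c m ++ (Y ++ (cp GenSym.c m' ++ Y)))) (blk GenSym.c Y ms ++ (P ++ t)) (hms m'' (by simp)) (by rw [e']; simp)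
        rw [hq] at e3
        cases ε with
        | true =>
          simp at s1 s2 s3
          exact ⟨pair_pos s1 s2 (he1 rfl) hC e3, hg, a, by rw [← hYz, hy0]⟩
        | false =>
          exfalso
          simp at s1 s2 s3
          have n3 := hms m'' (by simp)
          have k1 := pair_neg (by omega) (by omega) (he2 rfl) e3
          have k2 := pair_neg (m := m') (m' := m'') (p := (GenSym.elt a, false) :: cp GenSym.c m) (q := q) (by omega) (by omega) (he2 rfl) (by rw [e3]; simp)
          exact neg_contra hC (hC' _ _ rfl) k1 k2
    · obtain ⟨o, w, how⟩ := List.eq_nil_or_concat Y0 |>.resolve_left hY00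
      have hw : w = (GenSym.elt a, ε) := nonc w (by rw [hy0, how]; simp) (hLN w ((GenSym.elt a, ε) :: o) (by rw [hy0, how]; simp))
      rw [how, hw] at hy0
      cases ms with
      | cons m'' ms =>
        exfalso
        have := sgn_once he1 he2 (p := T ++ cp GenSym.c m) (o := o) (q := cp GenSym.c m' ++ (blk GenSym.c Y (m'' :: ms) ++ (P ++ t)))
          (p' := T ++ (cp GenSym.c m ++ (Y ++ cp GenSym.c m'))) (q' := cp GenSym.c m'' ++ (blk GenSym.c Y ms ++ (P ++ t)))
          (by have h := e'; nth_rw 1 [hy0] at h; rw [h]; simp) (by 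
            have h := e'; rw [blk_cons] at h; nth_rw 2 [hy0] at h; rw [h]; simp)
        have := List.length_pos_iff.2 hY0
        simp at *
        omega
      | nil =>
        left
        rw [blk_nil, List.append_nil, List.append_assoc] at e'
        have fT := Rp_two hb₁ hb₂ hr hzr (cp_mem hzc) (o := T) (p := []) (q := cp GenSym.c m ++ (Y ++ (cp GenSym.c m' ++ (P ++ t)))) (p' := T ++ (cp GenSym.c m ++ Y1))
          (q' := cp GenSym.c m' ++ (P ++ t)) (by rw [e']; simp) (by have h := e'; nth_rw 1 [hT] at h; rw [h]; simp) (by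
            have := List.length_pos_iff.2 hT0; simp; omega)
        have fP := Rp_two hb₁ hb₂ hr hzr (cp_mem hzc) (o := P) (p := T ++ cp GenSym.c m) (q := Y2 ++ (cp GenSym.c m' ++ (P ++ t))) (p' := T ++ (cp GenSym.c m ++ (Y ++ cp GenSym.c m')))
          (q' := t) (by have h := e'; nth_rw 1 [hP] at h; rw [h]; simp) (by rw [e']; simp) (by
            have := List.length_pos_iff.2 hY0; simp; omega)
        have hl := congrArg List.length e'
        simp at hl
        refine .mk0 [] (iW (cp GenSym.c m' ++ (P ++ t) ++ (T ++ cp GenSym.c m))) (by rw [hg, ← hYz]; simp; omega) ?_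
        rw [e'] at hf
        simp only [ev_append] at hf
        rw [hg, ← hYz]
        simp only [ev_append, ev_iW, ev_nil]
        have : ev f Y = (ev f T * ev f (cp GenSym.c m))⁻¹ * (ev f (cp GenSym.c m') * (ev f P * ev f t))⁻¹ := by
          rw [eq_mul_inv_iff_mul_eq, eq_inv_iff_mul_eq_one, ← mul_eq_one_comm]
          rw [← hf]; group
        rw [this]; group
end SC

set_option linter.unusedSectionVars false
set_option linter.unusedSimpArgs false
namespace SC
open List
section
variable {α : Type} {G : Type} [Group G] {f : FreeGroup α →* G}

theorem not_chain {w : List (α × Bool)} (h : ¬ w.IsChain (fun a b => b ≠ iL a)) : ∃ p l q, w = p ++ l :: iL l :: q := by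
  induction w with
  | nil => simp at h
  | cons a w ih =>
    cases w with
    | nil => simp at h
    | cons b w =>
      rw [List.isChain_cons_cons] at h
      by_cases hb : b = iL a
      · exact ⟨[], a, w, by simp [hb]⟩
      · obtain ⟨p, l, q, e⟩ := ih (fun h' => h ⟨hb, h'⟩)
        exact ⟨a :: p, l, q, by rw [e]; simp⟩

theorem ev_cl {c : α} {l : α × Bool} (h : l.1 = c) : ∃ k : ℤ, ev f [l] = ev f [(c, true)] ^ k := by
  obtain ⟨d, b⟩ := l
  simp at h; subst h
  cases b with
  | true => exact ⟨1, by simp⟩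
  | false => exact ⟨-1, by rw [show (d, false) = iL (d, true) from rfl, ev_iL]; simp⟩

theorem iW_eq_cons {g : List (α × Bool)} {x u} (h : iW g = x :: u) : g = iW u ++ [iL x] := by
  have := congrArg iW h; simpa using this

theorem iW_chain {w : List (α × Bool)} (h : w.IsChain (fun a b => b ≠ iL a)) : (iW w).IsChain (fun a b => b ≠ iL a) := by
  by_contra hn
  obtain ⟨p, l, q, e⟩ := not_chain hn
  have e2 := congrArg iW e
  simp at e2
  rw [e2] at h
  have := h.right_of_append
  rw [List.isChain_cons_cons] at this
  exact this.1 (by simp)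

theorem Y_chain {γ : G} {g z : List (α × Bool)} (hz : z ≠ []) (h : ¬ Imp f γ g z) : (g ++ (z ++ iW g)).IsChain (fun a b => b ≠ iL a) := by
  have hg : g.IsChain (fun a b => b ≠ iL a) := by
    by_contra hn
    obtain ⟨p, l, q, e⟩ := not_chain hn
    refine h (.mk0 (p ++ q) z (by rw [e]; simp) ?_)
    rw [e, ev_append, ev_append, ev_cons, ev_cons f (iL l), ev_iL]; group
  have hz' : z.IsChain (fun a b => b ≠ iL a) := by
    by_contra hn
    obtain ⟨p, l, q, e⟩ := not_chain hn
    refine h (.mk0 g (p ++ q) (by rw [e]; simp) ?_)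
    rw [e, ev_append, ev_append, ev_cons, ev_cons f (iL l), ev_iL]; group
  rw [List.isChain_append, List.isChain_append]
  refine ⟨hg, ⟨hz', iW_chain hg, ?_⟩, ?_⟩
  · rintro x hx y hy rfl
    obtain ⟨z0, w, ew⟩ := List.eq_nil_or_concat z |>.resolve_left hz
    rw [ew] at hx; simp at hx; subst hx
    cases hg' : iW g with
    | nil => rw [hg'] at hy; simp at hy
    | cons y u =>
      rw [hg'] at hy; simp at hy; subst hy
      have e := iW_eq_cons hg'
      simp at e ew
      refine h (.mk0 (iW u) (w :: z0) (by rw [e, ew]; simp) ?_)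
      rw [e, ew, ev_cons]; simp only [ev_append]; group
  · rintro x hx y hy rfl
    cases z with
    | nil => exact hz rfl
    | cons y z0 =>
      simp at hy; subst hy
      rcases List.eq_nil_or_concat g with hg0 | ⟨g0, w, ew⟩
      · rw [hg0] at hx; simp at hx
      · rw [ew] at hx; simp at hx; subst hx
        simp at ew
        refine h (.mk0 g0 (z0 ++ [iL w]) (by rw [ew]; simp) ?_)
        rw [ew, ev_cons f (iL w)]; simp only [ev_append, ev_iL]; group

theorem Y_ends {c : α} {g z : List (α × Bool)} (hz : z ≠ []) (h : ¬ Imp f (ev f [(c, true)]) g z) : 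
    HN c (g ++ (z ++ iW g)) ∧ LN c (g ++ (z ++ iW g)) := by
  cases g with
  | nil =>
    constructor
    · intro l u e hl
      simp at e
      obtain ⟨k, hk⟩ := ev_cl (f := f) hl
      refine h ⟨[], u, k, 0, by rw [e]; simp, ?_⟩
      rw [e, ev_cons, hk]; simp
    · intro l u e hl
      simp at e
      obtain ⟨k, hk⟩ := ev_cl (f := f) hl
      refine h ⟨[], u, 0, k, by rw [e]; simp, ?_⟩
      rw [e, ev_append, hk]; simp
  | cons y g =>
    have key : y.1 ≠ c := by
      intro hl
      obtain ⟨k, hk⟩ := ev_cl (f := f) hl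
      refine h ⟨g, z, k, -k, by simp, ?_⟩
      rw [ev_cons, hk]; group
    constructor
    · intro l u e
      simp at e
      rw [← e.1]; exact key
    · intro l u e
      have e2 : (y :: g ++ (z ++ iW g)) ++ [iL y] = u ++ [l] := by rw [← e]; simp
      have := (List.append_inj' e2 rfl).2
      simp at this
      rw [← this]; exact key

theorem exists_min (γ : G) (hf : Function.Surjective f) (x : G) :
    ∃ g z : List (α × Bool), ∃ i j : ℤ, x = γ ^ i * (ev f g * ev f z * (ev f g)⁻¹) * γ ^ j ∧ ¬ Imp f γ g z := by
  have key : ∀ n, ∀ g z : List (α × Bool), ∀ i j : ℤ, g.length + z.length = n → x = γ ^ i * (ev f g * ev f z * (ev f g)⁻¹) * γ ^ j → 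
    ∃ g z : List (α × Bool), ∃ i j : ℤ, x = γ ^ i * (ev f g * ev f z * (ev f g)⁻¹) * γ ^ j ∧ ¬ Imp f γ g z := by
    intro n
    induction n using Nat.strong_induction_on with
    | _ n ih =>
      intro g z i j hn hx
      by_cases h : Imp f γ g z
      · obtain ⟨g', z', i', j', hl, e⟩ := h
        refine ih _ (by omega) g' z' (i + i') (j' + j) rfl ?_
        rw [hx, e, zpow_add, zpow_add]; group
      · exact ⟨g, z, i, j, hx, h⟩
  obtain ⟨w, hw⟩ := hf x
  classical
  refine key _ [] w.toWord 0 0 rfl ?_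
  have : ev f w.toWord = x := by rw [ev, FreeGroup.mk_toWord, hw]
  simp [this]

theorem conj_prod {γ y : G} {i j : ℤ} (L : List ℤ) :
    (L.map fun n => γ ^ i * y * γ ^ j * γ ^ n).prod = γ ^ i * (L.map fun n => y * γ ^ (n + (i + j))).prod * γ ^ (-i) := by
  induction L with
  | nil => simp
  | cons a L ih =>
    rw [List.map_cons, List.map_cons, List.prod_cons, List.prod_cons, ih]
    group

theorem sq_sum (σ : ℤ) (N : ℕ) : 6 * ((List.range N).map fun k : ℕ => ((k : ℤ) + 1) ^ 2 + σ).sum = N * (N + 1) * (2 * N + 1) + 6 * N * σ := by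
  induction N with
  | zero => simp
  | succ n ih =>
    rw [List.range_succ, List.map_append, List.sum_append, mul_add, ih]
    simp
    ring

theorem zpow_prod {γ : G} (L : List ℤ) : (L.map fun n => γ ^ n).prod = γ ^ L.sum := by
  induction L with
  | nil => simp
  | cons a L ih => rw [List.map_cons, List.prod_cons, ih, List.sum_cons, zpow_add]

theorem rot0 (L : List ℤ) (h : L.Nodup) : ∃ A B, L = A ++ B ∧ ∀ n ∈ (B ++ A).dropLast, n ≠ 0 := by
  by_cases h0 : (0 : ℤ) ∈ L
  · obtain ⟨A, B, e⟩ := List.append_of_mem h0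
    refine ⟨A ++ [0], B, by simp [e], ?_⟩
    intro n hn
    rw [← List.append_assoc, List.dropLast_concat] at hn
    rw [e] at h
    rintro rfl
    rw [List.nodup_append] at h
    rcases List.mem_append.1 hn with h' | h'
    · have := (List.nodup_cons.1 h.2.1).1; exact this h'
    · exact h.2.2 0 h' 0 (by simp) rfl
  · refine ⟨[], L, by simp, ?_⟩
    rintro n hn rfl
    simp at hn
    exact h0 (List.mem_of_mem_dropLast hn)
end
end SC

set_option linter.unusedSectionVars false
set_option linter.unusedSimpArgs false
namespace SC
open List
variable {S : IndexedStructure} {p₁ p₂ : ℕ}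

theorem Rp_len (hb₁ : 10 ^ 10 < p₁) (hb₂ : 10 ^ 10 < p₂) {r} (hr : r ∈ Rp S p₁ p₂) : 15000 ≤ r.length := by
  obtain ⟨q, hq, l, -⟩ := Rp_cases (s := r) (t := []) (by simpa using hr)
  have := base_len hb₁ hb₂ hq
  simp at l; omega

theorem Rp_one (hb₁ : 10 ^ 10 < p₁) (hb₂ : 10 ^ 10 < p₂) {r} (hr : r ∈ Rp S p₁ p₂) : ev (qf S p₁ p₂) r = 1 :=
  (Rp_sys hb₁ hb₂ fun _ h => qf_one h).one r hr

def Ns (σ : ℤ) : List ℤ := (List.range 1000).map fun k : ℕ => (1 + (k : ℤ)) ^ 2 + σ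

theorem Ns_nodup (σ : ℤ) : (Ns σ).Nodup := by
  unfold Ns
  apply List.Nodup.map _ List.nodup_range
  intro a b h
  simp only at h
  have : ((1 + (a : ℤ)) - (1 + b)) * ((1 + (a : ℤ)) + (1 + b)) = 0 := by linear_combination h
  rcases mul_eq_zero.1 this with h | h <;> omega

theorem Ns_cs {σ m m' : ℤ} {A B ns1 ns2} (h : Ns σ = A ++ B) (h2 : B ++ A = ns1 ++ m :: m' :: ns2) : Cs σ m m' := by
  have : Ns σ ++ Ns σ = (A ++ ns1) ++ m :: m' :: (ns2 ++ B) := by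
    rw [h]
    have : A ++ B ++ (A ++ B) = A ++ (B ++ A) ++ B := by simp
    rw [this, h2]; simp
  unfold Ns at this
  rcases consec this with ⟨k, hk, e1, e2⟩ | ⟨e1, e2⟩
  · left; refine ⟨k, hk, e1, ?_⟩; rw [e2]; push_cast; ring
  · right; rw [e1, e2]; norm_num

/-- c has infinite order -/
theorem c_inf (hb₁ : 10 ^ 10 < p₁) (hb₂ : 10 ^ 10 < p₂) {n : ℤ} (h : ev (qf S p₁ p₂) [(GenSym.c, true)] ^ n = 1) : n = 0 := by
  by_contra hn
  obtain ⟨s, t, ⟨a, b, hs⟩, hr, hl⟩ := green (S := S) hb₁ hb₂ (w := cp GenSym.c n) ((isReduced_iff _).2 (cp_red _ _)) (by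
    intro h; have := congrArg List.length h; simp at this; exact hn this) (by rw [ev_cp, h])
  have := Rp_run (y := GenSym.c) (Or.inl rfl) hb₁ hb₂ (u := s) (t := t) (fun z hz => cp_mem (n := n) (by rw [← hs]; simp [hz])) hr
  have := Rp_len hb₁ hb₂ hr
  simp at *
  omega

theorem chain_eq {x : GA S p₁ p₂} {γ : GA S p₁ p₂} (h : chainProd 0 x γ = 1) {i j : ℤ} {y} (hx : x = γ ^ i * y * γ ^ j) :
    ((Ns (i + j)).map fun n => y * γ ^ n).prod = 1 := by
  have e1 : chainProd 0 x γ = (((List.range 1000).map fun k : ℕ => (1 + (k : ℤ)) ^ 2).map fun n => γ ^ i * y * γ ^ j * γ ^ n).prod := by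
    unfold chainProd
    rw [List.map_map]
    refine congrArg List.prod (List.map_congr_left ?_)
    intro k _
    simp only [Function.comp]
    rw [hx, ← zpow_natCast]
    push_cast
    rw [zero_add, add_comm (k : ℤ) 1]
  rw [h, conj_prod] at e1
  have e2 : (Ns (i + j)).map (fun n => y * γ ^ n) = ((List.range 1000).map fun k : ℕ => (1 + (k : ℤ)) ^ 2).map fun n => y * γ ^ (n + (i + j)) := by
    unfold Ns
    rw [List.map_map, List.map_map]
    rfl
  rw [e2]
  generalize (map (fun n => y * γ ^ (n + (i + j))) (map (fun k : ℕ => (1 + (k : ℤ)) ^ 2) (range 1000))).prod = Q at e1 ⊢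
  have : Q = γ ^ (-i) * (γ ^ i * Q * γ ^ (-i)) * γ ^ i := by group
  rw [this, ← e1]; group

theorem main1 (hb₁ : 10 ^ 10 < p₁) (hb₂ : 10 ^ 10 < p₂) (x : GA S p₁ p₂) (hc : chainProd 0 x (ev (qf S p₁ p₂) [(GenSym.c, true)]) = 1) :
    ∃ (i : ℤ) (a : S.A), x = ev (qf S p₁ p₂) [(GenSym.c, true)] ^ i * ev (qf S p₁ p₂) [(GenSym.elt a, true)] * ev (qf S p₁ p₂) [(GenSym.c, true)] ^ (-i) := by
  obtain ⟨g, z, i, j, hx, hImp⟩ := exists_min (f := qf S p₁ p₂) (ev (qf S p₁ p₂) [(GenSym.c, true)]) (PresentedGroup.mk_surjective _) x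
  have hprod := chain_eq hc hx
  have hz : z ≠ [] := by
    rintro rfl
    simp only [ev_nil, mul_one, mul_inv_cancel, one_mul] at hprod
    rw [zpow_prod] at hprod
    have h0 := c_inf hb₁ hb₂ hprod
    have h1 := sq_sum (i + j) 1000
    have : ((List.range 1000).map fun k : ℕ => ((k : ℤ) + 1) ^ 2 + (i + j)) = Ns (i + j) := by
      unfold Ns; refine List.map_congr_left fun k _ => by rw [add_comm (k : ℤ) 1]
    rw [this, h0] at h1
    push_cast at h1
    omega
  obtain ⟨hHN, hLN⟩ := Y_ends hz hImp
  have hch := Y_chain hz hImp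
  have hY0 : g ++ (z ++ iW g) ≠ [] := by simp [hz]
  have hYe : ev (qf S p₁ p₂) g * ev (qf S p₁ p₂) z * (ev (qf S p₁ p₂) g)⁻¹ = ev (qf S p₁ p₂) (g ++ (z ++ iW g)) := by simp [mul_assoc]
  rw [hYe] at hprod
  generalize hY : g ++ (z ++ iW g) = Y at *
  obtain ⟨A, B, hAB, hnz⟩ := rot0 (Ns (i + j)) (Ns_nodup _)
  have hone : ev (qf S p₁ p₂) (blk GenSym.c Y (B ++ A)) = 1 := by
    rw [hAB, ← ev_blk, blk_append, ev_append] at hprod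
    rw [blk_append, ev_append]
    exact mul_eq_one_comm.1 hprod
  have hns0 : B ++ A ≠ [] := by
    intro h
    have h1 := congrArg List.length hAB
    have h2 := congrArg List.length h
    simp [Ns] at h1 h2
    rw [h2.1, h2.2] at h1; simp at h1
  obtain ⟨s, t, ⟨pa, pb, hs⟩, hr, hl⟩ := green hb₁ hb₂ (w := blk GenSym.c Y (B ++ A)) ((isReduced_iff _).2 (blk_red hY0 hch hHN hLN hnz)) (by
    obtain ⟨n, ns, h⟩ := List.exists_cons_of_ne_nil hns0
    rw [h, blk_cons]; simp [hY0]) hone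
  obtain ⟨u, s0, v, hs0, hu, hv, hh0, hl0⟩ := strip GenSym.c s
  have hlu := Rp_run (y := GenSym.c) (Or.inl rfl) hb₁ hb₂ (u := u) (t := s0 ++ v ++ t) hu (by rw [hs0] at hr; simpa using hr)
  have hlv := Rp_run (y := GenSym.c) (Or.inl rfl) hb₁ hb₂ (u := v) (t := t ++ (u ++ s0)) hv (by
    have := Rp_rot (u := u ++ s0) (v := v ++ t) (by rw [hs0] at hr; simpa using hr)
    simpa using this)
  have hr0 : s0 ++ (v ++ (t ++ u)) ∈ Rp S p₁ p₂ := by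
    have := Rp_rot (u := u) (v := s0 ++ (v ++ t)) (by rw [hs0] at hr; simpa using hr)
    simpa using this
  rw [hs0] at hl
  have hlr := Rp_len hb₁ hb₂ hr0
  have hlt : 100 * (v ++ (t ++ u)).length ≤ 22 * (s0 ++ (v ++ (t ++ u))).length := by
    simp at *; omega
  generalize hrr : s0 ++ (v ++ (t ++ u)) = r at *
  generalize v ++ (t ++ u) = t0 at *
  have hone0 := Rp_one hb₁ hb₂ hr0
  have hlen := congrArg List.length hrr
  simp at hlen
  have hs00 : s0 ≠ [] := by
    rintro rfl; simp at hlen; omega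
  rcases blk_inner hs00 hh0 hl0 (p := pa ++ u) (q := v ++ pb) (Y := Y) (ns := B ++ A) (by rw [← hs, hs0]; simp) with
    ⟨y1, y2, hy⟩ | ⟨ns1, m, ms, n, ns2, T, P, Y1, Y2, hns, hT, hP, hT0, hP0, hsT⟩
  · exfalso
    refine hImp (G0 (t := t0) hz (hY.trans hy) (by rw [← ev_append, hrr, hone0]) (by omega) ?_)
    intro o a1 b1 a2 b2 h1 h2
    exact Rp_mixed hr0 (p := a1) (o := o) (q := b1 ++ t0) (p' := a2) (q' := b2 ++ t0) (by rw [← hrr]; nth_rw 1 [h1]; simp) (by rw [← hrr]; nth_rw 1 [h2]; simp)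
  · have hnz' : ∀ k ∈ m :: ms, k ≠ 0 := by
      intro k hk
      apply hnz
      rw [hns, show ns1 ++ (m :: (ms ++ n :: ns2)) = (ns1 ++ (m :: ms)) ++ (n :: ns2) by simp, List.dropLast_append_of_ne_nil (by simp)]
      simp only [List.mem_append]; exact Or.inl (Or.inr hk)
    have hm := hnz' m (by simp)
    have er : r = T ++ (cp GenSym.c m ++ (blk GenSym.c Y ms ++ (P ++ t0))) := by rw [← hrr, hsT]; simp
    cases ms with
    | nil =>
      exfalso
      have hcr : ((GenSym.c : GenSym S.A), decide (0 < m)) ∈ r := by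
        rw [er, cp, List.mem_append, List.mem_append, List.mem_replicate]
        exact Or.inr (Or.inl ⟨by omega, rfl⟩)
      have hrun := Rp_infix_run hb₁ hb₂ hr0 er
      refine hImp (G1 (r := r) (t := t0) (C := cp GenSym.c m) (n := m) hz (hY.trans hP) (hY.trans hT) (by simpa using er) hone0 (ev_cp _ _) (by simpa using hrun) hlt hlr ?_ ?_)
      · intro o a1 b1 a2 b2 h1 h2
        exact Rp_mixed hr0 h1 h2
      · intro o a1 b1 a2 b2 h1 h2 hlt
        exact Rp_two hb₁ hb₂ hr0 hcr rfl h1 h2 hlt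
    | cons m' ms =>
      have hC : Cs (i + j) m m' := Ns_cs hAB (ns1 := ns1) (ns2 := ms ++ n :: ns2) (by rw [hns]; simp)
      have hC' : ∀ m'' ms', ms = m'' :: ms' → Cs (i + j) m' m'' := by
        rintro m'' ms' rfl
        exact Ns_cs hAB (ns1 := ns1 ++ [m]) (ns2 := ms' ++ n :: ns2) (by rw [hns]; simp)
      rcases caseB2 (γ := ev (qf S p₁ p₂) [(GenSym.c, true)]) hb₁ hb₂ hr0 hone0 hY.symm hz hHN hLN hT hP hT0 hP0 er hlt hlr hm (hnz' m' (by simp)) (fun k hk => hnz' k (by simp [hk])) hC hC' with h | ⟨hσ, hg, a, hza⟩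
      · exact absurd h hImp
      · refine ⟨i, a, ?_⟩
        rw [hx, hg, hza, show j = -i by omega]
        simp
end SC

set_option linter.unusedSectionVars false
set_option linter.unusedSimpArgs false
namespace SC
open List
variable {S : IndexedStructure} {p₁ p₂ : ℕ}

theorem short_core {α : Type} {c : α} {s : List (α × Bool)} (hh : HN c s) (hl : LN c s) {X Z u v : List (α × Bool)} {e}
    (hX : ∀ z ∈ X, z.1 = c) (hZ : ∀ z ∈ Z, z.1 = c) (h : X ++ e :: Z = u ++ (s ++ v)) : s.length ≤ 1 := by
  classical
  have h1 := congrArg (List.countP (fun z => decide (z.1 ≠ c))) h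
  have hX0 : X.countP (fun z => decide (z.1 ≠ c)) = 0 := by
    rw [List.countP_eq_zero]; intro z hz; simpa using hX z hz
  have hZ0 : Z.countP (fun z => decide (z.1 ≠ c)) = 0 := by
    rw [List.countP_eq_zero]; intro z hz; simpa using hZ z hz
  rw [List.countP_append, List.countP_append, List.countP_append, List.countP_cons, hX0, hZ0] at h1
  rcases s with _ | ⟨a, s⟩
  · simp
  · rcases List.eq_nil_or_concat s with rfl | ⟨s', b, rfl⟩
    · simp
    · exfalso
      have ha := hh a _ rfl
      have hb := hl b (a :: s') (by simp)
      simp only [List.concat_eq_append, List.countP_cons, List.countP_append, List.countP_nil, ha, hb, ne_eq, not_false_eq_true, decide_true, if_true] at h1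
      split at h1 <;> omega

theorem main2 (hb₁ : 10 ^ 10 < p₁) (hb₂ : 10 ^ 10 < p₂) {x : GA S p₁ p₂} (hd : chainProd 0 x (ev (qf S p₁ p₂) [(GenSym.d, true)]) = 1)
    {i : ℤ} {a : S.A} (hx : x = ev (qf S p₁ p₂) [(GenSym.c, true)] ^ i * ev (qf S p₁ p₂) [(GenSym.elt a, true)] * ev (qf S p₁ p₂) [(GenSym.c, true)] ^ (-i)) : i = 0 := by
  by_contra hi
  obtain ⟨Y, hY⟩ : ∃ Y : List (Ltr S), Y = cp GenSym.c i ++ (GenSym.elt a, true) :: cp GenSym.c (-i) := ⟨_, rfl⟩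
  have hxY : x = ev (qf S p₁ p₂) Y := by
    have e : Y = cp GenSym.c i ++ ([(GenSym.elt a, true)] ++ cp GenSym.c (-i)) := hY
    have e2 := congrArg (ev (qf S p₁ p₂)) e
    rw [ev_append, ev_append, ev_cp, ev_cp, ← mul_assoc] at e2
    exact hx.trans e2.symm
  have hprod := chain_eq hd (i := 0) (j := 0) (y := ev (qf S p₁ p₂) Y) (by rw [hxY]; simp)
  rw [← ev_blk] at hprod
  have hY0 : Y ≠ [] := by rw [hY]; simp
  have hfirst : ∀ z u, Y = z :: u → z.1 = GenSym.c := by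
    intro z u e
    have : cp (GenSym.c : GenSym S.A) i ≠ [] := by
      intro h; have := congrArg List.length h; simp at this; exact hi this
    obtain ⟨z', u', h⟩ := List.exists_cons_of_ne_nil this
    rw [hY, h] at e
    simp only [List.cons_append, List.cons.injEq] at e
    rw [← e.1]; exact cp_mem (n := i) (by rw [h]; simp)
  have hlast : ∀ z u, Y = u ++ [z] → z.1 = GenSym.c := by
    intro z u e
    have : cp (GenSym.c : GenSym S.A) (-i) ≠ [] := by
      intro h; have := congrArg List.length h; simp at this; exact hi this
    rcases List.eq_nil_or_concat (cp (GenSym.c : GenSym S.A) (-i)) with h | ⟨u', z', h⟩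
    · exact absurd h this
    rw [hY, h] at e
    have e' : (cp (GenSym.c : GenSym S.A) i ++ (GenSym.elt a, true) :: u') ++ [z'] = u ++ [z] := by simpa using e
    have := (List.append_inj' e' rfl).2
    simp only [List.cons.injEq, and_true] at this
    rw [← this]; exact cp_mem (n := -i) (by rw [h]; simp)
  have hHN : HN GenSym.d Y := by
    intro z u e h; rw [hfirst z u e] at h; cases h
  have hLN : LN GenSym.d Y := by
    intro z u e h; rw [hlast z u e] at h; cases h
  have key : ∀ z w : Ltr S, z.1 ≠ w.1 → w ≠ iL z := by
    rintro z w h rfl; simp [iL] at h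
  have hch : Y.IsChain (fun a b => b ≠ iL a) := by
    rw [hY, List.isChain_append]
    refine ⟨cp_red _ _, ?_, ?_⟩
    · rw [← List.singleton_append, List.isChain_append]
      refine ⟨by simp, cp_red _ _, ?_⟩
      intro z hz w hw
      apply key
      simp at hz
      rw [cp_mem (List.mem_of_mem_head? hw), ← hz]; simp
    · intro z hz w hw
      apply key
      simp at hw
      rw [cp_mem (List.mem_of_mem_getLast? hz), ← hw]; simp
  have hpos : ∀ n ∈ Ns 0, n ≠ 0 := by
    intro n hn
    unfold Ns at hn
    obtain ⟨k, -, rfl⟩ := List.mem_map.1 hn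
    positivity
  have hns0 : Ns 0 ≠ [] := by
    intro h
    have h1 := congrArg List.length h
    simp [Ns] at h1
  rw [add_zero] at hprod
  obtain ⟨s, t, ⟨pa, pb, hs⟩, hr, hl⟩ := green hb₁ hb₂ (w := blk GenSym.d Y (Ns 0)) ((isReduced_iff _).2 (blk_red hY0 hch hHN hLN (fun n hn => hpos n (List.dropLast_subset _ hn)))) (by
    obtain ⟨n, ns, h⟩ := List.exists_cons_of_ne_nil hns0
    rw [h, blk_cons]; simp [hY0]) hprod
  obtain ⟨u, s0, v, hs0, hu, hv, hh0, hl0⟩ := strip GenSym.d s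
  have hlu := Rp_run (y := GenSym.d) (Or.inr rfl) hb₁ hb₂ (u := u) (t := s0 ++ v ++ t) hu (by rw [hs0] at hr; simpa using hr)
  have hlv := Rp_run (y := GenSym.d) (Or.inr rfl) hb₁ hb₂ (u := v) (t := t ++ (u ++ s0)) hv (by
    have := Rp_rot (u := u ++ s0) (v := v ++ t) (by rw [hs0] at hr; simpa using hr)
    simpa using this)
  have hr0 : s0 ++ (v ++ (t ++ u)) ∈ Rp S p₁ p₂ := by
    have := Rp_rot (u := u) (v := s0 ++ (v ++ t)) (by rw [hs0] at hr; simpa using hr)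
    simpa using this
  rw [hs0] at hl
  have hlr := Rp_len hb₁ hb₂ hr0
  have hlt : 100 * (v ++ (t ++ u)).length ≤ 22 * (s0 ++ (v ++ (t ++ u))).length := by
    simp at *; omega
  generalize v ++ (t ++ u) = t0 at *
  have hs00 : s0 ≠ [] := by
    rintro rfl; simp at hlt hlr; omega
  rcases blk_inner hs00 hh0 hl0 (p := pa ++ u) (q := v ++ pb) (Y := Y) (ns := Ns 0) (by rw [← hs, hs0]; simp) with
    ⟨y1, y2, hy⟩ | ⟨ns1, m, ms, n, ns2, T, P, Y1, Y2, hns, hT, hP, hT0, hP0, hsT⟩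
  · obtain ⟨u1, s1, v1, hs1, hu1, hv1, hh1, hl1⟩ := strip GenSym.c s0
    have h1 := short_core hh1 hl1 (u := y1 ++ u1) (v := v1 ++ y2) (fun z hz => cp_mem hz) (fun z hz => cp_mem hz) (hY.symm.trans (hy.trans (by rw [hs1]; simp)))
    have hr1 := hr0
    rw [hs1] at hr1
    have hlu1 := Rp_run (y := GenSym.c) (Or.inl rfl) hb₁ hb₂ (u := u1) (t := s1 ++ v1 ++ t0) hu1 (by simpa using hr1)
    have hlv1 := Rp_run (y := GenSym.c) (Or.inl rfl) hb₁ hb₂ (u := v1) (t := t0 ++ (u1 ++ s1)) hv1 (by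
      have := Rp_rot (u := u1 ++ s1) (v := v1 ++ t0) (by simpa using hr1)
      simpa using this)
    have hlen := congrArg List.length hs1
    simp only [List.length_append] at *
    omega
  · have hm : m ≠ 0 := hpos m (by rw [hns]; simp)
    rcases List.eq_nil_or_concat T with h | ⟨T', z, hTz⟩
    · exact hT0 h
    rw [List.concat_eq_append] at hTz
    have hz := hlast z (Y1 ++ T') (by rw [hT, hTz]; simp)
    refine Rp_ncd hr0 (z := z) (w := (GenSym.d, decide (0 < m))) ?_ ?_ hz rfl
    · rw [hsT, hTz]; simp
    · rw [hsT, cp]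
      simp only [List.mem_append, List.mem_replicate]
      exact Or.inl (Or.inr (Or.inl ⟨by omega, trivial⟩))

theorem final (S : IndexedStructure) (p₁ p₂ : ℕ)
    (hbig₁ : 10 ^ 10 < p₁) (hbig₂ : 10 ^ 10 < p₂)
    (x : GA S p₁ p₂)
    (hc : chainProd 0 x (gen S p₁ p₂ GenSym.c) = 1)
    (hd : chainProd 0 x (gen S p₁ p₂ GenSym.d) = 1) :
    ∃ a : S.A, x = gen S p₁ p₂ (GenSym.elt a) := by
  have hg : ∀ g, gen S p₁ p₂ g = ev (qf S p₁ p₂) [(g, true)] := fun g => rfl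
  rw [hg] at hc hd
  obtain ⟨i, a, hx⟩ := main1 hbig₁ hbig₂ x hc
  have hi := main2 hbig₁ hbig₂ hd hx
  refine ⟨a, ?_⟩
  rw [hg, hx, hi]; simp
end SC

/-- Lemma `lem:uu`(1): in `G(𝒜)`, if `u_A(x,c) = e` and `u_A(x,d) = e`,
then `x` is the image of one of the generators `a` with `a ∈ A`. -/
theorem stmt_0 (S : IndexedStructure) (p₁ p₂ : ℕ)
    (hp₁ : p₁.Prime) (hp₂ : p₂.Prime) (hne : p₁ ≠ p₂)
    (hbig₁ : 10 ^ 10 < p₁) (hbig₂ : 10 ^ 10 < p₂)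
    (x : GA S p₁ p₂)
    (hc : chainProd 0 x (gen S p₁ p₂ GenSym.c) = 1)
    (hd : chainProd 0 x (gen S p₁ p₂ GenSym.d) = 1) :
    ∃ a : S.A, x = gen S p₁ p₂ (GenSym.elt a) := by
  exact SC.final S p₁ p₂ hbig₁ hbig₂ x hc hd
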